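/- Let d ≥ 2, S(d) = 2⌊d²/2⌋, c ∈ (1, 1+c₂(d)), and let τ be as follows: τ(n) = (c/σ(b)) m^{d−1/c} if Wn−b = m^d for some m ∈ ℕ^c with m ≤ x, and τ(n) = 0 otherwise. Then ∫₀¹ |τ̂(θ)|^{S(d)} dθ ≪ x^{(d−1/c)S(d) + S(d) − d} L ≪ N^{S(d)(1 + (1−1/c)/d) − 1} L^{S(d)}, where L = log x and N = ⌊x^d/W⌋ + 1. -/

import Mathlib

open scoped BigOperators Classical
open Real

noncomputable section

/-- `e(t) = e^{2πit}`. -/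
def eC (t : ℝ) : ℂ := Complex.exp (2 * Real.pi * Complex.I * t)

/-- The Piatetski-Shapiro set `ℕ^c = {⌊n^c⌋ : n ∈ ℕ}`. -/
def PS (c : ℝ) : Set ℕ := {m | ∃ n : ℕ, 0 < n ∧ m = ⌊(n : ℝ) ^ c⌋₊}

/-- The Fourier transform `f̂(α) = ∑_{n ∈ ℤ} f(n) e(αn)` of a finitely
supported function on `ℤ`. -/
def FT (f : ℤ → ℂ) (α : ℝ) : ℂ := ∑ᶠ n : ℤ, f n * eC (α * n)

/-- `w = (1/2) log log x`. -/
def wps (x : ℕ) : ℝ := Real.log (Real.log x) / 2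

/-- `W = 4 d³ ∏_{p ≤ w} p`. -/
def Wps (d x : ℕ) : ℕ :=
  4 * d ^ 3 * ∏ p ∈ Finset.filter Nat.Prime (Finset.Iic ⌊wps x⌋₊), p

/-- `σ(b) = #{z ∈ [W] : z^d ≡ -b (mod W)}`. -/
def sigmaPS (d W b : ℕ) : ℕ :=
  ((Finset.Icc 1 W).filter fun z => (z ^ d + b) % W = 0).card

/-- `N = ⌊x^d / W⌋ + 1`. -/
def Nps (d x : ℕ) : ℕ := ⌊(x : ℝ) ^ d / (Wps d x : ℝ)⌋₊ + 1

/-- `b ∈ [W]` and `-b ∈ (ℤ/Wℤ)^{×d}`. -/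
def bSpec (d x b : ℕ) : Prop :=
  b ∈ Finset.Icc 1 (Wps d x) ∧
    ∃ z : (ZMod (Wps d x))ˣ, (z : ZMod (Wps d x)) ^ d = -(b : ZMod (Wps d x))

/-- `S(d) = 2⌊d²/2⌋`. -/
def Sd (d : ℕ) : ℕ := 2 * (d ^ 2 / 2)

def hD (d : ℕ) : ℝ := 1 / ((d : ℝ) * ((d : ℝ) + 1) ^ 2 - 1)
def kD (d : ℕ) : ℝ := 2 / (27 * (d : ℝ) ^ 2 - 14)
def lD (d : ℕ) : ℝ := 2 / (27 * (d : ℝ) ^ 2 - 5)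

/-- `θ(d, c)`. -/
def θdc (d : ℕ) (c : ℝ) : ℝ :=
  if d = 2 then (4 * c + 7) / 13
  else if d = 3 then (15 * c + 14) / 30
  else if d ≤ 11 then (1 + c) / 2 * (1 - hD d)
  else if 2 ∣ d then (1 + c) / 2 * (1 - kD d)
  else (1 + c) / 2 * (1 - lD d)

/-- `c₂(d)`. -/
def c2ps (d : ℕ) : ℝ :=
  if d = 2 then 1 / 54
  else if d = 3 then 1 / 495
  else if d ≤ 11 then 2 * hD d / (4 * (Sd d : ℝ) + 1 - hD d)
  else if 2 ∣ d then 2 * kD d / (4 * (Sd d : ℝ) + 1 - kD d)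
  else 2 * lD d / (4 * (Sd d : ℝ) + 1 - lD d)

/-- The majorant `ν = ν_b` from the density transfer lemma, characterized by
its defining property. -/
def nuSpec (d x : ℕ) (c : ℝ) (b : ℕ) (ν : ℤ → ℝ) : Prop :=
  (∀ n : ℤ, ∀ p : ℕ, p.Prime → p ∈ PS c → p ≤ x →
      (Wps d x : ℤ) * n - (b : ℤ) = (p : ℤ) ^ d →
      ν n = c * (Nat.totient (Wps d x) : ℝ) /
          ((sigmaPS d (Wps d x) b : ℝ) * (Wps d x : ℝ)) *
          (p : ℝ) ^ ((d : ℝ) - 1 / c) * Real.log p) ∧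
  (∀ n : ℤ, (¬ ∃ p : ℕ, p.Prime ∧ p ∈ PS c ∧ p ≤ x ∧
      (Wps d x : ℤ) * n - (b : ℤ) = (p : ℤ) ^ d) → ν n = 0)

/-- The majorant `τ`, characterized by its defining property. -/
def tauSpec (d x : ℕ) (c : ℝ) (b : ℕ) (τ : ℤ → ℝ) : Prop :=
  (∀ n : ℤ, ∀ m : ℕ, m ∈ PS c → m ≤ x →
      (Wps d x : ℤ) * n - (b : ℤ) = (m : ℤ) ^ d →
      τ n = c / (sigmaPS d (Wps d x) b : ℝ) * (m : ℝ) ^ ((d : ℝ) - 1 / c)) ∧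
  (∀ n : ℤ, (¬ ∃ m : ℕ, m ∈ PS c ∧ m ≤ x ∧
      (Wps d x : ℤ) * n - (b : ℤ) = (m : ℤ) ^ d) → τ n = 0)

/-- The function `μ`, characterized by its defining property. -/
def muSpec (d x : ℕ) (b : ℕ) (μ : ℤ → ℝ) : Prop :=
  (∀ n : ℤ, ∀ m : ℕ, 1 ≤ m → m ≤ x →
      (Wps d x : ℤ) * n - (b : ℤ) = (m : ℤ) ^ d →
      μ n = (m : ℝ) ^ (d - 1) / (sigmaPS d (Wps d x) b : ℝ)) ∧
  (∀ n : ℤ, (¬ ∃ m : ℕ, 1 ≤ m ∧ m ≤ x ∧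
      (Wps d x : ℤ) * n - (b : ℤ) = (m : ℤ) ^ d) → μ n = 0)

def hh : ℕ → ℕ
  | 0 => 0
  | (k+1) => hh k + (k+1)

def IsC (q M k : ℕ) (φ : Fin k → Polynomial (ZMod (q^M))) : Prop :=
  ∀ j, ∃ r, φ j = Polynomial.X^((j:ℕ)+1) + Polynomial.C (q : ZMod (q^M)) * r

def ph (q M k e : ℕ) (φ : Fin k → Polynomial (ZMod (q^M))) (x : Fin k → ZMod (q^M)) (m : ℕ) :
    ZMod (q^M) := (q : ZMod (q^M))^e * ∑ j, x j * (φ j).eval (m : ZMod (q^M))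

def EF (q M k e : ℕ) [Fact q.Prime] (φ : Fin k → Polynomial (ZMod (q^M))) (a : ℕ → ℂ) (ν : ℕ → ℕ)
    (s : Finset ℕ) (x : Fin k → ZMod (q^M)) : ℂ :=
  ∑ n ∈ s, a n * ZMod.stdAddChar (ph q M k e φ x (ν n))

def Dec (q : ℕ) [Fact q.Prime] (k N : ℕ) (K : ℝ) : Prop :=
  ∀ M e : ℕ, e + k * N ≤ M → ∀ φ, IsC q M k φ → ∀ (s : Finset ℕ) (a : ℕ → ℂ) (ν : ℕ → ℕ),
    (q:ℝ)^N * ∑ x, ‖EF q M k e φ a ν s x‖^(2 * hh k) ≤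
      K * ((q:ℝ)^N)^(hh k) * ∑ r ∈ Finset.range (q^N), ∑ x,
        ‖EF q M k e φ a ν (s.filter (fun n => ν n % q^N = r)) x‖^(2 * hh k)

lemma ph_add {q M k e : ℕ} (φ : Fin k → Polynomial (ZMod (q^M))) (x y : Fin k → ZMod (q^M)) (m : ℕ) :
    ph q M k e φ (x + y) m = ph q M k e φ x m + ph q M k e φ y m := by
  simp only [ph, Pi.add_apply, add_mul, Finset.sum_add_distrib, mul_add]

lemma norm_std {P : ℕ} [NeZero P] (t : ZMod P) : ‖ZMod.stdAddChar t‖ = 1 := by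
  exact AddChar.norm_apply _ _

lemma EF_shift {q M k e : ℕ} [Fact q.Prime] {φ : Fin k → Polynomial (ZMod (q^M))} {a : ℕ → ℂ}
    {ν : ℕ → ℕ} {s : Finset ℕ} {y : Fin k → ZMod (q^M)} {l e' : ℕ}
    {φ' : Fin l → Polynomial (ZMod (q^M))} {z : Fin l → ZMod (q^M)} {m : ℕ → ℕ} {cst : ZMod (q^M)}
    (h : ∀ n ∈ s, ph q M k e φ y (ν n) = cst + ph q M l e' φ' z (m n))
    (x : Fin k → ZMod (q^M)) :
    ‖EF q M k e φ a ν s (x + y)‖ = ‖EF q M l e' φ'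
      (fun n => a n * ZMod.stdAddChar (ph q M k e φ x (ν n))) m s z‖ := by
  have : EF q M k e φ a ν s (x + y) = ZMod.stdAddChar cst * EF q M l e' φ'
      (fun n => a n * ZMod.stdAddChar (ph q M k e φ x (ν n))) m s z := by
    unfold EF
    rw [Finset.mul_sum]
    refine Finset.sum_congr rfl fun n hn => ?_
    rw [ph_add, h n hn, AddChar.map_add_eq_mul, AddChar.map_add_eq_mul]
    ring
  rw [this, norm_mul, norm_std, one_mul]

lemma TL {q M k e l e' N' : ℕ} [Fact q.Prime] {K : ℝ} (hDec : Dec q l N' K)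
    {φ : Fin k → Polynomial (ZMod (q^M))} {a : ℕ → ℂ}
    {ν : ℕ → ℕ} {s : Finset ℕ} (he' : e' + l * N' ≤ M)
    {φ' : Fin l → Polynomial (ZMod (q^M))} (hφ' : IsC q M l φ') (m : ℕ → ℕ)
    (L : (Fin l → ZMod (q^M)) → (Fin k → ZMod (q^M))) (cst : (Fin l → ZMod (q^M)) → ZMod (q^M))
    (h : ∀ z, ∀ n ∈ s, ph q M k e φ (L z) (ν n) = cst z + ph q M l e' φ' z (m n))
    (w : (Fin k → ZMod (q^M)) → ℝ) (hw0 : ∀ x, 0 ≤ w x) (hw : ∀ x z, w (x + L z) = w x) :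
    (q:ℝ)^N' * ∑ x, w x * ‖EF q M k e φ a ν s x‖^(2 * hh l) ≤
      K * ((q:ℝ)^N')^(hh l) * ∑ r ∈ Finset.range (q^N'), ∑ x,
        w x * ‖EF q M k e φ a ν (s.filter (fun n => m n % q^N' = r)) x‖^(2 * hh l) := by
  have key : ∀ t : Finset ℕ, t ⊆ s → (Fintype.card (Fin l → ZMod (q^M)) : ℝ) *
      ∑ x, w x * ‖EF q M k e φ a ν t x‖^(2 * hh l) = ∑ x, w x * ∑ z, ‖EF q M l e' φ'
      (fun n => a n * ZMod.stdAddChar (ph q M k e φ x (ν n))) m t z‖^(2 * hh l) := by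
    intro t ht
    have h1 : ∀ z : Fin l → ZMod (q^M), ∑ x, w x * ‖EF q M k e φ a ν t x‖^(2 * hh l)
        = ∑ x, w x * ‖EF q M l e' φ'
      (fun n => a n * ZMod.stdAddChar (ph q M k e φ x (ν n))) m t z‖^(2 * hh l) := by
      intro z
      rw [← Equiv.sum_comp (Equiv.addRight (L z))]
      refine Finset.sum_congr rfl fun x _ => ?_
      rw [Equiv.coe_addRight, hw, EF_shift (fun n hn => h z n (ht hn))]
    simp only [Finset.mul_sum]
    rw [Finset.sum_comm, ← Finset.sum_comm]
    simp_rw [← Finset.mul_sum]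
    rw [← nsmul_eq_mul, ← Finset.card_univ, ← Finset.sum_const, Finset.sum_congr rfl (fun z _ => h1 z), Finset.sum_comm]
    simp_rw [← Finset.mul_sum]
  have hc : (0:ℝ) < (Fintype.card (Fin l → ZMod (q^M)) : ℝ) := by
    exact_mod_cast Fintype.card_pos
  rw [← mul_le_mul_iff_right₀ hc]
  calc _ = (q:ℝ)^N' * ((Fintype.card (Fin l → ZMod (q^M)) : ℝ) *
      ∑ x, w x * ‖EF q M k e φ a ν s x‖^(2 * hh l)) := by ring
    _ = ∑ x, w x * ((q:ℝ)^N' * ∑ z, ‖EF q M l e' φ'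
      (fun n => a n * ZMod.stdAddChar (ph q M k e φ x (ν n))) m s z‖^(2 * hh l)) := by
        rw [key s subset_rfl, Finset.mul_sum]
        refine Finset.sum_congr rfl fun x _ => by ring
    _ ≤ ∑ x, w x * (K * ((q:ℝ)^N')^(hh l) * ∑ r ∈ Finset.range (q^N'), ∑ z, ‖EF q M l e' φ'
      (fun n => a n * ZMod.stdAddChar (ph q M k e φ x (ν n))) m
        (s.filter (fun n => m n % q^N' = r)) z‖^(2 * hh l)) := by
        refine Finset.sum_le_sum fun x _ => mul_le_mul_of_nonneg_left ?_ (hw0 x)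
        exact hDec M e' he' φ' hφ' s _ m
    _ = K * ((q:ℝ)^N')^(hh l) * ∑ r ∈ Finset.range (q^N'), ∑ x, w x * ∑ z, ‖EF q M l e' φ'
      (fun n => a n * ZMod.stdAddChar (ph q M k e φ x (ν n))) m
        (s.filter (fun n => m n % q^N' = r)) z‖^(2 * hh l) := by
        rw [Finset.sum_comm, Finset.mul_sum]
        refine Finset.sum_congr rfl fun x _ => ?_
        rw [← Finset.mul_sum]; ring
    _ = K * ((q:ℝ)^N')^(hh l) * ∑ r ∈ Finset.range (q^N'),
        ((Fintype.card (Fin l → ZMod (q^M)) : ℝ) * ∑ x, w x * ‖EF q M k e φ a ν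
          (s.filter (fun n => m n % q^N' = r)) x‖^(2 * hh l)) := by
        congr 1
        refine Finset.sum_congr rfl fun r _ => ?_
        rw [key _ (Finset.filter_subset _ _)]
    _ = _ := by rw [← Finset.mul_sum]; ring

open Polynomial in
lemma PL {q M l a : ℕ} (ha : 1 ≤ a) (g : Fin l → (ZMod (q^M))[X]) (c : ZMod (q^M))
    (hdet : IsUnit (Matrix.of (fun i j : Fin l => (taylor c (g i)).coeff ((j:ℕ)+1))).det) :
    ∃ (Bz : (Fin l → ZMod (q^M)) → Fin l → ZMod (q^M)) (φ' : Fin l → (ZMod (q^M))[X])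
      (cst : (Fin l → ZMod (q^M)) → ZMod (q^M)), IsC q M l φ' ∧
      ∀ z (m : ℕ), ∑ i, Bz z i * (g i).eval (c + (q:ZMod (q^M))^a * m) =
        cst z + (q:ZMod (q^M))^(a*l) * ∑ t, z t * (φ' t).eval (m : ZMod (q^M)) := by
  set G := Matrix.of (fun i j : Fin l => (taylor c (g i)).coeff ((j:ℕ)+1)) with hG
  have hGG : G⁻¹ * G = 1 := Matrix.nonsing_inv_mul G hdet
  have hρ : ∀ i, ∃ ρ : (ZMod (q^M))[X], taylor c (g i) =
      C ((taylor c (g i)).coeff 0) + ∑ j : Fin l, C (G i j) * X^((j:ℕ)+1) + X^(l+1) * ρ := by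
    intro i
    have : X^(l+1) ∣ taylor c (g i) - (C ((taylor c (g i)).coeff 0) + ∑ j : Fin l, C (G i j) * X^((j:ℕ)+1)) := by
      rw [X_pow_dvd_iff]
      intro d hd
      rw [coeff_sub, coeff_add, finsetSum_coeff, coeff_C]
      simp only [coeff_C_mul, coeff_X_pow]
      rcases d with _ | d
      · simp
      · have hd' : d < l := by omega
        rw [Finset.sum_eq_single (⟨d, hd'⟩ : Fin l)]
        · simp [hG]
        · intro b _ hb
          have : ¬ (d + 1 = (b:ℕ) + 1) := by
            intro h; apply hb; ext; simp; omega
          rw [if_neg this, mul_zero]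
        · simp
    obtain ⟨ρ, h⟩ := this
    exact ⟨ρ, by rw [← h]; ring⟩
  choose ρ hρ using hρ
  set Q : ZMod (q^M) := (q : ZMod (q^M)) with hQ
  refine ⟨fun z i => ∑ t, z t * Q^(a*(l-1-t)) * G⁻¹ t i,
    fun t => X^((t:ℕ)+1) + C Q * (C (Q^(a*(l-t)-1)) * X^(l+1) * ∑ i, C (G⁻¹ t i) * (ρ i).comp (C (Q^a) * X)),
    fun z => ∑ i, (∑ t, z t * Q^(a*(l-1-t)) * G⁻¹ t i) * (taylor c (g i)).coeff 0,
    fun t => ⟨_, rfl⟩, ?_⟩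
  intro z m
  have hev : ∀ i, (g i).eval (c + Q^a*m) = (taylor c (g i)).coeff 0 +
      ∑ j : Fin l, G i j * (Q^a*m)^((j:ℕ)+1) + (Q^a*m)^(l+1) * (ρ i).eval (Q^a*m) := by
    intro i
    rw [add_comm c, ← taylor_eval, hρ i]
    simp [eval_finsetSum]
  simp only [hev, mul_add, Finset.sum_add_distrib, add_assoc]
  congr 1
  have h1 : ∑ i, (∑ t, z t * Q^(a*(l-1-t)) * G⁻¹ t i) * ∑ j : Fin l, G i j * (Q^a*m)^((j:ℕ)+1)
      = ∑ t : Fin l, z t * (Q^(a*l) * (m:ZMod (q^M))^((t:ℕ)+1)) := by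
    calc _ = ∑ t, ∑ j, z t * Q^(a*(l-1-t)) * (G⁻¹ * G) t j * (Q^a*m)^((j:ℕ)+1) := by
          simp_rw [Finset.sum_mul_sum]
          rw [Finset.sum_comm]
          refine Finset.sum_congr rfl fun t _ => ?_
          rw [Finset.sum_comm]
          refine Finset.sum_congr rfl fun j _ => ?_
          rw [Matrix.mul_apply, Finset.mul_sum, Finset.sum_mul]
          refine Finset.sum_congr rfl fun i _ => by ring
      _ = _ := by
          refine Finset.sum_congr rfl fun t _ => ?_
          rw [Finset.sum_eq_single t]
          · rw [hGG, Matrix.one_apply_eq, mul_pow, ← pow_mul]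
            have : a * l = a * (l-1-t) + a * ((t:ℕ)+1) := by
              rw [← mul_add]; congr 1; have := t.2; omega
            rw [this, pow_add]; ring
          · intro b _ hb
            rw [hGG, Matrix.one_apply_ne (Ne.symm hb)]; ring
          · simp
  have h2 : ∑ i, (∑ t, z t * Q^(a*(l-1-t)) * G⁻¹ t i) * ((Q^a*m)^(l+1) * (ρ i).eval (Q^a*m))
      = ∑ t : Fin l, z t * (Q^(a*l) * (Q * (Q^(a*(l-t)-1) * (m:ZMod (q^M))^(l+1) * ∑ i, G⁻¹ t i * (ρ i).eval (Q^a*m)))) := by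
    simp only [Finset.sum_mul, Finset.mul_sum]
    rw [Finset.sum_comm]
    refine Finset.sum_congr rfl fun t _ => Finset.sum_congr rfl fun i _ => ?_
    have : a * (l-1-t) + a * (l+1) = a * l + (1 + (a*(l-t) - 1)) := by
      have ht := t.2
      have h3 : 1 ≤ a * (l-t) := Nat.mul_pos ha (by omega)
      rw [Nat.add_sub_of_le h3, ← mul_add, ← mul_add]; congr 1; omega
    have h4 : Q^(a*(l-1-t)) * Q^(a*(l+1)) = Q^(a*l) * (Q * Q^(a*(l-t)-1)) := by
      rw [← pow_add, this, pow_add, pow_add, pow_one]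
    calc _ = z t * (Q^(a*(l-1-t)) * Q^(a*(l+1))) * G⁻¹ t i * ((m:ZMod (q^M))^(l+1) * (ρ i).eval (Q^a*m)) := by
            rw [mul_pow, ← pow_mul]; ring
      _ = _ := by rw [h4]; ring
  rw [h1, h2, ← Finset.sum_add_distrib, Finset.mul_sum]
  refine Finset.sum_congr rfl fun t _ => ?_
  simp [eval_finsetSum]
  ring

open Polynomial in
lemma detField {q : ℕ} [Fact q.Prime] {k l : ℕ} (hl : l ≤ k) (hk : k < q)
    (s : ZMod q) (hs : s ≠ 0 ∨ l = k) (cn : Fin l → ZMod q) :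
    (Matrix.of (fun i j : Fin l =>
      (C (cn i) + (X + C s)^(k-l+(i:ℕ)+1) : (ZMod q)[X]).coeff ((j:ℕ)+1))).det ≠ 0 := by
  intro h0
  obtain ⟨v, hv, hv0⟩ := Matrix.exists_vecMul_eq_zero_iff.mpr h0
  apply hv
  set P : (ZMod q)[X] := ∑ i : Fin l, C (v i) * (X + C s)^(k-l+(i:ℕ)+1) with hP
  have hco : ∀ d < l, P.coeff (d+1) = 0 := by
    intro d hd
    have := congrFun hv0 ⟨d, hd⟩
    simp only [Matrix.vecMul, dotProduct, Matrix.of_apply, coeff_add, coeff_C_succ, zero_add, Pi.zero_apply] at this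
    rw [hP, finsetSum_coeff]
    simpa only [coeff_C_mul] using this
  have hdv : X^l ∣ derivative P := by
    rw [X_pow_dvd_iff]
    intro d hd
    rw [coeff_derivative, hco d hd, zero_mul]
  set H : (ZMod q)[X] := ∑ i : Fin l, C (v i * ((k-l+(i:ℕ)+1 : ℕ) : ZMod q)) * (X + C s)^(i:ℕ) with hH
  have hder : derivative P = (X + C s)^(k-l) * H := by
    rw [hP, hH, derivative_sum, Finset.mul_sum]
    refine Finset.sum_congr rfl fun i _ => ?_
    rw [derivative_C_mul, derivative_X_add_C_pow]
    rw [show k-l+(i:ℕ)+1-1 = k-l+i by omega, pow_add, C_mul]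
    simp only [Nat.cast_add, Nat.cast_one, map_add, map_natCast, map_one]
    ring
  have hdvH : X^l ∣ H := by
    rcases hs with hs | hs
    · rw [hder] at hdv
      refine IsCoprime.dvd_of_dvd_mul_left ?_ hdv
      apply IsCoprime.pow
      refine ⟨-C s⁻¹, C s⁻¹, ?_⟩
      rw [mul_add, ← C_mul, inv_mul_cancel₀ hs]; simp
    · subst hs; simpa [hder] using hdv
  have hH0 : H = 0 := by
    by_contra hne
    have h1 := Polynomial.degree_le_of_dvd hdvH hne
    rw [degree_X_pow] at h1
    have h2 : H.degree < l := by
      rw [hH]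
      refine lt_of_le_of_lt (degree_sum_le _ _) ?_
      rw [Finset.sup_lt_iff (by exact_mod_cast WithBot.bot_lt_coe l)]
      intro i _
      refine lt_of_le_of_lt ((degree_mul_le _ _).trans (add_le_of_nonpos_left degree_C_le)) ?_
      rw [degree_pow, degree_X_add_C]
      simp
    exact absurd (lt_of_le_of_lt h1 h2) (lt_irrefl _)
  have hco2 : ∀ i : Fin l, v i * ((k-l+(i:ℕ)+1 : ℕ) : ZMod q) = 0 := by
    have h3 : ∑ i : Fin l, C (v i * ((k-l+(i:ℕ)+1 : ℕ) : ZMod q)) * (X:(ZMod q)[X])^(i:ℕ) = 0 := by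
      have := congrArg (fun p => p.comp (X - C s)) hH0
      rw [hH] at this
      simp only [Polynomial.sum_comp, mul_comp, C_comp, pow_comp, add_comp, X_comp, zero_comp] at this
      simpa using this
    intro i
    have := congrArg (fun p => p.coeff (i:ℕ)) h3
    simp only [finsetSum_coeff, coeff_C_mul, coeff_X_pow, coeff_zero] at this
    rw [Finset.sum_eq_single i] at this
    · simpa using this
    · intro b _ hb
      have : ¬ ((i:ℕ) = b) := fun h => hb (Fin.ext h.symm)
      rw [if_neg this, mul_zero]
    · simp
  funext i
  have h4 := hco2 i
  rcases mul_eq_zero.mp h4 with h | h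
  · exact h
  · exfalso
    rw [ZMod.natCast_eq_zero_iff] at h
    have := Nat.le_of_dvd (by omega) h
    have := i.2
    omega

lemma unit_of_cast {q M : ℕ} [Fact q.Prime] (hM : M ≠ 0) (y : ZMod (q^M))
    (h : ZMod.castHom (dvd_pow_self q hM) (ZMod q) y ≠ 0) : IsUnit y := by
  obtain ⟨n, rfl⟩ := ZMod.natCast_zmod_surjective y
  rw [map_natCast, Ne, ZMod.natCast_eq_zero_iff] at h
  rw [ZMod.isUnit_iff_coprime]
  exact Nat.Coprime.pow_right _ (((Nat.Prime.coprime_iff_not_dvd Fact.out).mpr h).symm)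

open Polynomial in
lemma detUnit {q M : ℕ} [Fact q.Prime] (hM : M ≠ 0) {k l : ℕ} (hl : l ≤ k) (hk : k < q)
    (g : Fin l → (ZMod (q^M))[X]) (t : ZMod (q^M)) (c : ZMod q)
    (hg : ∀ i, ∃ r, (g i).map (ZMod.castHom (dvd_pow_self q hM) (ZMod q)) =
       C r + (X - C c)^(k-l+(i:ℕ)+1))
    (ht : ZMod.castHom (dvd_pow_self q hM) (ZMod q) t ≠ c ∨ l = k) :
    IsUnit (Matrix.of (fun i j : Fin l => (taylor t (g i)).coeff ((j:ℕ)+1))).det := by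
  apply unit_of_cast hM
  rw [RingHom.map_det]
  choose r hr using hg
  set f := ZMod.castHom (dvd_pow_self q hM) (ZMod q)
  have := detField hl hk (f t - c) (by
    rcases ht with h | h
    · left; exact sub_ne_zero.mpr h
    · right; exact h) r
  convert this using 2
  ext i j
  simp only [RingHom.mapMatrix_apply, Matrix.map_apply, Matrix.of_apply]
  rw [← Polynomial.coeff_map, Polynomial.map_taylor, hr]
  congr 1
  simp only [taylor_apply, add_comp, C_comp, pow_comp, sub_comp, X_comp, map_sub]
  ring_nf

structure Cx (q k N : ℕ) where
  M : ℕ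
  e : ℕ
  hM : e + k * N ≤ M
  φ : Fin k → Polynomial (ZMod (q^M))
  hφ : IsC q M k φ
  s : Finset ℕ
  a : ℕ → ℂ
  ν : ℕ → ℕ

def Cx.F {q k N : ℕ} [Fact q.Prime] (X : Cx q k N) (b J : ℕ) (x : Fin k → ZMod (q^X.M)) : ℂ :=
  EF q X.M k X.e X.φ X.a X.ν (X.s.filter (fun n => X.ν n % q^b = J)) x

def Cx.V {q k N : ℕ} [Fact q.Prime] (X : Cx q k N) (n : ℕ) : ℝ := ∑ x, ‖X.F N n x‖^(2 * hh k)

def Cx.T {q k N : ℕ} [Fact q.Prime] (X : Cx q k N) (b J : ℕ) : ℝ :=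
  ((q:ℝ)^(N-b))⁻¹ * ∑ r ∈ Finset.range (q^(N-b)), X.V (J + q^b * r)

lemma sum_range_split (F : ℕ → ℝ) (A B : ℕ) :
    ∑ n ∈ Finset.range (A*B), F n = ∑ r ∈ Finset.range A, ∑ t ∈ Finset.range B, F (r + A*t) := by
  induction B with
  | zero => simp
  | succ B ih =>
    simp_rw [Finset.sum_range_succ, Finset.sum_add_distrib]
    rw [mul_add, mul_one, Finset.sum_range_add, ih]
    simp_rw [add_comm (A*B)]

lemma filt_split {q a t I r : ℕ} (s : Finset ℕ) (ν : ℕ → ℕ) (hI : I < q^a) :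
    (s.filter (fun n => ν n % q^a = I)).filter (fun n => ν n / q^a % q^t = r) =
      s.filter (fun n => ν n % q^(a+t) = I + q^a * r) := by
  rw [Finset.filter_filter]
  refine Finset.filter_congr fun n _ => ?_
  rw [pow_add, Nat.mod_mul]
  constructor
  · rintro ⟨h1, h2⟩; rw [h1, h2]
  · intro h
    have h1 : (ν n % q^a + q^a * (ν n / q^a % q^t)) % q^a = (I + q^a * r) % q^a := by rw [h]
    rw [Nat.add_mul_mod_self_left, Nat.add_mul_mod_self_left, Nat.mod_mod, Nat.mod_eq_of_lt hI] at h1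
    refine ⟨h1, ?_⟩
    rw [h1] at h
    have h3 : 0 < q^a := by omega
    exact Nat.eq_of_mul_eq_mul_left h3 (by omega)

section
variable {q k N : ℕ} [Fact q.Prime]

lemma qpos : (0:ℝ) < (q:ℝ) := by exact_mod_cast (Fact.out : q.Prime).pos

lemma Cx.V_nonneg (X : Cx q k N) (n : ℕ) : 0 ≤ X.V n := Finset.sum_nonneg fun _ _ => by positivity

lemma Cx.T_nonneg (X : Cx q k N) (b J : ℕ) : 0 ≤ X.T b J :=
  mul_nonneg (by positivity) (Finset.sum_nonneg fun _ _ => X.V_nonneg _)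

lemma Cx.T_split (X : Cx q k N) {a a' I : ℕ} (h : a ≤ a') (h' : a' ≤ N) :
    ∑ r ∈ Finset.range (q^(a'-a)), X.T a' (I + q^a * r) = (q:ℝ)^(a'-a) * X.T a I := by
  unfold Cx.T
  have h1 : q^(N-a) = q^(a'-a) * q^(N-a') := by rw [← pow_add]; congr 1; omega
  have h2 : (q:ℝ)^(N-a) = (q:ℝ)^(a'-a) * (q:ℝ)^(N-a') := by exact_mod_cast h1
  have h3 : q^a' = q^a * q^(a'-a) := by rw [← pow_add]; congr 1; omega
  rw [h1, h2, sum_range_split, ← Finset.mul_sum]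
  have : (q:ℝ)^(a'-a) ≠ 0 := by have := qpos (q := q); positivity
  simp_rw [h3, mul_add, mul_assoc, add_assoc]
  rw [mul_inv, mul_assoc, mul_inv_cancel_left₀ this]

lemma nat_split {q ν a I : ℕ} (h : ν % q^a = I) (M : ℕ) :
    (ν : ZMod (q^M)) = (I : ZMod (q^M)) + (q:ZMod (q^M))^a * ((ν / q^a : ℕ) : ZMod (q^M)) := by
  conv_lhs => rw [← Nat.mod_add_div ν (q^a), h]
  push_cast; ring

open Polynomial in
lemma IsC_map {M : ℕ} (hM : M ≠ 0) {φ : Fin k → (ZMod (q^M))[X]} (hφ : IsC q M k φ) (i : Fin k) :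
    (φ i).map (ZMod.castHom (dvd_pow_self q hM) (ZMod q)) = X^((i:ℕ)+1) := by
  obtain ⟨r, hr⟩ := hφ i
  rw [hr, Polynomial.map_add, Polynomial.map_pow, map_X, Polynomial.map_mul, map_C, map_natCast, ZMod.natCast_self]
  simp

lemma lemma0 (X : Cx q k N) (hk1 : 1 ≤ k) (hk : k < q) {b J : ℕ} (hb : 1 ≤ b) (hbN : b ≤ N) (hJ : J < q^b)
    {K : ℝ} (hD : Dec q k (N-b) K) :
    ∑ x, ‖X.F b J x‖^(2*hh k) ≤ K * ((q:ℝ)^(N-b))^(hh k) * X.T b J := by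
  have hM0 : X.M ≠ 0 := by
    have := X.hM
    have : 1 * 1 ≤ k * N := Nat.mul_le_mul hk1 (by omega)
    omega
  have hdet := detUnit (k := k) (l := k) hM0 le_rfl hk X.φ (J : ZMod (q^X.M)) 0
    (fun i => ⟨0, by rw [IsC_map hM0 X.hφ]; simp⟩) (Or.inr rfl)
  obtain ⟨Bz, φ', cst, hφ', hB⟩ := PL hb X.φ _ hdet
  have hN : b + (N-b) = N := by omega
  have := TL (N' := N-b) (e := X.e) (e' := X.e + b*k) hD (a := X.a) (ν := X.ν)
    (s := X.s.filter (fun n => X.ν n % q^b = J)) (φ := X.φ)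
    (by
      have h1 := X.hM
      have h2 : k * (b + (N-b)) = k * N := by rw [hN]
      rw [mul_add] at h2
      rw [mul_comm b k]; omega) hφ' (fun n => X.ν n / q^b) Bz
    (fun z => (q:ZMod (q^X.M))^X.e * cst z) (by
      intro z n hn
      rw [Finset.mem_filter] at hn
      unfold ph
      rw [nat_split hn.2, hB, pow_add]; ring) (fun _ => 1) (by simp) (by simp)
  simp only [one_mul, filt_split X.s X.ν hJ, hN] at this
  have h2 : (0:ℝ) < (q:ℝ)^(N-b) := by have := qpos (q := q); positivity
  rw [← mul_le_mul_iff_right₀ h2]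
  refine this.trans (le_of_eq ?_)
  unfold Cx.T Cx.V Cx.F
  field_simp

open Polynomial in
lemma lemma1 (Y : Cx q k N) (hk : k < q) {a a' b I J l p : ℕ} (hl1 : 1 ≤ l) (hlk : l ≤ k)
    (ha : 1 ≤ a) (haa : a ≤ a') (hb : 1 ≤ b) (hbN : b ≤ N)
    (hI : I < q^a) (hJ : J < q^b) (hIJ : I % q ≠ J % q)
    (hab : l * a' ≤ (k-l+1) * b) {K : ℝ} (hD : Dec q l (a'-a) K) :
    (q:ℝ)^(a'-a) * ∑ x, ‖Y.F b J x‖^p * ‖Y.F a I x‖^(2*hh l) ≤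
      K * ((q:ℝ)^(a'-a))^(hh l) * ∑ r ∈ Finset.range (q^(a'-a)), ∑ x,
        ‖Y.F b J x‖^p * ‖Y.F a' (I+q^a*r) x‖^(2*hh l) := by
  have hM := Y.hM
  have hkb : (k-l+1) * b ≤ k * N := Nat.mul_le_mul (by omega) hbN
  have hM0 : Y.M ≠ 0 := by
    have : 1 * 1 ≤ (k-l+1) * b := Nat.mul_le_mul (by omega) (by omega)
    omega
  set Q : ZMod (q^Y.M) := (q : ZMod (q^Y.M)) with hQ
  have hdet := detUnit (k := k) (l := k) hM0 le_rfl hk Y.φ (J : ZMod (q^Y.M)) 0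
    (fun i => ⟨0, by rw [IsC_map hM0 Y.hφ]; simp⟩) (Or.inr rfl)
  set G := (Matrix.of (fun i j : Fin k => (taylor (J:ZMod (q^Y.M)) (Y.φ i)).coeff ((j:ℕ)+1))) with hG
  have hGG : G⁻¹ * G = 1 := Matrix.nonsing_inv_mul G hdet
  set ψ : Fin k → (ZMod (q^Y.M))[X] := fun i => ∑ j, C (G⁻¹ i j) * Y.φ j with hψ
  have htay : ∀ i, taylor (J:ZMod (q^Y.M)) (ψ i) = ∑ j, C (G⁻¹ i j) * taylor (J:ZMod (q^Y.M)) (Y.φ j) := by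
    intro i
    simp only [hψ, map_sum, taylor_mul, taylor_C]
  have hcoef : ∀ i j : Fin k, (taylor (J:ZMod (q^Y.M)) (ψ i)).coeff ((j:ℕ)+1) = if i = j then 1 else 0 := by
    intro i j
    rw [htay, finsetSum_coeff]
    simp only [coeff_C_mul]
    have := congrFun (congrFun hGG i) j
    rw [Matrix.mul_apply, Matrix.one_apply] at this
    rw [← this]
    rfl
  -- values on the class of J
  have hval : ∀ i : Fin k, ∃ g : ZMod (q^Y.M), ∃ ρ : (ZMod (q^Y.M))[X], taylor (J:ZMod (q^Y.M)) (ψ i) = C g + X^((i:ℕ)+1) * ρ := by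
    intro i
    refine ⟨(taylor (J:ZMod (q^Y.M)) (ψ i)).coeff 0, ?_⟩
    have : X^((i:ℕ)+1) ∣ taylor (J:ZMod (q^Y.M)) (ψ i) - C ((taylor (J:ZMod (q^Y.M)) (ψ i)).coeff 0) := by
      rw [X_pow_dvd_iff]
      intro d hd
      rw [coeff_sub, coeff_C]
      rcases d with _ | d
      · simp
      · have hdk : d < k := by have := i.2; omega
        have := hcoef i ⟨d, hdk⟩
        simp only at this
        rw [this, if_neg, if_neg (by omega), sub_zero]
        intro h
        have := congrArg Fin.val h
        simp at this; omega
    obtain ⟨ρ, h⟩ := this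
    exact ⟨ρ, by rw [← h]; ring⟩
  choose γ ρ hγρ using hval
  -- reduction mod q
  set f := ZMod.castHom (dvd_pow_self q hM0) (ZMod q) with hf
  have hmapψ : ∀ i : Fin k, ∃ r, (ψ i).map f = C r + (X - C (f J))^((i:ℕ)+1) := by
    intro i
    have hdeg : ((ψ i).map f).natDegree ≤ k := by
      rw [hψ, Polynomial.map_sum]
      refine natDegree_sum_le_of_forall_le _ _ fun j _ => ?_
      rw [Polynomial.map_mul, map_C, IsC_map hM0 Y.hφ]
      refine (natDegree_C_mul_le _ _).trans ?_
      rw [natDegree_X_pow]; exact j.2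
    have h1 : taylor (f J) ((ψ i).map f) = C ((taylor (f J) ((ψ i).map f)).coeff 0) + X^((i:ℕ)+1) := by
      ext d
      rw [coeff_add, coeff_C, coeff_X_pow]
      rcases d with _ | d
      · simp
      · by_cases hdk : d < k
        · rw [← Polynomial.map_taylor, Polynomial.coeff_map]
          have := hcoef i ⟨d, hdk⟩
          simp only at this
          rw [this]
          by_cases hid : (i:ℕ) = d
          · have : i = ⟨d, hdk⟩ := Fin.ext hid
            simp [this]
          · have h2 : ¬ i = ⟨d, hdk⟩ := fun h => hid (congrArg Fin.val h)
            rw [if_neg h2, if_neg (by omega), if_neg (by omega)]; simp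
        · rw [coeff_eq_zero_of_natDegree_lt, if_neg (by omega), if_neg (by have := i.2; omega)]
          · simp
          · rw [natDegree_taylor]; omega
    refine ⟨(taylor (f J) ((ψ i).map f)).coeff 0, ?_⟩
    have h2 := congrArg (taylor (-(f J))) h1
    rw [taylor_taylor, neg_add_cancel, taylor_zero] at h2
    refine h2.trans ?_
    generalize (taylor (f J) ((ψ i).map f)).coeff 0 = cc
    simp only [taylor_apply, add_comp, C_comp, pow_comp, X_comp, map_neg]
    ring_nf
  -- last l coordinates
  set ι : Fin l → Fin k := fun i => ⟨k - l + i, by have := i.2; omega⟩ with hι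
  have hdet2 := detUnit (k := k) (l := l) hM0 hlk hk (fun i => ψ (ι i)) (I : ZMod (q^Y.M)) (f J)
    (fun i => hmapψ (ι i)) (Or.inl (by
      rw [map_natCast, map_natCast]
      intro h
      exact hIJ ((ZMod.natCast_eq_natCast_iff' _ _ _).mp h)))
  obtain ⟨Bz, φ', cst, hφ', hB⟩ := PL ha (fun i => ψ (ι i)) _ hdet2
  set E := Y.M - Y.e - (k-l+1)*b with hE
  set L : (Fin l → ZMod (q^Y.M)) → (Fin k → ZMod (q^Y.M)) := fun z j => Q^E * ∑ i, Bz z i * G⁻¹ (ι i) j with hL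
  have hph : ∀ z n, ph q Y.M k Y.e Y.φ (L z) n = Q^(Y.e+E) * ∑ i, Bz z i * (ψ (ι i)).eval (n:ZMod (q^Y.M)) := by
    intro z n
    unfold ph
    rw [pow_add, mul_assoc]
    congr 1
    simp only [hL, hψ, eval_finsetSum, eval_mul, eval_C, Finset.mul_sum, Finset.sum_mul]
    rw [Finset.sum_comm]
    refine Finset.sum_congr rfl fun i _ => Finset.sum_congr rfl fun j _ => by ring
  have hQM : Q^Y.M = 0 := by
    rw [hQ, ← Nat.cast_pow]; exact ZMod.natCast_self _
  have hJinv : ∀ x z, ‖Y.F b J (x + L z)‖ = ‖Y.F b J x‖ := by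
    intro x z
    unfold Cx.F
    rw [EF_shift (l := 0) (e' := 0) (φ' := fun i => 0) (z := 0) (m := fun _ => 0)
      (cst := Q^(Y.e+E) * ∑ i, Bz z i * γ (ι i))]
    · congr 1
      unfold EF
      refine Finset.sum_congr rfl fun n _ => ?_
      simp [ph]
    · intro n hn
      rw [Finset.mem_filter] at hn
      rw [hph, nat_split hn.2]
      have : ∀ i, Q^(Y.e+E) * (ψ (ι i)).eval ((J:ZMod (q^Y.M)) + Q^b * ((Y.ν n / q^b : ℕ) : ZMod (q^Y.M))) = Q^(Y.e+E) * γ (ι i) := by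
        intro i
        rw [add_comm (J:ZMod (q^Y.M)), ← taylor_eval, hγρ]
        simp only [eval_add, eval_C, eval_mul, eval_pow, eval_X, mul_add (Q^(Y.e+E)), mul_pow, ← pow_mul]
        have h5 : Y.M ≤ Y.e + E + b * ((ι i : ℕ) + 1) := by
          have : (k-l+1)*b ≤ b * ((ι i : ℕ) + 1) := by
            rw [mul_comm]; exact Nat.mul_le_mul le_rfl (by simp [hι])
          omega
        have h6 : Q^(Y.e+E) * Q^(b*((ι i:ℕ)+1)) = 0 := by
          rw [← pow_add, ← Nat.add_sub_of_le h5, pow_add, hQM, zero_mul]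
        rw [← mul_assoc, ← mul_assoc, h6]; ring
      simp only [ph, Finset.univ_eq_empty, Finset.sum_empty, mul_zero, add_zero, Finset.mul_sum]
      refine Finset.sum_congr rfl fun i _ => ?_
      rw [mul_left_comm, this i]; ring
  have := TL (N' := a'-a) (e := Y.e) (e' := Y.e + E + a*l) hD (a := Y.a) (ν := Y.ν)
    (s := Y.s.filter (fun n => Y.ν n % q^a = I)) (φ := Y.φ)
    (by
      have : a*l + l*(a'-a) = l*a' := by rw [mul_comm a l, ← mul_add]; congr 1; omega
      omega) hφ' (fun n => Y.ν n / q^a) L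
    (fun z => Q^(Y.e+E) * cst z) (by
      intro z n hn
      rw [Finset.mem_filter] at hn
      rw [hph, nat_split hn.2, hB]
      unfold ph
      rw [pow_add _ (Y.e+E)]; ring) (fun x => ‖Y.F b J x‖^p) (fun _ => by positivity)
      (fun x z => by simp only [hJinv])
  simp only [filt_split Y.s Y.ν hI, show a + (a'-a) = a' by omega] at this
  exact this
end

lemma holder_nat {ι : Type*} (s : Finset ι) (W U V : ι → ℝ) (α β : ℕ) (hα : 0 < α)
    (hW : ∀ i ∈ s, 0 ≤ W i) (hU : ∀ i ∈ s, 0 ≤ U i) (hV : ∀ i ∈ s, 0 ≤ V i)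
    (h : ∀ i ∈ s, W i ^ (α+β) ≤ U i ^ α * V i ^ β) :
    (∑ i ∈ s, W i)^(α+β) ≤ (∑ i ∈ s, U i)^α * (∑ i ∈ s, V i)^β := by
  rcases Nat.eq_zero_or_pos β with hβ | hβ
  · subst hβ
    simp only [add_zero, pow_zero, mul_one] at h ⊢
    refine pow_le_pow_left₀ (Finset.sum_nonneg hW) (Finset.sum_le_sum fun i hi => ?_) _
    exact (pow_le_pow_iff_left₀ (hW i hi) (hU i hi) hα.ne').mp (h i hi)
  have hαr : (0:ℝ) < α := by exact_mod_cast hα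
  have hβr : (0:ℝ) < β := by exact_mod_cast hβ
  set m : ℝ := α + β with hm
  have hmp : 0 < m := by positivity
  have hconj : (m/α).HolderConjugate (m/β) := by
    rw [Real.holderConjugate_iff]
    refine ⟨by rw [lt_div_iff₀ hαr]; linarith, ?_⟩
    field_simp; rw [hm]
  have hSU := Finset.sum_nonneg hU
  have hSV := Finset.sum_nonneg hV
  have h1 : ∀ i ∈ s, W i ≤ U i ^ (α/m) * V i ^ (β/m) := by
    intro i hi
    have hU' := hU i hi
    have hV' := hV i hi
    rw [← pow_le_pow_iff_left₀ (hW i hi) (by positivity) (by omega : α+β ≠ 0), mul_pow]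
    refine (h i hi).trans (le_of_eq ?_)
    rw [← Real.rpow_natCast (_ ^ _), ← Real.rpow_natCast (V i ^ _), ← Real.rpow_mul hU', ← Real.rpow_mul hV']
    push_cast
    rw [← hm, div_mul_cancel₀ _ hmp.ne', div_mul_cancel₀ _ hmp.ne', Real.rpow_natCast, Real.rpow_natCast]
  have h2 : ∑ i ∈ s, W i ≤ (∑ i ∈ s, U i)^(α/m) * (∑ i ∈ s, V i)^(β/m) := by
    refine (Finset.sum_le_sum h1).trans ?_
    have := Real.inner_le_Lp_mul_Lq_of_nonneg s hconj (f := fun i => U i ^ (α/m)) (g := fun i => V i ^ (β/m))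
      (fun i hi => Real.rpow_nonneg (hU i hi) _) (fun i hi => Real.rpow_nonneg (hV i hi) _)
    refine this.trans (le_of_eq ?_)
    rw [one_div_div, one_div_div]
    congr 2
    · refine Finset.sum_congr rfl fun i hi => ?_
      rw [← Real.rpow_mul (hU i hi)]
      rw [show (α/m) * (m/α) = 1 by field_simp, Real.rpow_one]
    · refine Finset.sum_congr rfl fun i hi => ?_
      rw [← Real.rpow_mul (hV i hi)]
      rw [show (β/m) * (m/β) = 1 by field_simp, Real.rpow_one]
  refine (pow_le_pow_left₀ (Finset.sum_nonneg hW) h2 _).trans (le_of_eq ?_)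
  rw [mul_pow, ← Real.rpow_natCast (_ ^ _), ← Real.rpow_natCast ((∑ i ∈ s, V i) ^ _), ← Real.rpow_mul hSU, ← Real.rpow_mul hSV]
  push_cast
  rw [← hm, div_mul_cancel₀ _ hmp.ne', div_mul_cancel₀ _ hmp.ne', Real.rpow_natCast, Real.rpow_natCast]

lemma hh_mono : Monotone hh := monotone_nat_of_le_succ fun n => by simp [hh]

lemma two_hh (k : ℕ) : 2 * hh k = k * (k+1) := by
  induction k with
  | zero => simp [hh]
  | succ k ih => simp only [hh]; rw [mul_add, ih]; ring

def Bil (q : ℕ) [Fact q.Prime] (k N l a b : ℕ) (B : ℝ) : Prop :=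
  ∀ X : Cx q k N, ∀ I J : ℕ, I < q^a → J < q^b → I % q ≠ J % q →
    ∑ x, ‖X.F a I x‖^(2*hh l) * ‖X.F b J x‖^(2*(hh k - hh l)) ≤
      B * (((q:ℝ)^(N-a))^(hh l) * ((q:ℝ)^(N-b))^(hh k - hh l)) * (X.T a I + X.T b J)

section
variable {q k N : ℕ} [Fact q.Prime]

lemma Bil_mono {l a b : ℕ} {B B' : ℝ} (h : Bil q k N l a b B) (hB : B ≤ B') : Bil q k N l a b B' := by
  intro X I J hI hJ hIJ
  refine (h X I J hI hJ hIJ).trans ?_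
  have := X.T_nonneg a I
  have := X.T_nonneg b J
  gcongr

lemma Bil_step (hk : k < q) {a a' b l : ℕ} (hl1 : 1 ≤ l) (hlk : l ≤ k)
    (ha : 1 ≤ a) (haa : a ≤ a') (ha'N : a' ≤ N) (hb : 1 ≤ b) (hbN : b ≤ N)
    (hab : l * a' ≤ (k-l+1) * b) {K B : ℝ} (hK : 0 ≤ K) (hD : Dec q l (a'-a) K)
    (hB : Bil q k N l a' b B) : Bil q k N l a b (K*B) := by
  intro X I J hI hJ hIJ
  have hq0 : (0:ℝ) < (q:ℝ) := qpos
  have h1 := lemma1 X hk (p := 2*(hh k - hh l)) hl1 hlk ha haa hb hbN hI hJ hIJ hab hD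
  have h2 : (0:ℝ) < (q:ℝ)^(a'-a) := by positivity
  rw [← mul_le_mul_iff_right₀ h2]
  simp_rw [mul_comm (‖X.F a I _‖ ^ _)]
  refine h1.trans ?_
  have h3 : ∀ r ∈ Finset.range (q^(a'-a)), ∑ x, ‖X.F b J x‖^(2*(hh k - hh l)) * ‖X.F a' (I+q^a*r) x‖^(2*hh l)
      ≤ B * (((q:ℝ)^(N-a'))^(hh l) * ((q:ℝ)^(N-b))^(hh k - hh l)) * (X.T a' (I+q^a*r) + X.T b J) := by
    intro r hr
    simp_rw [mul_comm (‖X.F b J _‖ ^ _)]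
    refine hB X _ _ ?_ hJ ?_
    · rw [Finset.mem_range] at hr
      have : q^a' = q^a * q^(a'-a) := by rw [← pow_add]; congr 1; omega
      rw [this]
      calc I + q^a*r < q^a + q^a * r := by omega
        _ = q^a * (r+1) := by ring
        _ ≤ _ := Nat.mul_le_mul le_rfl hr
    · obtain ⟨c, hc⟩ := dvd_pow_self q (by omega : a ≠ 0)
      rw [hc, mul_assoc, Nat.add_mul_mod_self_left]; exact hIJ
  refine (mul_le_mul_of_nonneg_left (Finset.sum_le_sum h3) (by positivity)).trans (le_of_eq ?_)
  rw [← Finset.mul_sum, Finset.sum_add_distrib, X.T_split haa ha'N, Finset.sum_const, Finset.card_range, nsmul_eq_mul]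
  have h4 : (q:ℝ)^(N-a) = (q:ℝ)^(a'-a) * (q:ℝ)^(N-a') := by rw [← pow_add]; congr 1; omega
  rw [h4, mul_pow]; push_cast; ring

lemma Bil_swap {a b l : ℕ} (hl1 : 1 ≤ l) (hlk : l ≤ k) {B B1 B2 : ℝ} (hB0 : 0 ≤ B)
    (hB1 : 0 ≤ B1) (hB2 : 0 ≤ B2)
    (h1 : Bil q k N (k-l) b a B1) (h2 : Bil q k N (l-1) a b B2)
    (hB : B1 * B2^(k-l) ≤ B^(1+(k-l))) : Bil q k N l a b B := by
  intro X I J hI hJ hIJ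
  have hq0 : (0:ℝ) < (q:ℝ) := qpos
  have hm1 : hh l ≤ hh k := hh_mono hlk
  have hm2 : hh (l-1) ≤ hh l := hh_mono (by omega)
  have hm3 : hh (k-l) ≤ hh k := hh_mono (by omega)
  have e1 : hh k - hh (k-l) + (k-l) * hh (l-1) = (1+(k-l)) * hh l := by
    obtain ⟨j, rfl⟩ := Nat.exists_eq_add_of_le hlk
    obtain ⟨l, rfl⟩ := Nat.exists_eq_add_of_le hl1
    have a1 := two_hh (1+l+j)
    have a2 := two_hh j
    have a3 := two_hh l
    have a4 := two_hh (1+l)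
    simp only [Nat.add_sub_cancel_left] at *
    zify [hm3] at *
    nlinarith
  have e2 : hh (k-l) + (k-l) * (hh k - hh (l-1)) = (1+(k-l)) * (hh k - hh l) := by
    have hm4 : hh (l-1) ≤ hh k := hm2.trans hm1
    zify [hm1, hm2, hm3, hm4] at *
    nlinarith
  have gen : ∀ u v : ℝ, (v^(hh (k-l)) * u^(hh k - hh (k-l))) * (u^(hh (l-1)) * v^(hh k - hh (l-1)))^(k-l) =
      (u^(hh l) * v^(hh k - hh l))^(1+(k-l)) := by
    intro u v
    rw [mul_pow, mul_pow, ← pow_mul, ← pow_mul, ← pow_mul, ← pow_mul, mul_comm (hh l), mul_comm (hh k - hh l), ← e1, ← e2,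
      pow_add, pow_add, mul_comm (hh (l-1)), mul_comm (hh k - hh (l-1))]
    ring
  have hol := holder_nat Finset.univ (fun x => ‖X.F a I x‖^(2*hh l) * ‖X.F b J x‖^(2*(hh k - hh l)))
    (fun x => ‖X.F b J x‖^(2*hh (k-l)) * ‖X.F a I x‖^(2*(hh k - hh (k-l))))
    (fun x => ‖X.F a I x‖^(2*hh (l-1)) * ‖X.F b J x‖^(2*(hh k - hh (l-1)))) 1 (k-l) one_pos
    (fun _ _ => by positivity) (fun _ _ => by positivity) (fun _ _ => by positivity) (by
      intro x _
      simp only [pow_mul]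
      rw [pow_one, gen])
  have hT1 := X.T_nonneg a I
  have hT2 := X.T_nonneg b J
  have g1 := h1 X J I hJ hI (Ne.symm hIJ)
  have g2 := h2 X I J hI hJ hIJ
  rw [← pow_le_pow_iff_left₀ (Finset.sum_nonneg fun _ _ => by positivity) (by positivity) (by omega : 1 + (k-l) ≠ 0)]
  refine hol.trans ?_
  rw [pow_one]
  refine (mul_le_mul g1 (pow_le_pow_left₀ (Finset.sum_nonneg fun _ _ => by positivity) g2 _)
    (pow_nonneg (Finset.sum_nonneg fun _ _ => by positivity) _) (by positivity)).trans ?_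
  rw [mul_pow _ (X.T a I + X.T b J), mul_pow _ (X.T a I + X.T b J), mul_pow B, mul_pow B2, ← gen, add_comm (X.T b J), pow_add (X.T a I + X.T b J), pow_one]
  calc _ = (B1 * B2^(k-l)) * (((q:ℝ)^(N-b))^(hh (k-l)) * ((q:ℝ)^(N-a))^(hh k - hh (k-l)) * (((q:ℝ)^(N-a))^(hh (l-1)) * ((q:ℝ)^(N-b))^(hh k - hh (l-1)))^(k-l)) * ((X.T a I + X.T b J) * (X.T a I + X.T b J)^(k-l)) := by ring
    _ ≤ _ := by gcongr

lemma Bil_zero (hk1 : 1 ≤ k) (hk : k < q) {a b : ℕ} (hb : 1 ≤ b) (hbN : b ≤ N) {K : ℝ} (hK : 0 ≤ K)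
    (hD : Dec q k (N-b) K) : Bil q k N 0 a b K := by
  intro X I J hI hJ hIJ
  simp only [hh, mul_zero, pow_zero, one_mul, Nat.sub_zero]
  refine (lemma0 X hk1 hk hb hbN hJ hD).trans ?_
  have := X.T_nonneg a I
  gcongr; linarith

lemma Bil_triv (hk1 : 1 ≤ k) (hk : k < q) {a b l : ℕ} (hl1 : 1 ≤ l) (hlk : l ≤ k) (ha : 1 ≤ a) (haN : a ≤ N)
    (hb : 1 ≤ b) (hbN : b ≤ N) {K : ℝ} (hK : 0 ≤ K)
    (hDa : Dec q k (N-a) K) (hDb : Dec q k (N-b) K) : Bil q k N l a b K := by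
  intro X I J hI hJ hIJ
  have hq0 : (0:ℝ) < (q:ℝ) := qpos
  have hm1 : hh l ≤ hh k := hh_mono hlk
  have hl0 : 0 < hh l := by
    obtain ⟨j, rfl⟩ := Nat.exists_eq_add_of_le hl1
    rw [add_comm]; simp [hh]
  have hsum : hh l + (hh k - hh l) = hh k := by omega
  have hol := holder_nat Finset.univ (fun x => ‖X.F a I x‖^(2*hh l) * ‖X.F b J x‖^(2*(hh k - hh l)))
    (fun x => ‖X.F a I x‖^(2*hh k))
    (fun x => ‖X.F b J x‖^(2*hh k)) (hh l) (hh k - hh l) hl0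
    (fun _ _ => by positivity) (fun _ _ => by positivity) (fun _ _ => by positivity) (by
      intro x _
      simp only [hsum]
      rw [mul_pow, ← pow_mul, ← pow_mul, ← pow_mul, ← pow_mul]
      apply le_of_eq; congr 2 <;> ring)
  have hT1 := X.T_nonneg a I
  have hT2 := X.T_nonneg b J
  have g1 := lemma0 X hk1 hk ha haN hI hDa
  have g2 := lemma0 X hk1 hk hb hbN hJ hDb
  rw [← pow_le_pow_iff_left₀ (Finset.sum_nonneg fun _ _ => by positivity) (by positivity) (by omega : hh l + (hh k - hh l) ≠ 0)]
  refine hol.trans ?_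
  have p1 := pow_le_pow_left₀ (Finset.sum_nonneg fun _ _ => by positivity) (g1.trans
    (mul_le_mul_of_nonneg_left (by linarith : X.T a I ≤ X.T a I + X.T b J) (by positivity))) (hh l)
  have p2 := pow_le_pow_left₀ (Finset.sum_nonneg fun _ _ => by positivity) (g2.trans
    (mul_le_mul_of_nonneg_left (by linarith : X.T b J ≤ X.T a I + X.T b J) (by positivity))) (hh k - hh l)
  refine (mul_le_mul p1 p2 (pow_nonneg (Finset.sum_nonneg fun _ _ => by positivity) _) (by positivity)).trans (le_of_eq ?_)
  simp only [mul_pow, pow_add]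
  have e1 : (((q:ℝ)^(N-a))^(hh k))^(hh l) = (((q:ℝ)^(N-a))^(hh l))^(hh l) * (((q:ℝ)^(N-a))^(hh l))^(hh k - hh l) := by
    rw [← pow_add, hsum, ← pow_mul _ (hh k), ← pow_mul _ _ (hh k), mul_comm (hh k)]
  have e2 : (((q:ℝ)^(N-b))^(hh k))^(hh k - hh l) = (((q:ℝ)^(N-b))^(hh k - hh l))^(hh l) * (((q:ℝ)^(N-b))^(hh k - hh l))^(hh k - hh l) := by
    rw [← pow_add, hsum, ← pow_mul _ (hh k), ← pow_mul _ _ (hh k), mul_comm (hh k)]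
  rw [e1, e2]; ring
end

def PD (q : ℕ) [Fact q.Prime] (k : ℕ) (η : ℝ) : Prop :=
  ∃ C : ℝ, 1 ≤ C ∧ ∀ N : ℕ, Dec q k N (C * (q:ℝ)^(η*N))

def StB (q : ℕ) [Fact q.Prime] (k : ℕ) (η ε : ℝ) (n : ℕ) : Prop :=
  ∃ C : ℝ, 1 ≤ C ∧ ∀ N b l a : ℕ, 1 ≤ b → (k.factorial)^n ∣ b → b * k^(n+1) ≤ N → 1 ≤ l → l + 1 ≤ k →
    1 ≤ a → l * a ≤ (k-l+1) * b → a ≤ N →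
    Bil q k N l a b (C * (q:ℝ)^(η*N + n*k*ε*N - η*((k:ℝ)-l)*l*n*b/(k:ℝ)^2))

def Inn (q : ℕ) [Fact q.Prime] (k : ℕ) (η ε : ℝ) (n l : ℕ) : Prop :=
  ∃ C : ℝ, 1 ≤ C ∧ ∀ N b a : ℕ, 1 ≤ b → (k.factorial)^(n+1) ∣ b → b * k^(n+2) ≤ N →
    1 ≤ a → l * a ≤ (k-l+1) * b → a ≤ N →
    Bil q k N l a b (C * (q:ℝ)^(η*N + (n*k+l)*ε*N - η*((k:ℝ)-l)*(k+l*n)*b/(k:ℝ)^2))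

section
variable {q k : ℕ} [Fact q.Prime]

lemma q_one : (1:ℝ) ≤ (q:ℝ) := by exact_mod_cast (Fact.out : q.Prime).one_lt.le

lemma Dec_mono {N : ℕ} {K K' : ℝ} (h : Dec q k N K) (hK : K ≤ K') : Dec q k N K' := by
  intro M e he φ hφ s a ν
  refine (h M e he φ hφ s a ν).trans ?_
  gcongr

lemma StB_zero {η ε : ℝ} (hη : 0 ≤ η) (hk1 : 1 ≤ k) (hk : k < q) (hP : PD q k η) : StB q k η ε 0 := by
  obtain ⟨C, hC, h⟩ := hP
  refine ⟨C, hC, fun N b l a hb _ hbN hl1 hlk ha _ haN => ?_⟩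
  have hbN' : b ≤ N := by
    have : b * 1 ≤ b * k^(0+1) := Nat.mul_le_mul le_rfl (by simpa using hk1)
    omega
  have hD : ∀ c : ℕ, Dec q k (N-c) (C * (q:ℝ)^(η*N)) := by
    intro c
    refine Dec_mono (h (N-c)) ?_
    have := q_one (q := q)
    have : ((N - c : ℕ) : ℝ) ≤ N := by exact_mod_cast Nat.sub_le _ _
    gcongr
  have := Bil_triv hk1 hk hl1 (by omega) ha haN hb hbN' (by positivity) (hD a) (hD b)
  convert this using 3
  push_cast; ring

lemma Inn_zero {η ε : ℝ} (hε : 0 ≤ ε) (n : ℕ) (hk1 : 1 ≤ k) (hk : k < q) (hP : PD q k η) : Inn q k η ε n 0 := by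
  obtain ⟨C, hC, h⟩ := hP
  refine ⟨C, hC, fun N b a hb _ hbN ha _ haN => ?_⟩
  have hbN' : b ≤ N := by
    have : b * 1 ≤ b * k^(n+2) := Nat.mul_le_mul le_rfl (Nat.one_le_pow _ _ hk1)
    omega
  refine Bil_mono (Bil_zero hk1 hk hb hbN' (by positivity) (h (N-b))) ?_
  have := q_one (q := q)
  have hk0 : (0:ℝ) < k := by exact_mod_cast hk1
  have e : η*N + (n*k+(0:ℕ))*ε*N - η*((k:ℝ)-(0:ℕ))*(k+(0:ℕ)*n)*b/(k:ℝ)^2 = η * (N - b) + n*k*ε*N := by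
    push_cast; field_simp; ring
  rw [e, Nat.cast_sub hbN']
  have : 0 ≤ n*k*ε*N := by positivity
  gcongr
  linarith

lemma Inn_succ {η ε : ℝ} (hη : 0 ≤ η) (hε : 0 ≤ ε) (n l : ℕ) (hlk : l + 2 ≤ k) (hk : k < q)
    (hl : PD q (l+1) ε) (hS : StB q k η ε n) (hI : Inn q k η ε n l) : Inn q k η ε n (l+1) := by
  obtain ⟨C0, hC0, h0⟩ := hl
  obtain ⟨C1, hC1, h1⟩ := hS
  obtain ⟨C2, hC2, h2⟩ := hI
  have hq1 := q_one (q := q)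
  have hq0 : (0:ℝ) < q := by linarith
  have hk0 : (0:ℝ) < k := by exact_mod_cast (by omega : 0 < k)
  refine ⟨C0 * (C1 * C2), by nlinarith [mul_le_mul hC1 hC2 zero_le_one (by linarith)], fun N b a hb hdiv hbN ha hlab haN => ?_⟩
  -- a'
  have hfac : (l+1) ∣ k.factorial := Nat.dvd_factorial (by omega) (by omega)
  have hlb : (l+1) * k.factorial^n ∣ b := by
    refine dvd_trans ?_ hdiv
    rw [pow_succ, mul_comm]
    exact Nat.mul_dvd_mul (dvd_refl _) hfac
  obtain ⟨w, hw⟩ := hlb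
  obtain ⟨t, ht⟩ : ∃ t, t = k.factorial^n * w := ⟨_, rfl⟩
  have hbt : b = (l+1) * t := by rw [hw, ht, mul_assoc]
  set a' := (k - (l+1) + 1) * t with ha'
  have hla' : (l+1) * a' = (k-(l+1)+1) * b := by rw [ha', hbt]; ring
  have haa' : a ≤ a' := by
    rw [← hla'] at hlab
    exact Nat.le_of_mul_le_mul_left hlab (by omega)
  have ht1 : 1 ≤ t := by
    rcases Nat.eq_zero_or_pos t with h | h
    · rw [h] at hbt; omega
    · exact h
  have htb : t ≤ b := by rw [hbt]; exact Nat.le_mul_of_pos_left _ (by omega)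
  have hak : a' ≤ k * b := Nat.mul_le_mul (by omega) htb
  have hpk : 1 ≤ k^(n+1) := Nat.one_le_pow _ _ (by omega)
  have hkb : k * b * k^(n+1) ≤ N := by
    calc _ = b * k^(n+2) := by ring
      _ ≤ N := hbN
  have hkbN : k * b ≤ N := (Nat.le_mul_of_pos_right _ hpk).trans hkb
  have ha'N : a' ≤ N := hak.trans hkbN
  have hbN' : b ≤ N := (Nat.le_mul_of_pos_left _ (by omega)).trans hkbN
  have hcast : ((l:ℝ)+1) * a' = ((k:ℝ) - l) * b := by
    have := congrArg (Nat.cast (R := ℝ)) hla'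
    rw [show k - (l+1) + 1 = k - l by omega] at this
    push_cast [Nat.cast_sub (by omega : l ≤ k)] at this
    exact this
  have hdm : k - (l+1) + 1 = k - l := by omega
  have b1 := h1 N a' (k-(l+1)) b (by omega) (by rw [ha', ht]; exact ⟨(k-(l+1)+1) * w, by ring⟩)
    ((Nat.mul_le_mul hak le_rfl).trans hkb) (by omega) (by omega) hb (by
      rw [show k - (k-(l+1)) + 1 = l + 2 by omega, hbt, ha']
      calc (k-(l+1)) * ((l+1)*t) ≤ (k-(l+1)+1) * ((l+2)*t) := by gcongr <;> omega
        _ = _ := by ring) hbN'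
  have b2 := h2 N b a' hb hdiv hbN (by omega) (by
      rw [ha', hbt]
      calc l * ((k-(l+1)+1)*t) ≤ (l+1) * ((k-l+1)*t) := by gcongr <;> omega
        _ = _ := by ring) ha'N
  set x : ℝ := η*N + (n*k+l)*ε*N - η*((k:ℝ)-(l+1))*(k+(l+1)*n)*b/(k:ℝ)^2 with hx
  have b3 : Bil q k N (l+1) a' b (C1 * C2 * (q:ℝ)^x) := by
    refine Bil_swap (by omega) (by omega) (B2 := C2 * (q:ℝ)^(η*N + (n*k+l)*ε*N - η*((k:ℝ)-l)*(k+l*n)*b/(k:ℝ)^2)) (by positivity) (by positivity) (by positivity) b1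
      (by simpa using b2) ?_
    set x1 := η*N + n*k*ε*N - η*((k:ℝ)-((k-(l+1):ℕ):ℝ))*((k-(l+1):ℕ):ℝ)*n*a'/(k:ℝ)^2 with hx1
    set x2 := η*N + (n*k+l)*ε*N - η*((k:ℝ)-l)*(k+l*n)*b/(k:ℝ)^2 with hx2
    have hj : ((k-(l+1):ℕ):ℝ) = (k:ℝ) - (l+1) := by push_cast [Nat.cast_sub (by omega : l+1 ≤ k)]; ring
    have key : x1 + (k-(l+1):ℕ) * x2 ≤ (1+(k-(l+1):ℕ)) * x := by
      rw [hx1, hx2, hx, hj]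
      have e1 : η*((k:ℝ)-((k:ℝ)-(l+1)))*((k:ℝ)-(l+1))*n*a'/(k:ℝ)^2 = η*((k:ℝ)-(l+1))*n*(((k:ℝ)-l)*b)/(k:ℝ)^2 := by
        rw [← hcast]; ring
      rw [e1]
      have e2 : (0:ℝ) ≤ l*ε*N := by positivity
      have : (η * N + n * k * ε * N - η*((k:ℝ)-(l+1))*n*(((k:ℝ)-l)*b)/(k:ℝ)^2 + ((k:ℝ)-(l+1)) * (η*N + (n*k+l)*ε*N - η*((k:ℝ)-l)*(k+l*n)*b/(k:ℝ)^2)) + l*ε*N = (1 + ((k:ℝ)-(l+1))) * (η*N + (n*k+l)*ε*N - η*((k:ℝ)-(l+1))*(k+(l+1)*n)*b/(k:ℝ)^2) := by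
        ring
      linarith
    have hp : ∀ (y : ℝ) (j : ℕ), ((q:ℝ)^y)^j = (q:ℝ)^(j*y) := by
      intro y j; rw [← Real.rpow_natCast, ← Real.rpow_mul hq0.le, mul_comm]
    rw [mul_pow, mul_pow, hp, hp]
    calc C1 * (q:ℝ)^x1 * (C2^(k-(l+1)) * (q:ℝ)^((k-(l+1):ℕ)*x2))
        = (C1 * C2^(k-(l+1))) * (q:ℝ)^(x1 + (k-(l+1):ℕ)*x2) := by
          rw [Real.rpow_add hq0]; ring
      _ ≤ (C1*C2)^(1+(k-(l+1))) * (q:ℝ)^(((1+(k-(l+1)):ℕ):ℝ) * x) := by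
          have : C1 * C2^(k-(l+1)) ≤ (C1*C2)^(1+(k-(l+1))) := by
            rw [mul_pow]
            exact mul_le_mul (le_self_pow₀ hC1 (by omega)) (pow_le_pow_right₀ hC2 (by omega)) (by positivity) (by positivity)
          have h9 : (((1+(k-(l+1)):ℕ):ℝ)) = 1 + ((k-(l+1):ℕ):ℝ) := by push_cast; ring
          rw [h9]
          gcongr
  have hD : Dec q (l+1) (a'-a) (C0 * (q:ℝ)^(ε*N)) := by
    refine Dec_mono (h0 (a'-a)) ?_
    have : ((a'-a:ℕ):ℝ) ≤ N := by exact_mod_cast (Nat.sub_le _ _).trans ha'N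
    gcongr
  have b4 := Bil_step hk (by omega) (by omega) ha haa' ha'N hb hbN' hla'.le (by positivity) hD b3
  refine Bil_mono b4 (le_of_eq ?_)
  have : η*N + (n*k+(l+1:ℕ))*ε*N - η*((k:ℝ)-(l+1:ℕ))*(k+(l+1:ℕ)*n)*b/(k:ℝ)^2 = ε*N + x := by
    rw [hx]; push_cast; ring
  rw [this, Real.rpow_add hq0]; ring

lemma StB_succ {η ε : ℝ} (hη : 0 ≤ η) (hε : 0 ≤ ε) (n : ℕ) (hk1 : 1 ≤ k) (hk : k < q) (hP : PD q k η)
    (hl : ∀ l, 1 ≤ l → l < k → PD q l ε) (hS : StB q k η ε n) : StB q k η ε (n+1) := by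
  have hin : ∀ l, l < k → Inn q k η ε n l := by
    intro l
    induction l with
    | zero => intro _; exact Inn_zero hε n hk1 hk hP
    | succ l ih =>
      intro h
      exact Inn_succ hη hε n l (by omega) hk (hl _ (by omega) h) hS (ih (by omega))
  have : ∀ l : Fin k, Inn q k η ε n l := fun l => hin l l.2
  unfold Inn at this
  choose C hC h using this
  have hq1 := q_one (q := q)
  have hk0 : (0:ℝ) < k := by exact_mod_cast hk1
  have hCs : ∀ l : Fin k, C l ≤ ∑ i, C i := fun l =>
    Finset.single_le_sum (f := C) (fun i _ => by linarith [hC i]) (Finset.mem_univ l)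
  refine ⟨∑ l, C l, (hC ⟨0, hk1⟩).trans (hCs _), fun N b l a hb hdiv hbN hl1 hlk ha hlab haN => ?_⟩
  refine Bil_mono (h ⟨l, hlk⟩ N b a hb hdiv hbN ha hlab haN) ?_
  have hlr : (l:ℝ) + 1 ≤ k := by exact_mod_cast hlk
  have e : η*N + (n*k+l)*ε*N - η*((k:ℝ)-l)*(k+l*n)*b/(k:ℝ)^2 ≤
     η*N + ((n+1:ℕ):ℝ)*k*ε*N - η*((k:ℝ)-l)*l*((n+1:ℕ):ℝ)*b/(k:ℝ)^2 := by
    have h1 : (n*k+l)*ε*N ≤ ((n+1:ℕ):ℝ)*k*ε*N := by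
      gcongr; push_cast; linarith
    have h2 : η*((k:ℝ)-l)*l*((n+1:ℕ):ℝ)*b/(k:ℝ)^2 ≤ η*((k:ℝ)-l)*(k+l*n)*b/(k:ℝ)^2 := by
      have : 0 ≤ η * ((k:ℝ)-l) := mul_nonneg hη (by linarith)
      rw [mul_assoc (η * ((k:ℝ)-l))]
      gcongr
      push_cast; nlinarith
    linarith
  have := hCs ⟨l, hlk⟩
  have := hC ⟨l, hlk⟩
  gcongr
  · linarith

lemma StB_all {η ε : ℝ} (hη : 0 ≤ η) (hε : 0 ≤ ε) (hk1 : 1 ≤ k) (hk : k < q) (hP : PD q k η)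
    (hl : ∀ l, 1 ≤ l → l < k → PD q l ε) (n : ℕ) : StB q k η ε n := by
  induction n with
  | zero => exact StB_zero hη hk1 hk hP
  | succ n ih => exact StB_succ hη hε n hk1 hk hP hl ih
end

lemma sum_std_mul {P : ℕ} [NeZero P] (b : ZMod P) :
    ∑ x : ZMod P, ZMod.stdAddChar (x * b) = if b = 0 then (P:ℂ) else 0 := by
  have := AddChar.sum_mulShift b (ZMod.isPrimitive_stdAddChar P)
  rw [this, ZMod.card]; split_ifs <;> simp

lemma conj_std {P : ℕ} [NeZero P] (b : ZMod P) :
    (starRingEnd ℂ) (ZMod.stdAddChar b) = ZMod.stdAddChar (-b) := by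
  rw [AddChar.map_neg_eq_conj]

lemma parseval {P : ℕ} [NeZero P] (c : ZMod P → ℂ) :
    ∑ x : ZMod P, ‖∑ t, c t * ZMod.stdAddChar (x * t)‖^2 = P * ∑ t, ‖c t‖^2 := by
  have : ((∑ x : ZMod P, ‖∑ t, c t * ZMod.stdAddChar (x * t)‖^2 : ℝ) : ℂ) = ((P * ∑ t, ‖c t‖^2 : ℝ) : ℂ) := by
    push_cast
    simp_rw [← Complex.mul_conj']
    calc _ = ∑ x : ZMod P, ∑ t, ∑ t', c t * (starRingEnd ℂ) (c t') * ZMod.stdAddChar (x * (t - t')) := by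
          refine Finset.sum_congr rfl fun x _ => ?_
          rw [map_sum, Finset.sum_mul_sum]
          refine Finset.sum_congr rfl fun t _ => Finset.sum_congr rfl fun t' _ => ?_
          rw [map_mul (starRingEnd ℂ), conj_std, mul_sub, sub_eq_add_neg, AddChar.map_add_eq_mul]; ring
      _ = ∑ t, ∑ t', c t * (starRingEnd ℂ) (c t') * ∑ x : ZMod P, ZMod.stdAddChar (x * (t - t')) := by
          rw [Finset.sum_comm]
          refine Finset.sum_congr rfl fun t _ => ?_
          rw [Finset.sum_comm]
          refine Finset.sum_congr rfl fun t' _ => ?_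
          rw [Finset.mul_sum]
      _ = _ := by
          rw [Finset.mul_sum]
          refine Finset.sum_congr rfl fun t _ => ?_
          rw [Finset.sum_eq_single t]
          · rw [sum_std_mul, sub_self, if_pos rfl]; ring
          · intro b _ hb
            rw [sum_std_mul, if_neg (sub_ne_zero.mpr (Ne.symm hb)), mul_zero]
          · simp
  exact_mod_cast this

lemma parseval' {P : ℕ} [NeZero P] {ι : Type*} (s : Finset ι) (a : ι → ℂ) (v : ι → ZMod P) :
    ∑ x : ZMod P, ‖∑ n ∈ s, a n * ZMod.stdAddChar (x * v n)‖^2 =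
      P * ∑ t, ‖∑ n ∈ s.filter (fun n => v n = t), a n‖^2 := by
  rw [← parseval]
  refine Finset.sum_congr rfl fun x _ => ?_
  congr 2
  rw [← Finset.sum_fiberwise s v]
  refine Finset.sum_congr rfl fun t _ => ?_
  rw [Finset.sum_mul]
  refine Finset.sum_congr rfl fun n hn => ?_
  rw [Finset.mem_filter] at hn
  rw [hn.2]

section
variable {q : ℕ} [Fact q.Prime]

lemma Dec_one (N : ℕ) : Dec q 1 N 1 := by
  intro M e he φ hφ s a ν
  obtain ⟨r, hr⟩ := hφ 0
  set v : ℕ → ZMod (q^M) := fun n => (q:ZMod (q^M))^e * (φ 0).eval ((ν n : ℕ) : ZMod (q^M)) with hv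
  have hpar : ∀ t : Finset ℕ, ∑ x, ‖EF q M 1 e φ a ν t x‖^(2*hh 1) =
      ((q^M : ℕ):ℝ) * ∑ u, ‖∑ n ∈ t.filter (fun n => v n = u), a n‖^2 := by
    intro t
    rw [← parseval', ← Equiv.sum_comp (Equiv.funUnique (Fin 1) (ZMod (q^M)))]
    refine Finset.sum_congr rfl fun x _ => ?_
    simp only [hh, EF, ph, Equiv.funUnique_apply, Finset.univ_unique, Finset.sum_singleton]
    simp only [Fin.default_eq_zero, hv]
    congr 2
    refine Finset.sum_congr rfl fun n _ => ?_
    congr 2; ring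
  have hclass : ∀ n m, v n = v m → ν n % q^N = ν m % q^N := by
    intro n m h
    simp only [hv] at h
    set A : ZMod (q^M) := ((ν n : ℕ) : ZMod (q^M))
    set B : ZMod (q^M) := ((ν m : ℕ) : ZMod (q^M))
    obtain ⟨w, hw⟩ := Polynomial.sub_dvd_eval_sub A B r
    have h1 : (q:ZMod (q^M))^e * (A - B) * (1 + q * w) = 0 := by
      have : (q:ZMod (q^M))^e * ((φ 0).eval A - (φ 0).eval B) = 0 := by rw [mul_sub, h, sub_self]
      rw [hr] at this
      simp only [Polynomial.eval_add, Polynomial.eval_pow, Polynomial.eval_X, Polynomial.eval_mul, Polynomial.eval_C, Fin.val_zero, zero_add, pow_one] at this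
      rw [← this, mul_assoc]; congr 1
      linear_combination (-(q:ZMod (q^M))) * hw
    have hu : IsUnit (1 + (q:ZMod (q^M)) * w) := by
      apply IsNilpotent.isUnit_one_add
      refine ⟨M, ?_⟩
      rw [mul_pow, ← Nat.cast_pow, ZMod.natCast_self, zero_mul]
    have h2 : (q:ZMod (q^M))^e * (A - B) = 0 := (hu.mul_left_eq_zero).mp h1
    have h3 : (((q:ℤ)^e * ((ν n : ℤ) - ν m) : ℤ) : ZMod (q^M)) = 0 := by push_cast; exact h2
    rw [ZMod.intCast_zmod_eq_zero_iff_dvd] at h3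
    have h4 : (q:ℤ)^N ∣ (ν n : ℤ) - ν m := by
      have h5 : (q:ℤ)^e * (q:ℤ)^N ∣ (q:ℤ)^e * ((ν n : ℤ) - ν m) := by
        refine dvd_trans ?_ h3
        rw [← pow_add]; push_cast
        exact pow_dvd_pow _ (by omega)
      exact (mul_dvd_mul_iff_left (pow_ne_zero _ (by exact_mod_cast (Fact.out : q.Prime).ne_zero))).mp h5
    have := (Int.emod_emod_of_dvd · h4)
    have h6 := (Int.emod_eq_emod_iff_emod_sub_eq_zero).mpr (Int.emod_eq_zero_of_dvd h4)
    exact_mod_cast h6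
  rw [hpar]
  simp_rw [hpar]
  rw [← Finset.mul_sum, Finset.sum_comm]
  have hmain : ∑ u, ‖∑ n ∈ s.filter (fun n => v n = u), a n‖^2 ≤
     ∑ u, ∑ r ∈ Finset.range (q^N), ‖∑ n ∈ (s.filter (fun n => ν n % q^N = r)).filter (fun n => v n = u), a n‖^2 := by
    refine Finset.sum_le_sum fun u _ => ?_
    rcases (s.filter (fun n => v n = u)).eq_empty_or_nonempty with h | ⟨n0, h0⟩
    · rw [h]; simp; exact Finset.sum_nonneg fun _ _ => by positivity
    · rw [Finset.mem_filter] at h0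
      have hq : 0 < q^N := pow_pos (Fact.out : q.Prime).pos _
      have := Finset.single_le_sum (f := fun r => ‖∑ n ∈ (s.filter (fun n => ν n % q^N = r)).filter (fun n => v n = u), a n‖^2)
        (s := Finset.range (q^N)) (fun _ _ => by positivity) (Finset.mem_range.mpr (Nat.mod_lt (ν n0) hq))
      refine le_trans (le_of_eq ?_) this
      congr 3
      ext n
      simp only [Finset.mem_filter]
      constructor
      · rintro ⟨h1, h2⟩
        exact ⟨⟨h1, hclass _ _ (h2.trans h0.2.symm)⟩, h2⟩
      · rintro ⟨⟨h1, _⟩, h2⟩; exact ⟨h1, h2⟩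
  simp only [hh, pow_one, one_mul, zero_add]
  gcongr

lemma crude {ι : Type*} (s : Finset ι) (a : ι → ℝ) (ha : ∀ i ∈ s, 0 ≤ a i) (m : ℕ) (hm : m ≠ 0) :
    (∑ i ∈ s, a i)^m ≤ (s.card:ℝ)^m * ∑ i ∈ s, a i^m := by
  rcases s.eq_empty_or_nonempty with h | h
  · rw [h]; simp [hm]
  obtain ⟨i0, hi0, hmax⟩ := Finset.exists_max_image s a h
  have h1 : ∑ i ∈ s, a i ≤ s.card * a i0 := by
    rw [← nsmul_eq_mul]; exact Finset.sum_le_card_nsmul _ _ _ hmax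
  calc _ ≤ (s.card * a i0)^m := pow_le_pow_left₀ (Finset.sum_nonneg ha) h1 _
    _ = (s.card:ℝ)^m * a i0^m := by rw [mul_pow]
    _ ≤ _ := by
      gcongr
      exact Finset.single_le_sum (f := fun i => a i^m) (fun i hi => pow_nonneg (ha i hi) _) hi0

lemma broad_narrow {q m : ℕ} (hq : 1 ≤ q) (hm : 3 ≤ m) (f : ℝ) (hf : 0 ≤ f) (A : ℕ → ℝ) (hA : ∀ i, 0 ≤ A i)
    (hfA : f ≤ ∑ i ∈ Finset.range q, A i) :
    f^m ≤ 2^m * ∑ i ∈ Finset.range q, A i^m + (q:ℝ)^(2*m) * ∑ i ∈ Finset.range q,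
      ∑ j ∈ (Finset.range q).filter (fun j => j ≠ i), A i^2 * A j^(m-2) := by
  obtain ⟨i0, hi0, hmax⟩ := Finset.exists_max_image (Finset.range q) A ⟨0, by simp; omega⟩
  have hq' : (1:ℝ) ≤ q := by exact_mod_cast hq
  have n1 : 0 ≤ ∑ i ∈ Finset.range q, A i^m := Finset.sum_nonneg fun i _ => pow_nonneg (hA i) _
  have n3 : ∀ i, 0 ≤ ∑ j ∈ (Finset.range q).filter (fun j => j ≠ i), A i^2 * A j^(m-2) :=
    fun i => Finset.sum_nonneg fun j _ => mul_nonneg (pow_nonneg (hA i) _) (pow_nonneg (hA j) _)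
  have n2 : 0 ≤ ∑ i ∈ Finset.range q, ∑ j ∈ (Finset.range q).filter (fun j => j ≠ i), A i^2 * A j^(m-2) :=
    Finset.sum_nonneg fun i _ => n3 i
  by_cases h : ∃ j ∈ Finset.range q, j ≠ i0 ∧ A i0 ≤ q * A j
  · obtain ⟨j, hj, hj0, hle⟩ := h
    have h1 : f ≤ q * A i0 := by
      refine hfA.trans ?_
      have := Finset.sum_le_card_nsmul _ _ _ hmax
      simpa using this
    have h2 : A i0^2 * A j^(m-2) ≤ ∑ i ∈ Finset.range q, ∑ j ∈ (Finset.range q).filter (fun j => j ≠ i), A i^2 * A j^(m-2) := by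
      refine le_trans ?_ (Finset.single_le_sum (f := fun i => ∑ j ∈ (Finset.range q).filter (fun j => j ≠ i), A i^2 * A j^(m-2)) (fun i _ => n3 i) hi0)
      exact Finset.single_le_sum (f := fun j => A i0^2 * A j^(m-2)) (fun j _ => mul_nonneg (pow_nonneg (hA _) _) (pow_nonneg (hA j) _))
        (Finset.mem_filter.mpr ⟨hj, hj0⟩)
    have h3 : f^m ≤ (q:ℝ)^(2*m) * (A i0^2 * A j^(m-2)) := by
      have hA0 := hA i0
      have hAj := hA j
      calc f^m ≤ (q * A i0)^m := pow_le_pow_left₀ hf h1 _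
        _ = (q:ℝ)^m * (A i0^2 * A i0^(m-2)) := by rw [mul_pow, ← pow_add]; congr 2; omega
        _ ≤ (q:ℝ)^m * (A i0^2 * (q * A j)^(m-2)) := by gcongr
        _ = (q:ℝ)^(m+(m-2)) * (A i0^2 * A j^(m-2)) := by rw [mul_pow, pow_add]; ring
        _ ≤ _ := by
          gcongr
          omega
    nlinarith [mul_le_mul_of_nonneg_left h2 (by positivity : (0:ℝ) ≤ (q:ℝ)^(2*m)), (by positivity : (0:ℝ) ≤ 2^m * ∑ i ∈ Finset.range q, A i^m)]
  · push Not at h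
    have h1 : f ≤ 2 * A i0 := by
      refine hfA.trans ?_
      rw [← Finset.add_sum_erase _ _ hi0]
      have : ∑ i ∈ (Finset.range q).erase i0, A i ≤ ((Finset.range q).erase i0).card • (A i0 / q) := by
        refine Finset.sum_le_card_nsmul _ _ _ fun j hj => ?_
        rw [Finset.mem_erase] at hj
        rw [le_div_iff₀ (by linarith)]
        linarith [h j hj.2 hj.1]
      rw [nsmul_eq_mul, Finset.card_erase_of_mem hi0, Finset.card_range, Nat.cast_sub hq] at this
      have h2 : ((q:ℝ) - (1:ℕ)) * (A i0/q) ≤ A i0 := by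
        rw [mul_div_assoc', div_le_iff₀ (by linarith)]
        push_cast; nlinarith [hA i0]
      linarith
    have h2 : f^m ≤ 2^m * A i0^m := by rw [← mul_pow]; exact pow_le_pow_left₀ hf h1 _
    have h3 : A i0^m ≤ ∑ i ∈ Finset.range q, A i^m :=
      Finset.single_le_sum (f := fun i => A i^m) (fun i _ => pow_nonneg (hA i) _) hi0
    have : (0:ℝ) ≤ (q:ℝ)^(2*m) * ∑ i ∈ Finset.range q, ∑ j ∈ (Finset.range q).filter (fun j => j ≠ i), A i^2 * A j^(m-2) := by positivity
    nlinarith [mul_le_mul_of_nonneg_left h3 (by positivity : (0:ℝ) ≤ (2:ℝ)^m)]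
end

section
variable {q k N : ℕ} [Fact q.Prime]

lemma Cx.F_split (X : Cx q k N) {a t I : ℕ} (hI : I < q^a) (x : Fin k → ZMod (q^X.M)) :
    X.F a I x = ∑ r ∈ Finset.range (q^t), X.F (a+t) (I + q^a * r) x := by
  unfold Cx.F
  simp_rw [← filt_split X.s X.ν hI]
  unfold EF
  rw [Finset.sum_fiberwise_of_maps_to]
  intro n _
  exact Finset.mem_range.mpr (Nat.mod_lt _ (pow_pos (Fact.out : q.Prime).pos _))

lemma Dec_of_Cx {K : ℝ} (h : ∀ X : Cx q k N, ∑ x, ‖X.F 0 0 x‖^(2*hh k) ≤ K * ((q:ℝ)^N)^(hh k) * X.T 0 0) :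
    Dec q k N K := by
  intro M e he φ hφ s a ν
  have := h ⟨M, e, he, φ, hφ, s, a, ν⟩
  have h2 : (0:ℝ) < (q:ℝ)^N := by have := qpos (q := q); positivity
  simp only [Cx.F, Cx.T, Cx.V, pow_zero, Nat.mod_one, Finset.filter_true, Nat.sub_zero, zero_add, one_mul] at this
  calc _ ≤ (q:ℝ)^N * _ := mul_le_mul_of_nonneg_left this h2.le
    _ = _ := by field_simp

lemma bn_step (hk2 : 2 ≤ k) (hk : k < q) (hq : 32 ≤ q) {b : ℕ} (hb : 1 ≤ b) (hbN : b ≤ N) {K B : ℝ}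
    (hK : 0 ≤ K) (hB0 : 0 ≤ B) (hD : Dec q k (N-1) K) (hB : Bil q k N 1 1 b B) :
    Dec q k N (K/2 + (q:ℝ)^(2*(2*hh k)+2+b*(2*hh k)) * B) := by
  apply Dec_of_Cx
  intro X
  have hh3 : 3 ≤ hh k := hh_mono hk2
  have hq0 : (0:ℝ) < (q:ℝ) := qpos
  have hq1 : (1:ℝ) ≤ (q:ℝ) := q_one
  have hqr : (32:ℝ) ≤ q := by exact_mod_cast hq
  set p := 2 * hh k with hp
  have hS1 : ∑ I ∈ Finset.range q, X.T 1 I = q * X.T 0 0 := by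
    have := X.T_split (a := 0) (a' := 1) (I := 0) (by omega) (by omega)
    simpa using this
  have hS2 : ∀ J, ∑ r ∈ Finset.range (q^(b-1)), X.T b (J + q * r) = (q:ℝ)^(b-1) * X.T 1 J := by
    intro J
    have := X.T_split (a := 1) (a' := b) (I := J) hb hbN
    simpa using this
  have hT := X.T_nonneg 0 0
  have hpt : ∀ x, ‖X.F 0 0 x‖^p ≤ 2^p * ∑ I ∈ Finset.range q, ‖X.F 1 I x‖^p + (q:ℝ)^(2*p) * ∑ I ∈ Finset.range q,
      ∑ J ∈ (Finset.range q).filter (fun j => j ≠ I), ‖X.F 1 I x‖^2 * ‖X.F 1 J x‖^(p-2) := by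
    intro x
    refine broad_narrow (by omega) (by omega) _ (norm_nonneg _) (fun I => ‖X.F 1 I x‖) (fun _ => norm_nonneg _) ?_
    rw [X.F_split (a := 0) (t := 1) (I := 0) (by simp)]
    simp only [pow_one, zero_add, pow_zero, one_mul]
    exact norm_sum_le _ _
  have hnar : ∑ I ∈ Finset.range q, ∑ x, ‖X.F 1 I x‖^p ≤ K * ((q:ℝ)^(N-1))^(hh k) * (q * X.T 0 0) := by
    rw [← hS1, Finset.mul_sum]
    refine Finset.sum_le_sum fun I hI => ?_
    exact lemma0 X (by omega) hk le_rfl (by omega) (by simpa using hI) hD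
  have hNh : ((q:ℝ)^N)^(hh k) = (q:ℝ)^(hh k) * ((q:ℝ)^(N-1))^(hh k) := by
    rw [← mul_pow, ← pow_succ']; congr 3; omega
  have h2p : (2:ℝ)^p * q ≤ (q:ℝ)^(hh k) / 2 := by
    have e1 : (q:ℝ)^(hh k) = q * (q:ℝ)^(hh k - 1) := by rw [← pow_succ']; congr 1; omega
    have e2 : (2:ℝ)^(p+1) ≤ (q:ℝ)^(hh k - 1) := by
      calc (2:ℝ)^(p+1) ≤ 2^(5*(hh k - 1)) := by gcongr <;> [norm_num; omega]
        _ = (32:ℝ)^(hh k - 1) := by rw [pow_mul]; norm_num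
        _ ≤ _ := by gcongr
    rw [pow_succ] at e2
    rw [e1]; nlinarith
  have hbr : ∀ I ∈ Finset.range q, ∀ J ∈ (Finset.range q).filter (fun j => j ≠ I),
      ∑ x, ‖X.F 1 I x‖^2 * ‖X.F 1 J x‖^(p-2) ≤ (q:ℝ)^(b*(p-2)) * (B * ((q:ℝ)^N)^(hh k)) *
        ∑ r ∈ Finset.range (q^(b-1)), (X.T 1 I + X.T b (J + q*r)) := by
    intro I hI J hJ
    rw [Finset.mem_filter, Finset.mem_range] at hJ
    rw [Finset.mem_range] at hI
    have c1 : ∀ x, ‖X.F 1 J x‖^(p-2) ≤ (q:ℝ)^(b*(p-2)) * ∑ r ∈ Finset.range (q^(b-1)), ‖X.F b (J+q*r) x‖^(p-2) := by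
      intro x
      have hs := X.F_split (a := 1) (t := b-1) (I := J) (by simpa using hJ.1) x
      rw [hs, show 1 + (b-1) = b by omega, pow_one]
      calc _ ≤ (∑ r ∈ Finset.range (q^(b-1)), ‖X.F b (J+q*r) x‖)^(p-2) := by
            gcongr; exact norm_sum_le _ _
        _ ≤ _ := crude _ _ (fun _ _ => norm_nonneg _) _ (by omega)
        _ ≤ _ := by
            rw [Finset.card_range]
            push_cast
            rw [← pow_mul]
            gcongr
            omega
    calc _ ≤ ∑ x, ‖X.F 1 I x‖^2 * ((q:ℝ)^(b*(p-2)) * ∑ r ∈ Finset.range (q^(b-1)), ‖X.F b (J+q*r) x‖^(p-2)) := by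
          gcongr with x; exact c1 x
      _ = (q:ℝ)^(b*(p-2)) * ∑ r ∈ Finset.range (q^(b-1)), ∑ x, ‖X.F 1 I x‖^2 * ‖X.F b (J+q*r) x‖^(p-2) := by
          rw [Finset.sum_comm, Finset.mul_sum]
          refine Finset.sum_congr rfl fun x _ => ?_
          rw [← Finset.mul_sum]; ring
      _ ≤ (q:ℝ)^(b*(p-2)) * ∑ r ∈ Finset.range (q^(b-1)), B * ((q:ℝ)^N)^(hh k) * (X.T 1 I + X.T b (J + q*r)) := by
          gcongr with r hr
          rw [Finset.mem_range] at hr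
          have hJr : J + q * r < q^b := by
            have : q^b = q * q^(b-1) := by rw [← pow_succ']; congr 1; omega
            rw [this]
            have := Nat.mul_le_mul_left q (Nat.succ_le_of_lt hr)
            rw [Nat.mul_succ] at this
            omega
          have := hB X I (J+q*r) (by simpa using hI) hJr (by
            rw [Nat.add_mul_mod_self_left, Nat.mod_eq_of_lt hI, Nat.mod_eq_of_lt hJ.1]; exact fun h => hJ.2 h.symm)
          have e1 : hh 1 = 1 := rfl
          rw [e1, mul_one, show 2*(hh k - 1) = p - 2 by omega] at this
          refine this.trans ?_
          have t1 := X.T_nonneg 1 I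
          have t2 := X.T_nonneg b (J+q*r)
          have : ((q:ℝ)^(N-1))^1 * ((q:ℝ)^(N-b))^(hh k - 1) ≤ ((q:ℝ)^N)^(hh k) := by
            calc _ ≤ ((q:ℝ)^N)^1 * ((q:ℝ)^N)^(hh k - 1) := by gcongr <;> omega
              _ = _ := by rw [← pow_add]; congr 1; omega
          gcongr
      _ = _ := by rw [Finset.mul_sum, Finset.mul_sum]; exact Finset.sum_congr rfl fun _ _ => by ring
  have hbr2 : ∑ I ∈ Finset.range q, ∑ J ∈ (Finset.range q).filter (fun j => j ≠ I),
      ∑ x, ‖X.F 1 I x‖^2 * ‖X.F 1 J x‖^(p-2) ≤ (q:ℝ)^(b*(p-2)) * (B * ((q:ℝ)^N)^(hh k)) * (2 * (q:ℝ)^(b+1) * X.T 0 0) := by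
    calc _ ≤ ∑ I ∈ Finset.range q, ∑ J ∈ (Finset.range q).filter (fun j => j ≠ I), (q:ℝ)^(b*(p-2)) * (B * ((q:ℝ)^N)^(hh k)) *
        ∑ r ∈ Finset.range (q^(b-1)), (X.T 1 I + X.T b (J + q*r)) :=
          Finset.sum_le_sum fun I hI => Finset.sum_le_sum fun J hJ => hbr I hI J hJ
      _ ≤ ∑ I ∈ Finset.range q, ∑ J ∈ (Finset.range q), (q:ℝ)^(b*(p-2)) * (B * ((q:ℝ)^N)^(hh k)) *
        ∑ r ∈ Finset.range (q^(b-1)), (X.T 1 I + X.T b (J + q*r)) := by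
          refine Finset.sum_le_sum fun I hI => Finset.sum_le_sum_of_subset_of_nonneg (Finset.filter_subset _ _) fun J _ _ => ?_
          exact mul_nonneg (by positivity) (Finset.sum_nonneg fun r _ => add_nonneg (X.T_nonneg _ _) (X.T_nonneg _ _))
      _ = _ := by
          simp_rw [← Finset.mul_sum, Finset.sum_add_distrib, hS2, ← Finset.mul_sum, hS1]
          simp only [Finset.sum_const, Finset.card_range, nsmul_eq_mul, ← Finset.mul_sum, hS1]
          rw [show b + 1 = (b-1)+2 by omega]
          push_cast
          ring
  calc _ ≤ ∑ x, (2^p * ∑ I ∈ Finset.range q, ‖X.F 1 I x‖^p + (q:ℝ)^(2*p) * ∑ I ∈ Finset.range q,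
      ∑ J ∈ (Finset.range q).filter (fun j => j ≠ I), ‖X.F 1 I x‖^2 * ‖X.F 1 J x‖^(p-2)) :=
        Finset.sum_le_sum fun x _ => hpt x
    _ = 2^p * (∑ I ∈ Finset.range q, ∑ x, ‖X.F 1 I x‖^p) + (q:ℝ)^(2*p) * ∑ I ∈ Finset.range q,
      ∑ J ∈ (Finset.range q).filter (fun j => j ≠ I), ∑ x, ‖X.F 1 I x‖^2 * ‖X.F 1 J x‖^(p-2) := by
        rw [Finset.sum_add_distrib, ← Finset.mul_sum, ← Finset.mul_sum, Finset.sum_comm]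
        congr 2
        rw [Finset.sum_comm]
        exact Finset.sum_congr rfl fun I _ => Finset.sum_comm
    _ ≤ 2^p * (K * ((q:ℝ)^(N-1))^(hh k) * (q * X.T 0 0)) + (q:ℝ)^(2*p) *
        ((q:ℝ)^(b*(p-2)) * (B * ((q:ℝ)^N)^(hh k)) * (2 * (q:ℝ)^(b+1) * X.T 0 0)) := by
        gcongr
    _ ≤ _ := by
        rw [add_mul, add_mul]
        apply add_le_add
        · rw [hNh]
          calc _ = (2^p * q) * (K * ((q:ℝ)^(N-1))^(hh k) * X.T 0 0) := by ring
            _ ≤ ((q:ℝ)^(hh k) / 2) * (K * ((q:ℝ)^(N-1))^(hh k) * X.T 0 0) := by gcongr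
            _ = _ := by ring
        · calc _ = ((q:ℝ)^(2*p) * (q:ℝ)^(b*(p-2)) * 2 * (q:ℝ)^(b+1)) * (B * ((q:ℝ)^N)^(hh k) * X.T 0 0) := by ring
            _ ≤ ((q:ℝ)^(2*p) * (q:ℝ)^(b*(p-2)) * q * (q:ℝ)^(b+1)) * (B * ((q:ℝ)^N)^(hh k) * X.T 0 0) := by
                gcongr; linarith
            _ ≤ (q:ℝ)^(2*p+2+b*p) * (B * ((q:ℝ)^N)^(hh k) * X.T 0 0) := by
                gcongr
                rw [← pow_add, ← pow_succ, ← pow_add]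
                apply pow_le_pow_right₀ hq1
                have : b*p = b*(p-2) + b * 2 := by rw [← mul_add]; congr 1; omega
                rw [this]; omega
            _ = _ := by ring
end

section
variable {q k : ℕ} [Fact q.Prime]

lemma PD_mono {η η' : ℝ} (h : η ≤ η') (hP : PD q k η) : PD q k η' := by
  obtain ⟨C, hC, h1⟩ := hP
  refine ⟨C, hC, fun N => Dec_mono (h1 N) ?_⟩
  have := q_one (q := q)
  gcongr

lemma PD_start (hk1 : 1 ≤ k) : PD q k (hh k + 1) := by
  refine ⟨1, le_rfl, fun N => ?_⟩
  have hq0 : (0:ℝ) < (q:ℝ) := qpos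
  have hh1 : 1 ≤ hh k := hh_mono hk1
  intro M e he φ hφ s a ν
  have e1 : 1 * (q:ℝ)^(((hh k : ℝ)+1)*N) * ((q:ℝ)^N)^(hh k) = (q:ℝ)^N * ((q:ℝ)^N)^(2*hh k) := by
    rw [one_mul, mul_comm _ (N:ℝ), rpow_mul hq0.le, rpow_natCast, rpow_add_one (by positivity), rpow_natCast, two_mul, pow_add]; ring
  rw [e1, mul_assoc]
  gcongr
  rw [Finset.sum_comm, Finset.mul_sum]
  refine Finset.sum_le_sum fun x _ => ?_
  have : EF q M k e φ a ν s x = ∑ r ∈ Finset.range (q^N), EF q M k e φ a ν (s.filter (fun n => ν n % q^N = r)) x := by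
    unfold EF
    rw [Finset.sum_fiberwise_of_maps_to]
    intro n _
    exact Finset.mem_range.mpr (Nat.mod_lt _ (pow_pos (Fact.out : q.Prime).pos _))
  rw [this]
  calc _ ≤ (∑ r ∈ Finset.range (q^N), ‖EF q M k e φ a ν (s.filter (fun n => ν n % q^N = r)) x‖)^(2*hh k) := by
        gcongr; exact norm_sum_le _ _
    _ ≤ _ := crude _ _ (fun _ _ => norm_nonneg _) _ (by omega)
    _ = _ := by rw [Finset.card_range]; push_cast; ring

lemma PD_improve (hk2 : 2 ≤ k) (hk : k < q) (hq : 32 ≤ q) (hl : ∀ l, 1 ≤ l → l < k → ∀ ε : ℝ, 0 < ε → PD q l ε)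
    {ε : ℝ} (hε : 0 < ε) : ∃ κ : ℝ, 0 < κ ∧ κ ≤ ε ∧ ∀ η, ε ≤ η → PD q k η → PD q k (η - κ) := by
  have hq0 : (0:ℝ) < (q:ℝ) := qpos
  have hq1 : (1:ℝ) ≤ (q:ℝ) := q_one
  have hk0 : (2:ℝ) ≤ k := by exact_mod_cast hk2
  set p := 2 * hh k with hp
  obtain ⟨n, hn⟩ := exists_nat_ge (((p:ℝ)+1) * (k:ℝ)^2 / (ε * ((k:ℝ)-1)))
  have hden : 0 < ε * ((k:ℝ)-1) := mul_pos hε (by linarith)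
  rw [div_le_iff₀ hden] at hn
  have hn0 : (0:ℝ) < n := by
    by_contra h
    have : (0:ℝ) < ((p:ℝ)+1) * (k:ℝ)^2 := by positivity
    nlinarith
  set β : ℝ := ((k:ℝ)^(n+1))⁻¹ with hβ
  have hβ0 : 0 < β := by positivity
  set ε' : ℝ := β / (2*n*k) with hε'
  have hε'0 : 0 < ε' := by positivity
  set D := (k.factorial)^n with hD
  have hD1 : 1 ≤ D := Nat.one_le_pow _ _ (Nat.factorial_pos k)
  set N0 := D * k^(n+1) with hN0
  have hN01 : 1 ≤ N0 := Nat.one_le_iff_ne_zero.mpr (by positivity)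
  refine ⟨min (β/2) ε, by positivity, min_le_right _ _, fun η hη hP => ?_⟩
  set κ := min (β/2) ε with hκ
  obtain ⟨CB, hCB, hB⟩ := StB_all (ε := ε') (by linarith) hε'0.le (by omega) hk hP (fun l h1 h2 => hl l h1 h2 _ hε'0) n
  obtain ⟨C, hC, hCd⟩ := hP
  set E : ℝ := (q:ℝ)^(2*(p:ℝ)+2+N0*β) with hE
  have hE0 : 0 < E := by positivity
  set C' : ℝ := C * (q:ℝ)^(κ*N0) + 2 * (CB * E) with hC'
  have hκ0 : 0 < κ := by positivity
  have hC'1 : C * (q:ℝ)^(κ*N0) ≤ C' := by rw [hC']; nlinarith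
  have h1q : 1 ≤ (q:ℝ)^(κ*N0) := one_le_rpow hq1 (by positivity)
  refine ⟨C', ?_, ?_⟩
  · refine le_trans ?_ hC'1
    nlinarith
  intro N
  induction N using Nat.strong_induction_on with
  | _ N ih =>
    by_cases hN : N < N0
    · refine Dec_mono (hCd N) ?_
      calc C * (q:ℝ)^(η*N) = C * ((q:ℝ)^(κ*N) * (q:ℝ)^((η-κ)*N)) := by
            rw [← rpow_add hq0]; congr 2; ring
        _ ≤ C * ((q:ℝ)^(κ*N0) * (q:ℝ)^((η-κ)*N)) := by
            have : (N:ℝ) ≤ N0 := by exact_mod_cast hN.le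
            gcongr
        _ ≤ C' * (q:ℝ)^((η-κ)*N) := by
            rw [← mul_assoc]; gcongr
    · push Not at hN
      set b := D * (N / N0) with hb
      have hdiv1 : 1 ≤ N / N0 := Nat.div_pos hN hN01
      have hb1 : 1 ≤ b := Nat.mul_pos hD1 hdiv1
      have hbe : b * k^(n+1) = N0 * (N/N0) := by rw [hb, hN0]; ring
      have hbk : b * k^(n+1) ≤ N := by rw [hbe]; exact Nat.mul_div_le _ _
      have hbN : b ≤ N := le_trans (Nat.le_mul_of_pos_right _ (by positivity)) hbk
      have hbig : N ≤ b * k^(n+1) + N0 := by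
        rw [hbe]
        have := Nat.div_add_mod N N0
        have := Nat.mod_lt N hN01
        omega
      have hbr : (N:ℝ) * β ≤ b + N0 * β := by
        have : (N:ℝ) ≤ b * (k:ℝ)^(n+1) + N0 := by exact_mod_cast hbig
        calc (N:ℝ) * β ≤ (b * (k:ℝ)^(n+1) + N0) * β := by gcongr
          _ = _ := by rw [add_mul, mul_assoc, hβ, mul_inv_cancel₀ (by positivity), mul_one]
      have hBil := hB N b 1 1 hb1 ⟨N/N0, rfl⟩ hbk le_rfl (by omega) le_rfl (by
        have : 1 ≤ (k-1+1)*b := Nat.mul_pos (by omega) hb1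
        omega) (by omega)
      have := bn_step hk2 hk hq hb1 hbN (by positivity) (by positivity) (ih (N-1) (by omega)) hBil
      refine Dec_mono this ?_
      clear_value b
      have hηκ : 0 ≤ η - κ := by linarith [min_le_right (β/2) ε]
      have t1 : C' * (q:ℝ)^((η-κ)*((N-1:ℕ):ℝ)) / 2 ≤ C' * (q:ℝ)^((η-κ)*N) / 2 := by
        have : ((N-1:ℕ):ℝ) ≤ N := by exact_mod_cast Nat.sub_le _ _
        have : 0 ≤ C' := by positivity
        gcongr
      have t2 : (q:ℝ)^(2*(2*hh k)+2+b*(2*hh k)) * (CB * (q:ℝ)^(η*N + n*k*ε'*N - η*((k:ℝ)-(1:ℕ))*(1:ℕ)*n*b/(k:ℝ)^2)) ≤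
          CB * E * (q:ℝ)^((η-κ)*N) := by
        rw [← rpow_natCast, mul_left_comm, mul_assoc CB, ← rpow_add hq0, hE, ← rpow_add hq0]
        refine mul_le_mul_of_nonneg_left (rpow_le_rpow_of_exponent_le hq1 ?_) (by positivity)
        push_cast
        have e1 : (n:ℝ)*k*ε' = β/2 := by rw [hε']; field_simp
        have e2 : ((p:ℝ)+1) * b ≤ η*((k:ℝ)-1)*1*n*b/(k:ℝ)^2 := by
          rw [le_div_iff₀ (by positivity)]
          have : ((p:ℝ)+1) * (k:ℝ)^2 ≤ η * ((k:ℝ)-1) * n := by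
            refine hn.trans ?_
            have : ε * ((k:ℝ)-1) ≤ η * ((k:ℝ)-1) := mul_le_mul_of_nonneg_right hη (by linarith)
            nlinarith
          nlinarith [(Nat.cast_nonneg b : (0:ℝ) ≤ b)]
        have e3 : κ * N ≤ β/2 * N := by gcongr; exact min_le_left _ _
        have e4 : (p:ℝ) = 2 * (hh k : ℝ) := by rw [hp]; push_cast; ring
        rw [e1]
        rw [e4] at e2 ⊢
        nlinarith
      have : C' * (q:ℝ)^((η-κ)*N) / 2 + CB * E * (q:ℝ)^((η-κ)*N) ≤ C' * (q:ℝ)^((η-κ)*N) := by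
        have : 2 * (CB * E) ≤ C' := by rw [hC']; have : 0 ≤ C * (q:ℝ)^(κ*N0) := by positivity
                                       linarith
        have := mul_le_mul_of_nonneg_right this (by positivity : 0 ≤ (q:ℝ)^((η-κ)*N))
        linarith
      exact (add_le_add t1 t2).trans this

lemma PD_all (hq : 32 ≤ q) : ∀ k, 1 ≤ k → k < q → ∀ ε : ℝ, 0 < ε → PD q k ε := by
  intro k
  induction k using Nat.strong_induction_on with
  | _ k ih =>
    intro hk1 hk ε hε
    rcases Nat.lt_or_ge 1 k with h | h
    · obtain ⟨κ, hκ, hκε, himp⟩ := PD_improve h hk hq (fun l h1 h2 => ih l h2 h1 (by omega)) hε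
      have : ∀ n : ℕ, PD q k (max ε ((hh k : ℝ) + 1 - n * κ)) := by
        intro n
        induction n with
        | zero => exact PD_mono (by simp) (PD_start hk1)
        | succ n ihn =>
          refine PD_mono ?_ (himp _ (le_max_left _ _) ihn)
          rcases le_total ε ((hh k : ℝ) + 1 - n * κ) with h1 | h1
          · rw [max_eq_right h1]
            refine le_trans (le_of_eq ?_) (le_max_right _ _)
            push_cast; ring
          · rw [max_eq_left h1]
            exact le_trans (by linarith) (le_max_left _ _)
      obtain ⟨n, hn⟩ := exists_nat_ge (((hh k : ℝ) + 1) / κ)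
      rw [div_le_iff₀ hκ] at hn
      have h2 := this n
      rwa [max_eq_left (by linarith)] at h2
    · have : k = 1 := by omega
      subst this
      refine ⟨1, le_rfl, fun N => Dec_mono (Dec_one N) ?_⟩
      have := q_one (q := q)
      rw [one_mul]
      exact one_le_rpow this (by positivity)

end

def Gk (P k Y : ℕ) [NeZero P] (θ : Fin k → ZMod P) : ℂ :=
  ∑ y ∈ Finset.Icc 1 Y, ZMod.stdAddChar (∑ j, θ j * (y : ZMod P)^((j:ℕ)+1))

lemma vmvt {q : ℕ} [Fact q.Prime] (hq : 32 ≤ q) {k : ℕ} (hk1 : 1 ≤ k) (hk : k < q) {ε : ℝ} (hε : 0 < ε) :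
    ∃ C : ℝ, 1 ≤ C ∧ ∀ N M Y : ℕ, k * N ≤ M → Y < q^N →
      ∑ θ, ‖Gk (q^M) k Y θ‖^(2*hh k) ≤ C * ((q:ℝ)^N)^(hh k) * (q:ℝ)^(ε*N) * ((q:ℝ)^M)^k := by
  obtain ⟨C, hC, h⟩ := PD_all hq k hk1 hk ε hε
  refine ⟨C, hC, fun N M Y hM hY => ?_⟩
  have hq0 : (0:ℝ) < (q:ℝ) := qpos
  have hN0 : (0:ℝ) < (q:ℝ)^N := by positivity
  have := h N M 0 (by omega) (fun j => Polynomial.X^((j:ℕ)+1)) (fun j => ⟨0, by simp⟩) (Finset.Icc 1 Y) (fun _ => 1) id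
  have e1 : ∀ θ, EF q M k 0 (fun j => Polynomial.X^((j:ℕ)+1)) (fun _ => 1) id (Finset.Icc 1 Y) θ = Gk (q^M) k Y θ := by
    intro θ; simp [EF, ph, Gk]
  simp_rw [e1] at this
  have e2 : ∀ r ∈ Finset.range (q^N), ∑ x, ‖EF q M k 0 (fun j => Polynomial.X^((j:ℕ)+1)) (fun _ => 1) id
      ((Finset.Icc 1 Y).filter (fun n => id n % q^N = r)) x‖^(2*hh k) ≤ ((q:ℝ)^M)^k := by
    intro r hr
    calc _ ≤ ∑ x : Fin k → ZMod (q^M), (1:ℝ) := by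
          refine Finset.sum_le_sum fun x _ => pow_le_one₀ (norm_nonneg _) ?_
          unfold EF
          refine (norm_sum_le _ _).trans ?_
          simp only [one_mul, norm_std, Finset.sum_const, nsmul_eq_mul, mul_one]
          have : ((Finset.Icc 1 Y).filter (fun n => id n % q^N = r)).card ≤ 1 := by
            rw [Finset.card_le_one]
            intro a ha b hb
            simp only [Finset.mem_filter, Finset.mem_Icc, id] at ha hb
            have h1 := ha.2
            have h2 := hb.2
            rw [Nat.mod_eq_of_lt (by omega)] at h1 h2
            omega
          exact_mod_cast this
      _ = _ := by simp
  have e3 := Finset.sum_le_sum e2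
  rw [Finset.sum_const, Finset.card_range, nsmul_eq_mul] at e3
  have e4 := this.trans (mul_le_mul_of_nonneg_left e3 (by positivity))
  push_cast at e4
  rw [← mul_le_mul_iff_right₀ hN0]
  refine e4.trans (le_of_eq ?_)
  ring

lemma std_sum {P : ℕ} [NeZero P] {ι : Type*} (s : Finset ι) (g : ι → ZMod P) :
    ZMod.stdAddChar (∑ i ∈ s, g i) = ∏ i ∈ s, ZMod.stdAddChar (g i) := by
  induction s using Finset.induction_on with
  | empty => simp
  | insert a s ha ih => rw [Finset.sum_insert ha, Finset.prod_insert ha, AddChar.map_add_eq_mul, ih]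

lemma sum_std_multi {P : ℕ} [NeZero P] {n : ℕ} (b : Fin n → ZMod P) :
    ∑ x : Fin n → ZMod P, ZMod.stdAddChar (∑ j, x j * b j) = if b = 0 then (P:ℂ)^n else 0 := by
  have h1 : ∀ x : Fin n → ZMod P, ZMod.stdAddChar (∑ j, x j * b j) = ∏ j, ZMod.stdAddChar (x j * b j) := by
    intro x; exact std_sum _ _
  simp_rw [h1]
  have := (Finset.prod_univ_sum (fun _ : Fin n => (Finset.univ : Finset (ZMod P))) (fun j x => ZMod.stdAddChar (x * b j)))
  rw [Fintype.piFinset_univ] at this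
  rw [← this]
  simp_rw [sum_std_mul]
  split_ifs with hb
  · simp [hb]
  · obtain ⟨j, hj⟩ := Function.ne_iff.mp hb
    exact Finset.prod_eq_zero (Finset.mem_univ j) (if_neg hj)

lemma parseval_multi {P : ℕ} [NeZero P] {n : ℕ} {ι : Type*} (s : Finset ι) (a : ι → ℂ) (v : ι → Fin n → ZMod P) :
    ∑ x : Fin n → ZMod P, ‖∑ i ∈ s, a i * ZMod.stdAddChar (∑ j, x j * v i j)‖^2 =
      (P:ℝ)^n * ∑ u, ‖∑ i ∈ s.filter (fun i => v i = u), a i‖^2 := by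
  set c : (Fin n → ZMod P) → ℂ := fun u => ∑ i ∈ s.filter (fun i => v i = u), a i with hc
  have h0 : ∀ x : Fin n → ZMod P, ∑ i ∈ s, a i * ZMod.stdAddChar (∑ j, x j * v i j) =
      ∑ u, c u * ZMod.stdAddChar (∑ j, x j * u j) := by
    intro x
    rw [← Finset.sum_fiberwise s v]
    refine Finset.sum_congr rfl fun t _ => ?_
    rw [hc, Finset.sum_mul]
    refine Finset.sum_congr rfl fun i hi => ?_
    rw [Finset.mem_filter] at hi
    rw [hi.2]
  simp_rw [h0]
  have : ((∑ x : Fin n → ZMod P, ‖∑ u, c u * ZMod.stdAddChar (∑ j, x j * u j)‖^2 : ℝ) : ℂ) = (((P:ℝ)^n * ∑ u, ‖c u‖^2 : ℝ) : ℂ) := by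
    push_cast
    simp_rw [← Complex.mul_conj']
    calc _ = ∑ x : Fin n → ZMod P, ∑ t, ∑ t', c t * (starRingEnd ℂ) (c t') * ZMod.stdAddChar (∑ j, x j * (t - t') j) := by
          refine Finset.sum_congr rfl fun x _ => ?_
          rw [map_sum, Finset.sum_mul_sum]
          refine Finset.sum_congr rfl fun t _ => Finset.sum_congr rfl fun t' _ => ?_
          have : ∑ j, x j * (t - t') j = ∑ j, x j * t j + - ∑ j, x j * t' j := by
            simp only [Pi.sub_apply, mul_sub, Finset.sum_sub_distrib]; ring
          rw [map_mul (starRingEnd ℂ), conj_std, this, AddChar.map_add_eq_mul]; ring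
      _ = ∑ t, ∑ t', c t * (starRingEnd ℂ) (c t') * ∑ x : Fin n → ZMod P, ZMod.stdAddChar (∑ j, x j * (t - t') j) := by
          rw [Finset.sum_comm]
          refine Finset.sum_congr rfl fun t _ => ?_
          rw [Finset.sum_comm]
          refine Finset.sum_congr rfl fun t' _ => ?_
          rw [Finset.mul_sum]
      _ = _ := by
          rw [Finset.mul_sum]
          refine Finset.sum_congr rfl fun t _ => ?_
          rw [Finset.sum_eq_single t]
          · rw [sum_std_multi, sub_self, if_pos rfl]; ring
          · intro b _ hb
            rw [sum_std_multi, if_neg (sub_ne_zero.mpr (Ne.symm hb)), mul_zero]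
          · simp
  exact_mod_cast this

def Gs (P κ Y : ℕ) [NeZero P] (x : Fin κ → ZMod P) (γ α : ZMod P) : ℂ :=
  ∑ y ∈ Finset.Icc 1 Y, ZMod.stdAddChar (∑ j, x j * (y : ZMod P)^((j:ℕ)+1) + (γ * (y:ZMod P)^(κ+1) + α * (y:ZMod P)^(κ+2)))

lemma Gk_eq {P κ Y : ℕ} [NeZero P] (x : Fin κ → ZMod P) (γ α : ZMod P) :
    Gk P (κ+2) Y (Fin.snoc (Fin.snoc x γ : Fin (κ+1) → ZMod P) α : Fin (κ+2) → ZMod P) = Gs P κ Y x γ α := by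
  unfold Gk Gs
  refine Finset.sum_congr rfl fun y _ => ?_
  rw [Fin.sum_univ_castSucc, Fin.sum_univ_castSucc]
  simp [add_assoc]

lemma sum_snoc {P n : ℕ} [NeZero P] (F : (Fin (n+1) → ZMod P) → ℝ) :
    ∑ θ, F θ = ∑ α, ∑ x : Fin n → ZMod P, F (Fin.snoc x α : Fin (n+1) → ZMod P) := by
  rw [← Fintype.sum_prod_type' (f := fun (α : ZMod P) (x : Fin n → ZMod P) => F (Fin.snoc x α : Fin (n+1) → ZMod P))]
  exact (Fintype.sum_equiv (Fin.snocEquiv (fun _ : Fin (n+1) => ZMod P)) _ _ (fun _ => rfl)).symm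

def TY (h Y : ℕ) : Finset (Fin h → ℕ) := Fintype.piFinset fun _ => Finset.Icc 1 Y

def low (P κ h : ℕ) (y : Fin h → ℕ) : Fin κ → ZMod P := fun j => ((∑ i, y i^((j:ℕ)+1) : ℕ) : ZMod P)

def Xi (P κ h Y : ℕ) [NeZero P] (γ α : ZMod P) : ℝ :=
  ∑ u : Fin κ → ZMod P, ‖∑ y ∈ (TY h Y).filter (fun y => low P κ h y = u),
    ZMod.stdAddChar (α * ((∑ i, y i^(κ+2) : ℕ) : ZMod P)) * ZMod.stdAddChar (γ * ((∑ i, y i^(κ+1) : ℕ) : ZMod P))‖^2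

lemma Gs_pow {P κ h Y : ℕ} [NeZero P] (x : Fin κ → ZMod P) (γ α : ZMod P) :
    Gs P κ Y x γ α ^ h = ∑ y ∈ TY h Y, (ZMod.stdAddChar (α * ((∑ i, y i^(κ+2) : ℕ) : ZMod P)) *
      ZMod.stdAddChar (γ * ((∑ i, y i^(κ+1) : ℕ) : ZMod P))) * ZMod.stdAddChar (∑ j, x j * low P κ h y j) := by
  unfold Gs TY low
  rw [Finset.sum_pow']
  refine Finset.sum_congr rfl fun y _ => ?_
  rw [← std_sum, ← AddChar.map_add_eq_mul, ← AddChar.map_add_eq_mul]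
  congr 1
  push_cast
  simp_rw [Finset.mul_sum]
  rw [Finset.sum_add_distrib, Finset.sum_add_distrib, Finset.sum_comm]
  ring

lemma Xi_par {P κ h Y : ℕ} [NeZero P] (γ α : ZMod P) :
    ∑ x, ‖Gs P κ Y x γ α‖^(2*h) = (P:ℝ)^κ * Xi P κ h Y γ α := by
  unfold Xi
  rw [← parseval_multi]
  refine Finset.sum_congr rfl fun x _ => ?_
  rw [← Gs_pow, norm_pow, ← pow_mul, mul_comm]

lemma Xi_pt {P κ h Y : ℕ} [NeZero P] (hh1 : 1 ≤ h) (hY : 1 ≤ Y) (x : Fin κ → ZMod P) (γ α : ZMod P) :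
    ‖Gs P κ Y x γ α‖^(2*h) ≤ (2*(h:ℝ))^κ * (Y:ℝ)^(hh κ) * Xi P κ h Y γ α := by
  rw [mul_comm 2 h, pow_mul, ← norm_pow, Gs_pow]
  set c : (Fin κ → ZMod P) → ℂ := fun u => ∑ y ∈ (TY h Y).filter (fun y => low P κ h y = u),
    ZMod.stdAddChar (α * ((∑ i, y i^(κ+2) : ℕ) : ZMod P)) * ZMod.stdAddChar (γ * ((∑ i, y i^(κ+1) : ℕ) : ZMod P)) with hc
  set U : Finset (Fin κ → ZMod P) := Fintype.piFinset fun j => (Finset.Icc 1 (h * Y^((j:ℕ)+1))).image (fun n : ℕ => (n : ZMod P)) with hU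
  have hmaps : ∀ y ∈ TY h Y, low P κ h y ∈ U := by
    intro y hy
    rw [hU, Fintype.mem_piFinset]
    intro j
    rw [Finset.mem_image]
    rw [TY, Fintype.mem_piFinset] at hy
    refine ⟨∑ i, y i^((j:ℕ)+1), ?_, rfl⟩
    rw [Finset.mem_Icc]
    constructor
    · calc 1 ≤ h := hh1
        _ = ∑ i : Fin h, 1 := by simp
        _ ≤ _ := Finset.sum_le_sum fun i _ => Nat.one_le_pow _ _ (Finset.mem_Icc.mp (hy i)).1
    · calc _ ≤ ∑ i : Fin h, Y^((j:ℕ)+1) := Finset.sum_le_sum fun i _ => Nat.pow_le_pow_left (Finset.mem_Icc.mp (hy i)).2 _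
        _ = _ := by simp
  have h1 : ∑ y ∈ TY h Y, (ZMod.stdAddChar (α * ((∑ i, y i^(κ+2) : ℕ) : ZMod P)) *
      ZMod.stdAddChar (γ * ((∑ i, y i^(κ+1) : ℕ) : ZMod P))) * ZMod.stdAddChar (∑ j, x j * low P κ h y j) =
      ∑ u ∈ U, c u * ZMod.stdAddChar (∑ j, x j * u j) := by
    rw [← Finset.sum_fiberwise_of_maps_to hmaps]
    refine Finset.sum_congr rfl fun u _ => ?_
    rw [hc, Finset.sum_mul]
    refine Finset.sum_congr rfl fun i hi => ?_
    rw [Finset.mem_filter] at hi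
    rw [hi.2]
  rw [h1]
  have hcard : (U.card:ℝ) ≤ (2*(h:ℝ))^κ * (Y:ℝ)^(hh κ) := by
    have e1 : U.card ≤ ∏ j : Fin κ, (h * Y^((j:ℕ)+1)) := by
      rw [hU, Fintype.card_piFinset]
      refine Finset.prod_le_prod' fun j _ => ?_
      refine Finset.card_image_le.trans ?_
      simp
    have e2 : ∏ j : Fin κ, (h * Y^((j:ℕ)+1)) = h^κ * Y^(hh κ) := by
      rw [Finset.prod_mul_distrib, Finset.prod_const, Finset.card_univ, Fintype.card_fin, Finset.prod_pow_eq_pow_sum]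
      congr 2
      rw [Fin.sum_univ_eq_sum_range (fun j => j+1)]
      induction κ with
      | zero => simp [hh]
      | succ n ih => rw [Finset.sum_range_succ, hh]; rw [show ∑ x ∈ Finset.range n, (x+1) = hh n from by
                        clear * -
                        induction n with
                        | zero => simp [hh]
                        | succ n ih => rw [Finset.sum_range_succ, hh, ih]]
    rw [e2] at e1
    calc (U.card:ℝ) ≤ (h:ℝ)^κ * (Y:ℝ)^(hh κ) := by exact_mod_cast e1
      _ ≤ _ := by
        have : (0:ℝ) ≤ h := by positivity
        gcongr; linarith
  calc _ ≤ (∑ u ∈ U, ‖c u‖)^2 := by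
        gcongr
        refine (norm_sum_le _ _).trans (le_of_eq (Finset.sum_congr rfl fun u _ => ?_))
        rw [norm_mul, norm_std, mul_one]
    _ ≤ U.card * ∑ u ∈ U, ‖c u‖^2 := sq_sum_le_card_mul_sum_sq
    _ ≤ U.card * Xi P κ h Y γ α := by
        gcongr
        unfold Xi
        exact Finset.sum_le_sum_of_subset_of_nonneg (Finset.subset_univ _) fun _ _ _ => by positivity
    _ ≤ _ := by
        have : 0 ≤ Xi P κ h Y γ α := Finset.sum_nonneg fun _ _ => by positivity
        gcongr

def za {P : ℕ} (t : ZMod P) : ℕ := t.valMinAbs.natAbs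

def Kn (P : ℕ) [NeZero P] (a : ZMod P) (L : ℕ) (t : ZMod P) : ℂ :=
  ∑ m ∈ Finset.range L, ZMod.stdAddChar ((a + (m : ZMod P)) * t)

lemma za_le {P : ℕ} [NeZero P] (t : ZMod P) (n : ℤ) (h : (n : ZMod P) = t) : za t ≤ n.natAbs := by
  refine ZMod.natAbs_min_of_le_div_two P _ _ ?_ (ZMod.natAbs_valMinAbs_le t)
  rw [ZMod.coe_valMinAbs, h]

lemma std_sub_one {P : ℕ} [NeZero P] (t : ZMod P) : 4 * (za t : ℝ) ≤ ‖ZMod.stdAddChar t - 1‖ * P := by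
  have hP : (0:ℝ) < P := by exact_mod_cast NeZero.pos P
  have e : ZMod.stdAddChar t = Complex.exp (Complex.I * ((2 * Real.pi * (t.valMinAbs : ℝ) / P : ℝ) : ℂ)) := by
    conv_lhs => rw [← ZMod.coe_valMinAbs t, ZMod.stdAddChar_coe]
    congr 1; push_cast; ring
  rw [e, Complex.norm_exp_I_mul_ofReal_sub_one, norm_mul, Real.norm_eq_abs, Real.norm_eq_abs, abs_two]
  have e2 : |Real.sin (2 * Real.pi * (t.valMinAbs : ℝ) / P / 2)| = |Real.sin (Real.pi * (za t : ℝ) / P)| := by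
    rw [show 2 * Real.pi * (t.valMinAbs : ℝ) / P / 2 = Real.pi * (t.valMinAbs : ℝ) / P by ring]
    have : (za t : ℝ) = |(t.valMinAbs : ℝ)| := by
      unfold za; rw [← Int.cast_abs, Int.abs_eq_natAbs]; simp
    rw [this]
    rcases abs_cases (t.valMinAbs : ℝ) with h | h
    · rw [h.1]
    · rw [h.1, mul_neg, neg_div, Real.sin_neg, abs_neg]
  rw [e2]
  have h2 : (za t : ℝ) * 2 ≤ P := by
    have h3 := ZMod.natAbs_valMinAbs_le t
    have : za t * 2 ≤ P := by unfold za; omega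
    exact_mod_cast this
  have := Real.mul_le_sin (x := Real.pi * (za t : ℝ) / P) (by positivity) (by
    rw [div_le_div_iff₀ hP (by norm_num)]; nlinarith [Real.pi_pos])
  have h4 : 2 / Real.pi * (Real.pi * (za t : ℝ) / P) = 2 * za t / P := by
    field_simp
  rw [h4, div_le_iff₀ hP] at this
  nlinarith [le_abs_self (Real.sin (Real.pi * (za t : ℝ) / P))]

lemma Kn_triv {P : ℕ} [NeZero P] (a : ZMod P) (L : ℕ) (t : ZMod P) : ‖Kn P a L t‖ ≤ L := by
  unfold Kn
  refine (norm_sum_le _ _).trans ?_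
  simp [norm_std]

lemma Kn_geom {P : ℕ} [NeZero P] (a : ZMod P) (L : ℕ) (t : ZMod P) : ‖Kn P a L t‖ * (2 * za t) ≤ P := by
  have h1 : Kn P a L t * (ZMod.stdAddChar t - 1) = ZMod.stdAddChar (a*t) * (ZMod.stdAddChar t ^ L - 1) := by
    rw [← geom_sum_mul, ← mul_assoc]
    congr 1
    unfold Kn
    rw [Finset.mul_sum]
    refine Finset.sum_congr rfl fun m _ => ?_
    rw [add_mul, AddChar.map_add_eq_mul, ← nsmul_eq_mul, AddChar.map_nsmul_eq_pow]
  have h2 : ‖Kn P a L t‖ * ‖ZMod.stdAddChar t - 1‖ ≤ 2 := by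
    rw [← norm_mul, h1, norm_mul, norm_std, one_mul]
    refine (norm_sub_le _ _).trans ?_
    rw [norm_pow, norm_std]; norm_num
  have h3 := std_sub_one t
  have hP : (0:ℝ) < P := by exact_mod_cast NeZero.pos P
  nlinarith [norm_nonneg (Kn P a L t), mul_le_mul_of_nonneg_left h3 (norm_nonneg (Kn P a L t)), mul_le_mul_of_nonneg_right h2 hP.le]

def bix (P H : ℕ) (t : ZMod P) : ℕ := za t * H / P

lemma bix_le {P H : ℕ} [NeZero P] (t : ZMod P) : bix P H t ≤ H := by
  unfold bix
  apply Nat.div_le_of_le_mul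
  have h3 := ZMod.natAbs_valMinAbs_le t
  exact Nat.mul_le_mul_right _ (by unfold za; omega)

lemma Kn_bix {P : ℕ} [NeZero P] (a : ZMod P) (L H : ℕ) (hL : L ≤ 3*H) (t : ZMod P) :
    ‖Kn P a L t‖ ≤ 3 * H / ((bix P H t : ℝ) + 1) := by
  have hP : (0:ℝ) < P := by exact_mod_cast NeZero.pos P
  rcases Nat.eq_zero_or_pos (bix P H t) with h | h
  · rw [h]; simp only [Nat.cast_zero, zero_add, div_one]
    refine (Kn_triv a L t).trans ?_
    exact_mod_cast hL
  · rw [le_div_iff₀ (by positivity)]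
    have h1 := Kn_geom a L t
    have h2 : bix P H t * P ≤ za t * H := Nat.div_mul_le_self _ _
    have h2' : (bix P H t : ℝ) * P ≤ za t * H := by exact_mod_cast h2
    have h3 : (1:ℝ) ≤ bix P H t := by exact_mod_cast h
    have h4 := norm_nonneg (Kn P a L t)
    have h5 : ‖Kn P a L t‖ * (bix P H t * P) ≤ ‖Kn P a L t‖ * (za t * H) := by gcongr
    have h6 : ‖Kn P a L t‖ * (2 * za t) * H ≤ P * H := by gcongr
    have h7 : (‖Kn P a L t‖ * bix P H t) * P ≤ (H/2) * P := by nlinarith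
    have h8 := le_of_mul_le_mul_right h7 hP
    nlinarith

lemma bucket_sum {ι : Type*} (s : Finset ι) (F : ι → ℝ) (idx : ι → ℕ) (H m : ℕ) (B : ℝ) (hB : 0 ≤ B)
    (hidx : ∀ i ∈ s, idx i ≤ H) (hF : ∀ i ∈ s, F i ≤ B / ((idx i : ℝ) + 1))
    (hm : ∀ n, (s.filter (fun i => idx i = n)).card ≤ m) :
    ∑ i ∈ s, F i ≤ B * m * (1 + Real.log (H+1)) := by
  have h0 : ∀ i ∈ s, idx i ∈ Finset.range (H+1) := fun i hi => by
    rw [Finset.mem_range]; have := hidx i hi; omega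
  rw [← Finset.sum_fiberwise_of_maps_to h0]
  calc _ ≤ ∑ n ∈ Finset.range (H+1), B * m * ((n:ℝ)+1)⁻¹ := by
        refine Finset.sum_le_sum fun n _ => ?_
        calc _ ≤ ∑ i ∈ s.filter (fun i => idx i = n), B / ((n:ℝ)+1) := by
              refine Finset.sum_le_sum fun i hi => ?_
              rw [Finset.mem_filter] at hi
              have := hF i hi.1
              rwa [hi.2] at this
          _ = ((s.filter (fun i => idx i = n)).card : ℝ) * (B / ((n:ℝ)+1)) := by simp
          _ ≤ m * (B / ((n:ℝ)+1)) := by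
              gcongr; exact_mod_cast hm n
          _ = _ := by ring
    _ = B * m * (harmonic (H+1) : ℚ) := by
        rw [← Finset.mul_sum]; congr 1
        unfold harmonic; push_cast; rfl
    _ ≤ _ := by
        have := harmonic_le_one_add_log (H+1)
        push_cast at this
        gcongr

lemma LS {P : ℕ} [NeZero P] {ι : Type*} (s : Finset ι) (c : ι → ℂ) (t : ι → ℕ) (H : ℕ) (ht : ∀ i ∈ s, t i ≤ H)
    (hP : 2*H < P) (γ0 : ZMod P) :
    P * ‖∑ i ∈ s, c i * ZMod.stdAddChar (γ0 * (t i : ZMod P))‖^2 ≤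
      ∑ γ, ‖∑ i ∈ s, c i * ZMod.stdAddChar (γ * (t i : ZMod P))‖^2 * ‖Kn P (-(H:ZMod P)) (2*H+1) (γ0 - γ)‖ := by
  have hsq : ∀ γ : ZMod P, ((‖∑ i ∈ s, c i * ZMod.stdAddChar (γ * (t i : ZMod P))‖^2 : ℝ) : ℂ) =
      ∑ i ∈ s, ∑ i' ∈ s, c i * (starRingEnd ℂ) (c i') * ZMod.stdAddChar (γ * ((t i : ZMod P) - (t i' : ZMod P))) := by
    intro γ
    push_cast
    rw [← Complex.mul_conj', map_sum, Finset.sum_mul_sum]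
    refine Finset.sum_congr rfl fun i _ => Finset.sum_congr rfl fun i' _ => ?_
    rw [map_mul (starRingEnd ℂ), conj_std, mul_sub, sub_eq_add_neg, AddChar.map_add_eq_mul]; ring
  have hin : ∀ i ∈ s, ∀ i' ∈ s, ∑ γ : ZMod P, ZMod.stdAddChar (γ * ((t i : ZMod P) - (t i' : ZMod P))) * Kn P (-(H:ZMod P)) (2*H+1) (γ0 - γ)
      = P * ZMod.stdAddChar (γ0 * ((t i : ZMod P) - (t i' : ZMod P))) := by
    intro i hi i' hi'
    have h1 := ht i hi
    have h2 := ht i' hi'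
    set m0 := t i + H - t i' with hm0
    have hm0' : (m0 : ZMod P) = (t i : ZMod P) + (H : ZMod P) - (t i' : ZMod P) := by
      rw [hm0, Nat.cast_sub (by omega), Nat.cast_add]
    calc _ = ∑ γ : ZMod P, ∑ m ∈ Finset.range (2*H+1), ZMod.stdAddChar ((-(H:ZMod P) + (m:ZMod P))*γ0) *
          ZMod.stdAddChar (γ * ((m0:ZMod P) - (m:ZMod P))) := by
          refine Finset.sum_congr rfl fun γ _ => ?_
          unfold Kn
          rw [Finset.mul_sum]
          refine Finset.sum_congr rfl fun m _ => ?_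
          rw [← AddChar.map_add_eq_mul, ← AddChar.map_add_eq_mul, hm0']
          congr 1; ring
      _ = ∑ m ∈ Finset.range (2*H+1), ZMod.stdAddChar ((-(H:ZMod P) + (m:ZMod P))*γ0) * (if (m0:ZMod P) - (m:ZMod P) = 0 then (P:ℂ) else 0) := by
          rw [Finset.sum_comm]
          refine Finset.sum_congr rfl fun m _ => ?_
          rw [← Finset.mul_sum, sum_std_mul]
      _ = _ := by
          rw [Finset.sum_eq_single m0]
          · rw [sub_self, if_pos rfl, hm0', mul_comm (P:ℂ)]
            congr 2; ring
          · intro m hm hne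
            rw [if_neg, mul_zero]
            intro h
            rw [sub_eq_zero] at h
            rw [Finset.mem_range] at hm
            have := (ZMod.natCast_eq_natCast_iff' m0 m P).mp h
            rw [Nat.mod_eq_of_lt (by omega), Nat.mod_eq_of_lt (by omega)] at this
            exact hne this.symm
          · intro h; exact absurd (Finset.mem_range.mpr (by omega)) h
  have heq : ((P * ‖∑ i ∈ s, c i * ZMod.stdAddChar (γ0 * (t i : ZMod P))‖^2 : ℝ) : ℂ) =
      ∑ γ, ((‖∑ i ∈ s, c i * ZMod.stdAddChar (γ * (t i : ZMod P))‖^2 : ℝ) : ℂ) * Kn P (-(H:ZMod P)) (2*H+1) (γ0 - γ) := by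
    rw [Complex.ofReal_mul, hsq]
    simp_rw [hsq, Finset.sum_mul]
    symm
    rw [Finset.sum_comm, Finset.mul_sum]
    refine Finset.sum_congr rfl fun i hi => ?_
    rw [Finset.sum_comm, Finset.mul_sum]
    refine Finset.sum_congr rfl fun i' hi' => ?_
    simp_rw [mul_assoc]
    rw [← Finset.mul_sum, ← Finset.mul_sum, hin i hi i' hi']
    push_cast; ring
  have h1 := congrArg norm heq
  rw [Complex.norm_real, Real.norm_of_nonneg (by positivity)] at h1
  rw [h1]
  refine (norm_sum_le _ _).trans (le_of_eq (Finset.sum_congr rfl fun γ _ => ?_))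
  rw [norm_mul, Complex.norm_real, Real.norm_of_nonneg (by positivity)]

def rB (P X H : ℕ) (β : ZMod P) : ℕ := ((Finset.Ico 1 X).filter (fun v : ℕ => za ((v:ZMod P) * β) * H ≤ P)).card

lemma bix_close {P H : ℕ} [NeZero P] {t t' : ZMod P} (h : bix P H t = bix P H t')
    (hs : 0 ≤ t.valMinAbs ↔ 0 ≤ t'.valMinAbs) : za (t - t') * H ≤ P := by
  have h1 := za_le (t - t') (t.valMinAbs - t'.valMinAbs) (by simp)
  unfold bix at h
  have hP : 0 < P := NeZero.pos P
  have a1 := Nat.div_add_mod (za t * H) P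
  have a2 := Nat.div_add_mod (za t' * H) P
  have b1 := Nat.mod_lt (za t * H) hP
  have b2 := Nat.mod_lt (za t' * H) hP
  rw [← h] at a2
  set n := za t * H / P
  have key : (t.valMinAbs - t'.valMinAbs).natAbs = za t - za t' ∨ (t.valMinAbs - t'.valMinAbs).natAbs = za t' - za t := by
    unfold za; by_cases h0 : 0 ≤ t.valMinAbs
    · have := hs.mp h0; omega
    · have : ¬ 0 ≤ t'.valMinAbs := fun h' => h0 (hs.mpr h'); omega
  calc _ ≤ (t.valMinAbs - t'.valMinAbs).natAbs * H := Nat.mul_le_mul_right _ h1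
    _ ≤ P := by
      rcases key with h | h <;> rw [h, Nat.sub_mul] <;> omega

lemma arc_count {P X H : ℕ} [NeZero P] (β : ZMod P) (T : Finset ℕ) (hT : T ⊆ Finset.range X)
    (h : ∀ z ∈ T, ∀ z' ∈ T, za (((z:ZMod P) - (z':ZMod P)) * β) * H ≤ P) : T.card ≤ 1 + rB P X H β := by
  rcases T.eq_empty_or_nonempty with h0 | h0
  · rw [h0]; simp
  obtain ⟨z0, hz0, hmin⟩ := Finset.exists_min_image T id h0
  have : (T.erase z0).card ≤ rB P X H β := by
    unfold rB
    refine Finset.card_le_card_of_injOn (fun z => z - z0) ?_ ?_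
    · intro z hz
      rw [Finset.mem_coe, Finset.mem_erase] at hz
      have h1 := hmin z hz.2
      have h2 := Finset.mem_range.mp (hT hz.2)
      simp only [id] at h1
      simp only [Finset.coe_filter, Set.mem_setOf_eq, Finset.mem_Ico]
      refine ⟨⟨by omega, by omega⟩, ?_⟩
      rw [Nat.cast_sub h1]
      exact h z hz.2 z0 hz0
    · intro z hz z' hz' he
      rw [Finset.mem_coe, Finset.mem_erase] at hz hz'
      have h1 := hmin z hz.2
      have h1' := hmin z' hz'.2
      simp only [id] at h1 h1' he
      omega
  rw [← Finset.card_erase_add_one hz0]; omega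

lemma WS {P X H : ℕ} [NeZero P] (a : ZMod P) (L : ℕ) (hL : L ≤ 3*H) (β γ : ZMod P) :
    ∑ z ∈ Finset.range X, ‖Kn P a L ((z:ZMod P) * β + γ)‖ ≤
      3 * H * (2 * (1 + rB P X H β) : ℕ) * (1 + Real.log (H+1)) := by
  refine bucket_sum _ _ (fun z : ℕ => bix P H ((z:ZMod P) * β + γ)) H _ _ (by positivity) (fun z _ => bix_le _)
    (fun z _ => Kn_bix a L H hL _) fun n => ?_
  rw [← Finset.card_filter_add_card_filter_not (fun z : ℕ => 0 ≤ ((z:ZMod P) * β + γ).valMinAbs), two_mul]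
  apply add_le_add
  · apply arc_count
    · exact (Finset.filter_subset _ _).trans (Finset.filter_subset _ _)
    · intro z hz z' hz'
      simp only [Finset.mem_filter] at hz hz'
      have := bix_close (hz.1.2.trans hz'.1.2.symm) (by simp [hz.2, hz'.2])
      convert this using 3; ring
  · apply arc_count
    · exact (Finset.filter_subset _ _).trans (Finset.filter_subset _ _)
    · intro z hz z' hz'
      simp only [Finset.mem_filter] at hz hz'
      have := bix_close (hz.1.2.trans hz'.1.2.symm) (by simp only [hz.2, hz'.2])
      convert this using 3; ring

lemma count_za {P : ℕ} [NeZero P] (g δ : ℕ) (hg : 1 ≤ g) :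
    (Finset.univ.filter (fun β : ZMod P => za ((g:ZMod P) * β) ≤ δ)).card ≤ 4 * δ + 2 * g := by
  have hP : (0:ℤ) < P := by exact_mod_cast NeZero.pos P
  have hg' : (0:ℤ) < g := by exact_mod_cast hg
  have key : ∀ β : ZMod P, ∃ a : ℕ, a < g + 1 ∧ (g:ℤ) * (β.val : ℤ) - ((g:ZMod P)*β).valMinAbs = (P:ℤ) * a := by
    intro β
    have h1 : (P:ℤ) ∣ (g:ℤ) * (β.val : ℤ) - ((g:ZMod P)*β).valMinAbs := by
      rw [← ZMod.intCast_zmod_eq_zero_iff_dvd]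
      push_cast
      rw [ZMod.natCast_zmod_val, sub_self]
    obtain ⟨a, ha⟩ := h1
    have h2 := ZMod.natAbs_valMinAbs_le ((g:ZMod P)*β)
    have h2' : ((((g:ZMod P)*β).valMinAbs.natAbs : ℕ) : ℤ) * 2 ≤ P := by omega
    have h3 : (β.val : ℤ) < P := by exact_mod_cast ZMod.val_lt β
    have h4 : (0:ℤ) ≤ (g:ℤ) * (β.val : ℤ) := by positivity
    have h5 : (g:ℤ) * (β.val : ℤ) ≤ g * P := by gcongr
    have a0 : 0 ≤ a := by
      by_contra hc
      have : (P:ℤ) * a ≤ P * (-1) := mul_le_mul_of_nonneg_left (by omega) hP.le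
      omega
    have a1 : a < g + 1 := by
      by_contra hc
      have : (P:ℤ) * (g + 1) ≤ P * a := mul_le_mul_of_nonneg_left (by omega) hP.le
      have e : (P:ℤ) * (g+1) = g * P + P := by ring
      omega
    refine ⟨a.toNat, by omega, ?_⟩
    rw [ha, Int.toNat_of_nonneg a0]
  choose a ha1 ha2 using key
  have h : (Finset.univ.filter (fun β : ZMod P => za ((g:ZMod P) * β) ≤ δ)).card ≤
      ((Finset.range (g+1)) ×ˢ (Finset.range (2*δ/g+1))).card := by
    refine Finset.card_le_card_of_injOn (fun β => (a β, (((g:ZMod P)*β).valMinAbs + δ).toNat / g)) ?_ ?_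
    · intro β hβ
      replace hβ := (Finset.mem_filter.mp (Finset.mem_coe.mp hβ)).2
      unfold za at hβ
      simp only [Finset.coe_product, Set.mem_prod, Finset.coe_range, Set.mem_Iio]
      refine ⟨ha1 β, Nat.lt_succ_of_le (Nat.div_le_div_right (by omega))⟩
    · intro β hβ β' hβ' he
      replace hβ := (Finset.mem_filter.mp (Finset.mem_coe.mp hβ)).2
      replace hβ' := (Finset.mem_filter.mp (Finset.mem_coe.mp hβ')).2
      unfold za at hβ hβ'
      simp only [Prod.mk.injEq] at he
      obtain ⟨e1, e2⟩ := he
      have q1 := ha2 β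
      have q2 := ha2 β'
      rw [e1] at q1
      generalize ((g:ZMod P)*β).valMinAbs = s at *
      generalize ((g:ZMod P)*β').valMinAbs = s' at *
      have m1 := Nat.div_add_mod (s + δ).toNat g
      have m2 := Nat.div_add_mod (s' + δ).toNat g
      have l1 := Nat.mod_lt (s + δ).toNat hg
      have l2 := Nat.mod_lt (s' + δ).toNat hg
      rw [e2] at m1
      have d1 : s - s' < g := by omega
      have d2 : s' - s < g := by omega
      have d3 : s - s' = g * ((β.val:ℤ) - β'.val) := by linarith
      rw [d3] at d1
      rw [show s' - s = g * ((β'.val:ℤ) - β.val) by linarith] at d2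
      have d4 : (β.val:ℤ) - β'.val < 1 := by
        by_contra hc
        nlinarith
      have d5 : (β'.val:ℤ) - β.val < 1 := by
        by_contra hc
        nlinarith
      apply ZMod.val_injective
      omega
  refine h.trans ?_
  rw [Finset.card_product, Finset.card_range, Finset.card_range]
  have h1 : g * (2*δ/g) ≤ 2*δ := Nat.mul_div_le _ _
  have h2 : 2*δ/g ≤ 2*δ := Nat.div_le_self _ _
  nlinarith

lemma Kn_L1 {P X : ℕ} [NeZero P] (hX : 1 ≤ X) (hXP : X ≤ P) (a : ZMod P) :
    ∑ β : ZMod P, ‖Kn P a X β‖ ≤ 36 * P * (1 + Real.log (X+1)) := by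
  have hl : 0 ≤ Real.log ((X:ℝ)+1) := Real.log_nonneg (by have : (0:ℝ) ≤ X := Nat.cast_nonneg X
                                                          linarith)
  have h := bucket_sum Finset.univ (fun β : ZMod P => ‖Kn P a X β‖) (fun β => bix P X β) X (2 * (4 * (P/X) + 2)) (3 * X)
    (by positivity) (fun z _ => bix_le _) (fun z _ => Kn_bix a X X (by omega) _) (by
    intro n
    have gen : ∀ T : Finset (ZMod P), (∀ b ∈ T, ∀ b' ∈ T, za (b - b') * X ≤ P) → T.card ≤ 4 * (P/X) + 2 := by
      intro T hT
      rcases T.eq_empty_or_nonempty with h0 | ⟨b0, hb0⟩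
      · rw [h0]; simp
      refine le_trans ?_ (count_za (P := P) 1 (P/X) le_rfl)
      refine Finset.card_le_card_of_injOn (fun b => b - b0) ?_ (fun b _ b' _ h => sub_left_injective h)
      intro b hb
      simp only [Finset.coe_filter, Finset.mem_univ, true_and, Set.mem_setOf_eq, Nat.cast_one, one_mul]
      exact (Nat.le_div_iff_mul_le hX).mpr (hT b hb b0 hb0)
    rw [← Finset.card_filter_add_card_filter_not (fun b : ZMod P => 0 ≤ b.valMinAbs), two_mul]
    apply add_le_add
    · apply gen
      intro z hz z' hz'
      simp only [Finset.mem_filter] at hz hz'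
      exact bix_close (hz.1.2.trans hz'.1.2.symm) (by simp [hz.2, hz'.2])
    · apply gen
      intro z hz z' hz'
      simp only [Finset.mem_filter] at hz hz'
      exact bix_close (hz.1.2.trans hz'.1.2.symm) (by simp only [hz.2, hz'.2]))
  refine h.trans ?_
  refine mul_le_mul_of_nonneg_right ?_ (by linarith)
  have h1 : 3 * X * (2 * (4 * (P/X) + 2)) ≤ 36 * P := by
    have := Nat.mul_div_le P X
    nlinarith
  exact_mod_cast h1

lemma phase_expand {P : ℕ} (κ : ℕ) (α z y : ZMod P) :
    α * (y - z)^(κ+2) = α * (-z)^(κ+2) + ((∑ j : Fin κ, (α * ((-z)^(κ+1-(j:ℕ)) * ((κ+2).choose ((j:ℕ)+1) : ZMod P))) * y^((j:ℕ)+1)) +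
      ((α * (-z * ((κ+2 : ℕ) : ZMod P))) * y^(κ+1) + α * y^(κ+2))) := by
  rw [sub_eq_add_neg, add_pow, Finset.sum_range_succ, Finset.sum_range_succ, Finset.sum_range_succ', Finset.sum_range]
  have e : (κ+2).choose (κ+1) = κ+2 := by
    rw [show κ+2 = (κ+1)+1 by ring, Nat.choose_succ_self_right]
  rw [e]
  simp only [Nat.sub_self, Nat.choose_self, Nat.choose_zero_right, pow_zero, Nat.sub_zero]
  rw [show κ + 2 - (κ+1) = 1 by omega, mul_add, mul_add, mul_add, Finset.mul_sum]
  have : ∀ j : Fin κ, α * (y^((j:ℕ)+1) * (-z)^(κ+2-((j:ℕ)+1)) * ((κ+2).choose ((j:ℕ)+1) : ZMod P)) =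
     (α * ((-z)^(κ+1-(j:ℕ)) * ((κ+2).choose ((j:ℕ)+1) : ZMod P))) * y^((j:ℕ)+1) := by
    intro j
    rw [show κ+2-((j:ℕ)+1) = κ+1-(j:ℕ) by omega]; ring
  rw [Finset.sum_congr rfl fun j _ => this j]
  push_cast; ring

lemma window {P κ X h : ℕ} [NeZero P] (hκ : 1 ≤ κ) (hX : 1 ≤ X) (hP : 4 * X < P) (h1 : 1 ≤ h) (z : ℕ) (hz : z < X) (α : ZMod P) :
    ‖∑ n ∈ Finset.Icc 1 X, ZMod.stdAddChar (α * (n:ZMod P)^(κ+2))‖^(2*h) ≤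
      (36 * (1 + Real.log (X+1)))^(2*h) * ((2*(h:ℝ))^κ * ((2*X : ℕ):ℝ)^(hh κ) *
        Xi P κ h (2*X) (α * (-(z:ZMod P) * ((κ+2 : ℕ) : ZMod P))) α) := by
  set γ := α * (-(z:ZMod P) * ((κ+2 : ℕ) : ZMod P)) with hγ
  set B := (2*(h:ℝ))^κ * ((2*X : ℕ):ℝ)^(hh κ) * Xi P κ h (2*X) γ α with hB
  have hP0 : (0:ℝ) < P := by exact_mod_cast NeZero.pos P
  have hpt : ∀ x, ‖Gs P κ (2*X) x γ α‖^(2*h) ≤ B := fun x => Xi_pt h1 (by omega) x γ α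
  have hB0 : 0 ≤ B := (by positivity : (0:ℝ) ≤ _).trans (hpt 0)
  set G0 := B ^ (((2*h : ℕ):ℝ)⁻¹) with hG0
  have hG0p : G0^(2*h) = B := Real.rpow_inv_natCast_pow hB0 (by omega)
  have hG00 : 0 ≤ G0 := Real.rpow_nonneg hB0 _
  have hpt' : ∀ x, ‖Gs P κ (2*X) x γ α‖ ≤ G0 := by
    intro x
    refine le_of_pow_le_pow_left₀ (n := 2*h) (by omega) hG00 ?_
    rw [hG0p]; exact hpt x
  set x0 : Fin κ → ZMod P := fun j => α * ((-(z:ZMod P))^(κ+1-(j:ℕ)) * ((κ+2).choose ((j:ℕ)+1) : ZMod P)) with hx0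
  set ph : ℕ → ZMod P := fun y => (∑ j, x0 j * (y:ZMod P)^((j:ℕ)+1)) + (γ * (y:ZMod P)^(κ+1) + α * (y:ZMod P)^(κ+2)) with hph
  set j0 : Fin κ := ⟨0, hκ⟩ with hj0
  have hGs : ∀ β : ZMod P, Gs P κ (2*X) (x0 + Pi.single j0 β) γ α =
      ∑ y ∈ Finset.Icc 1 (2*X), ZMod.stdAddChar (ph y) * ZMod.stdAddChar (β * (y:ZMod P)) := by
    intro β
    unfold Gs
    refine Finset.sum_congr rfl fun y _ => ?_
    rw [← AddChar.map_add_eq_mul]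
    congr 1
    simp only [Pi.add_apply, add_mul, Finset.sum_add_distrib, hph]
    have : ∑ j : Fin κ, (Pi.single j0 β : Fin κ → ZMod P) j * (y:ZMod P)^((j:ℕ)+1) = β * (y:ZMod P) := by
      rw [Finset.sum_eq_single j0]
      · simp [hj0]
      · intro j _ hj; rw [Pi.single_eq_of_ne hj, zero_mul]
      · simp
    rw [this]; ring
  set a : ZMod P := -((z:ZMod P) + (X:ZMod P)) with ha
  have hwin : ∀ y ∈ Finset.Icc 1 (2*X), ∑ β : ZMod P, ZMod.stdAddChar (β * (y:ZMod P)) * Kn P a X β =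
      if y ∈ Finset.Ioc z (z+X) then (P:ℂ) else 0 := by
    intro y hy
    rw [Finset.mem_Icc] at hy
    calc _ = ∑ β : ZMod P, ∑ m ∈ Finset.range X, ZMod.stdAddChar (β * (((y + m : ℕ) : ZMod P) - ((z + X : ℕ) : ZMod P))) := by
          refine Finset.sum_congr rfl fun β _ => ?_
          unfold Kn
          rw [Finset.mul_sum]
          refine Finset.sum_congr rfl fun m _ => ?_
          rw [← AddChar.map_add_eq_mul, ha]
          congr 1; push_cast; ring
      _ = ∑ m ∈ Finset.range X, if y + m = z + X then (P:ℂ) else 0 := by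
          rw [Finset.sum_comm]
          refine Finset.sum_congr rfl fun m hm => ?_
          rw [Finset.mem_range] at hm
          rw [sum_std_mul]
          congr 1
          rw [sub_eq_zero, ZMod.natCast_eq_natCast_iff', Nat.mod_eq_of_lt (by omega), Nat.mod_eq_of_lt (by omega)]
      _ = _ := by
          split_ifs with hc
          · rw [Finset.mem_Ioc] at hc
            rw [Finset.sum_eq_single (z + X - y)]
            · rw [if_pos (by omega)]
            · intro m _ hm; rw [if_neg (by omega)]
            · intro hm; rw [Finset.mem_range] at hm; omega
          · rw [Finset.mem_Ioc] at hc
            refine Finset.sum_eq_zero fun m hm => ?_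
            rw [Finset.mem_range] at hm
            rw [if_neg (by omega)]
  have hmain : (P:ℂ) * ∑ y ∈ Finset.Ioc z (z+X), ZMod.stdAddChar (ph y) =
      ∑ β : ZMod P, Kn P a X β * Gs P κ (2*X) (x0 + Pi.single j0 β) γ α := by
    simp_rw [hGs, Finset.mul_sum]
    symm
    rw [Finset.sum_comm]
    calc _ = ∑ y ∈ Finset.Icc 1 (2*X), ZMod.stdAddChar (ph y) * (if y ∈ Finset.Ioc z (z+X) then (P:ℂ) else 0) := by
          refine Finset.sum_congr rfl fun y hy => ?_
          rw [← hwin y hy, Finset.mul_sum]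
          refine Finset.sum_congr rfl fun β _ => by ring
      _ = _ := by
          simp_rw [mul_ite, mul_zero]
          rw [← Finset.sum_filter]
          refine Finset.sum_congr ?_ fun y _ => by ring
          ext y; simp only [Finset.mem_filter, Finset.mem_Icc, Finset.mem_Ioc]; omega
  have hf : ‖∑ n ∈ Finset.Icc 1 X, ZMod.stdAddChar (α * (n:ZMod P)^(κ+2))‖ = ‖∑ y ∈ Finset.Ioc z (z+X), ZMod.stdAddChar (ph y)‖ := by
    have e : ∑ n ∈ Finset.Icc 1 X, ZMod.stdAddChar (α * (n:ZMod P)^(κ+2)) =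
        ZMod.stdAddChar (α * (-(z:ZMod P))^(κ+2)) * ∑ y ∈ Finset.Ioc z (z+X), ZMod.stdAddChar (ph y) := by
      rw [Finset.mul_sum]
      refine Finset.sum_bij (fun n _ => n + z) ?_ ?_ ?_ ?_
      · intro n hn; rw [Finset.mem_Icc] at hn; rw [Finset.mem_Ioc]; omega
      · intro n _ n' _ he; simpa using he
      · intro y hy; rw [Finset.mem_Ioc] at hy
        exact ⟨y - z, by rw [Finset.mem_Icc]; omega, by omega⟩
      · intro n _
        rw [← AddChar.map_add_eq_mul]
        congr 1
        have := phase_expand κ α (z:ZMod P) ((n+z : ℕ) : ZMod P)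
        rw [hph]
        rw [← this]; push_cast; ring
    rw [e, norm_mul, norm_std, one_mul]
  have hfin : ‖∑ n ∈ Finset.Icc 1 X, ZMod.stdAddChar (α * (n:ZMod P)^(κ+2))‖ ≤ 36 * (1 + Real.log (X+1)) * G0 := by
    rw [hf]
    have h2 : (P:ℝ) * ‖∑ y ∈ Finset.Ioc z (z+X), ZMod.stdAddChar (ph y)‖ ≤ (36 * P * (1 + Real.log (X+1))) * G0 := by
      have := congrArg norm hmain
      rw [norm_mul, Complex.norm_natCast] at this
      rw [this]
      refine (norm_sum_le _ _).trans ?_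
      refine le_trans ?_ (mul_le_mul_of_nonneg_right (Kn_L1 hX (by omega) a) hG00)
      rw [Finset.sum_mul]
      refine Finset.sum_le_sum fun β _ => ?_
      rw [norm_mul]
      exact mul_le_mul_of_nonneg_left (hpt' _) (norm_nonneg _)
    refine le_of_mul_le_mul_left ?_ hP0
    linarith
  calc _ ≤ (36 * (1 + Real.log (X+1)) * G0)^(2*h) := pow_le_pow_left₀ (norm_nonneg _) hfin _
    _ = _ := by rw [mul_pow, hG0p]

def fX (P k X : ℕ) [NeZero P] (α : ZMod P) : ℂ := ∑ n ∈ Finset.Icc 1 X, ZMod.stdAddChar (α * (n:ZMod P)^k)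

lemma Xi_LS {P κ h Y H : ℕ} [NeZero P] (hH : h * Y^(κ+1) ≤ H) (hP : 2*H < P) (γ0 α : ZMod P) :
    P * Xi P κ h Y γ0 α ≤ ∑ γ, Xi P κ h Y γ α * ‖Kn P (-(H:ZMod P)) (2*H+1) (γ0 - γ)‖ := by
  unfold Xi
  simp_rw [Finset.sum_mul]
  rw [Finset.sum_comm, Finset.mul_sum]
  refine Finset.sum_le_sum fun u _ => ?_
  refine LS ((TY h Y).filter (fun y => low P κ h y = u)) (fun y : Fin h → ℕ => ZMod.stdAddChar (α * ((∑ i, y i^(κ+2) : ℕ) : ZMod P))) (fun y : Fin h → ℕ => ∑ i, y i^(κ+1)) H ?_ hP γ0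
  intro y hy
  have hy' := Fintype.mem_piFinset.mp (Finset.mem_filter.mp hy).1
  refine le_trans ?_ hH
  calc _ ≤ ∑ i : Fin h, Y^(κ+1) := Finset.sum_le_sum fun i _ => Nat.pow_le_pow_left (Finset.mem_Icc.mp (hy' i)).2 _
    _ = _ := by simp

lemma Xi_nonneg {P κ h Y : ℕ} [NeZero P] (γ α : ZMod P) : 0 ≤ Xi P κ h Y γ α := by
  unfold Xi; positivity

lemma MVa {P κ X h H : ℕ} [NeZero P] (hκ : 1 ≤ κ) (hX : 1 ≤ X) (hP : 4 * X < P) (h1 : 1 ≤ h)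
    (hH : h * (2*X)^(κ+1) ≤ H) (hHP : 2*H < P) :
    (P:ℝ) * X * ∑ α : ZMod P, ‖fX P (κ+2) X α‖^(2*h) / (1 + (rB P X H (α * (-((κ+2 : ℕ):ZMod P))) : ℝ)) ≤
      (36 * (1 + Real.log (X+1)))^(2*h) * ((2*(h:ℝ))^κ * ((2*X : ℕ):ℝ)^(hh κ)) * (6 * H * (1 + Real.log (H+1))) *
        ∑ α : ZMod P, ∑ γ : ZMod P, Xi P κ h (2*X) γ α := by
  rw [Finset.mul_sum, Finset.mul_sum]
  refine Finset.sum_le_sum fun α _ => ?_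
  set β := α * (-((κ+2 : ℕ):ZMod P)) with hβ
  have hr : (0:ℝ) < 1 + (rB P X H β : ℝ) := by positivity
  have hX' : (0:ℝ) < X := by exact_mod_cast hX
  have hl1 : 0 ≤ Real.log ((X:ℝ)+1) := Real.log_nonneg (by linarith)
  set K := (36 * (1 + Real.log (X+1)))^(2*h) * ((2*(h:ℝ))^κ * ((2*X : ℕ):ℝ)^(hh κ)) with hK
  have hK0 : 0 ≤ K := by positivity
  have hH1 : 1 ≤ H := le_trans (Nat.one_le_iff_ne_zero.mpr (by positivity)) hH
  rw [← mul_div_assoc, div_le_iff₀ hr]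
  have s1 : (X:ℝ) * ‖fX P (κ+2) X α‖^(2*h) ≤ ∑ z ∈ Finset.range X, K * Xi P κ h (2*X) ((z:ZMod P)*β) α := by
    calc _ = ∑ z ∈ Finset.range X, ‖fX P (κ+2) X α‖^(2*h) := by simp
      _ ≤ _ := by
        refine Finset.sum_le_sum fun z hz => ?_
        have := window hκ hX hP h1 z (Finset.mem_range.mp hz) α
        rw [← mul_assoc, show α * (-(z:ZMod P) * ((κ+2 : ℕ) : ZMod P)) = (z:ZMod P) * β by rw [hβ]; ring] at this
        exact this
  have s2 : (P:ℝ) * ∑ z ∈ Finset.range X, K * Xi P κ h (2*X) ((z:ZMod P)*β) α ≤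
      K * ∑ γ, Xi P κ h (2*X) γ α * ∑ z ∈ Finset.range X, ‖Kn P (-(H:ZMod P)) (2*H+1) ((z:ZMod P)*β + -γ)‖ := by
    rw [← Finset.mul_sum, mul_left_comm, Finset.mul_sum]
    refine mul_le_mul_of_nonneg_left ?_ hK0
    simp_rw [Finset.mul_sum]
    rw [Finset.sum_comm (s := Finset.univ)]
    refine Finset.sum_le_sum fun z _ => ?_
    have := Xi_LS hH hHP ((z:ZMod P)*β) α
    simp_rw [sub_eq_add_neg] at this
    exact this
  have s3 : K * ∑ γ, Xi P κ h (2*X) γ α * ∑ z ∈ Finset.range X, ‖Kn P (-(H:ZMod P)) (2*H+1) ((z:ZMod P)*β + -γ)‖ ≤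
      K * ∑ γ, Xi P κ h (2*X) γ α * (3 * H * (2 * (1 + rB P X H β) : ℕ) * (1 + Real.log (H+1))) := by
    refine mul_le_mul_of_nonneg_left ?_ hK0
    refine Finset.sum_le_sum fun γ _ => mul_le_mul_of_nonneg_left ?_ (Xi_nonneg _ _)
    exact WS _ _ (by omega) _ _
  calc (P:ℝ) * X * ‖fX P (κ+2) X α‖^(2*h) = P * (X * ‖fX P (κ+2) X α‖^(2*h)) := by ring
    _ ≤ P * ∑ z ∈ Finset.range X, K * Xi P κ h (2*X) ((z:ZMod P)*β) α := by gcongr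
    _ ≤ _ := s2.trans s3
    _ = _ := by
      rw [← Finset.sum_mul]; push_cast; ring

lemma sum_Xi {q : ℕ} [Fact q.Prime] (M κ h Y : ℕ) :
    ((q^M : ℕ):ℝ)^κ * ∑ α : ZMod (q^M), ∑ γ : ZMod (q^M), Xi (q^M) κ h Y γ α = ∑ θ, ‖Gk (q^M) (κ+2) Y θ‖^(2*h) := by
  rw [sum_snoc, Finset.mul_sum]
  refine Finset.sum_congr rfl fun α _ => ?_
  rw [sum_snoc, Finset.mul_sum]
  refine Finset.sum_congr rfl fun γ _ => ?_
  rw [← Xi_par]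
  refine Finset.sum_congr rfl fun x _ => ?_
  rw [Gk_eq]

lemma logb (n m : ℕ) (δ C0 : ℝ) (hδ : 0 < δ) (hC0 : 1 ≤ C0) : ∃ C : ℝ, 1 ≤ C ∧ ∀ X Y : ℝ, 1 ≤ X → 0 ≤ Y → Y + 1 ≤ C0 * X^m →
    (1 + Real.log (Y+1))^n ≤ C * X^δ := by
  set η := δ / (m*n+1) with hη
  have hη0 : 0 < η := by positivity
  have hηδ : η * (m * n) ≤ δ := by
    rw [hη, div_mul_eq_mul_div, div_le_iff₀ (by positivity)]; nlinarith
  refine ⟨(1+1/η)^n * (C0^η)^n, ?_, ?_⟩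
  · have h1 : (1:ℝ) ≤ 1 + 1/η := by have : 0 < 1/η := by positivity
                                    linarith
    have h2 : (1:ℝ) ≤ C0^η := Real.one_le_rpow hC0 hη0.le
    exact one_le_mul_of_one_le_of_one_le (one_le_pow₀ h1) (one_le_pow₀ h2)
  · intro X Y hX hY h
    have hl := Real.log_le_rpow_div (x := Y+1) (by linarith) hη0
    have h1 : (1:ℝ) ≤ (Y+1)^η := Real.one_le_rpow (by linarith) hη0.le
    have hl0 : 0 ≤ Real.log (Y+1) := Real.log_nonneg (by linarith)
    have h2 : 1 + Real.log (Y+1) ≤ (1+1/η) * (C0 * X^m)^η := by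
      calc _ ≤ (1+1/η) * (Y+1)^η := by rw [add_mul, one_mul, div_mul_eq_mul_div, one_mul]; linarith
        _ ≤ _ := by gcongr
    calc _ ≤ ((1+1/η) * (C0 * X^m)^η)^n := by gcongr
      _ = (1+1/η)^n * (C0^η)^n * ((X^m)^η)^n := by
        rw [Real.mul_rpow (by linarith) (by positivity), mul_pow, mul_pow]; ring
      _ ≤ _ := by
        refine mul_le_mul_of_nonneg_left ?_ (by positivity)
        rw [← Real.rpow_natCast X m, ← Real.rpow_mul (by linarith), ← Real.rpow_natCast _ n, ← Real.rpow_mul (by linarith)]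
        exact Real.rpow_le_rpow_of_exponent_le hX (by nlinarith)

lemma gen4 {A a b B c t a' c' t' : ℝ} (hA : 0 ≤ A) (ha : 0 ≤ a) (hb : 0 ≤ b) (hB : 0 ≤ B) (hc : 0 ≤ c) (ht : 0 ≤ t)
    (h1 : a ≤ a') (h2 : c ≤ c') (h3 : t ≤ t') : A * a * b * (6 * B * c) * t ≤ A * a' * b * (6 * B * c') * t' := by
  have := ha.trans h1
  have := hc.trans h2
  gcongr

set_option maxHeartbeats 1000000 in
lemma MV (κ : ℕ) (hκ : 1 ≤ κ) (ε : ℝ) (hε : 0 < ε) : ∃ C : ℝ, 1 ≤ C ∧ ∀ X : ℕ, 1 ≤ X → ∃ (P H : ℕ) (_ : NeZero P),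
    P.Coprime (κ+2) ∧ 2 * X^(κ+2) < P ∧ (P:ℝ) ≤ C * (X:ℝ)^(κ+2) ∧ 2*X < H ∧ X^(κ+1) ≤ H ∧ X * H ≤ P ∧
    ∑ α : ZMod P, ‖fX P (κ+2) X α‖^(2*hh (κ+2)) / (1 + (rB P X H (α * (-((κ+2 : ℕ):ZMod P))) : ℝ)) ≤
      C * P * ((X:ℝ)^((κ+2)^2-1) * (X:ℝ)^ε) := by
  set k := κ+2 with hk
  set h := hh k with hhd
  obtain ⟨q, hq1, hq2⟩ := Nat.exists_infinite_primes (k + 33)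
  haveI : Fact q.Prime := ⟨hq2⟩
  obtain ⟨C1, hC1, hv⟩ := vmvt (q := q) (by omega) (k := k) (by omega) (by omega) (ε := ε/3) (by positivity)
  have h2h : 2 * h = k * (k+1) := two_hh k
  have hh0 : 3 ≤ h := by nlinarith
  have hhq : h < q^2 := by nlinarith
  obtain ⟨C2, hC2, hlog1⟩ := logb (2*h) 1 (ε/3) 2 (by positivity) (by norm_num)
  obtain ⟨C3, hC3, hlog2⟩ := logb 1 (κ+1) (ε/3) (h * 2^(κ+1) + 1) (by positivity) (by
    have : (0:ℝ) ≤ h * 2^(κ+1) := by positivity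
    linarith)
  have hq0 : (1:ℝ) ≤ q := by exact_mod_cast hq2.one_lt.le
  set C4 : ℝ := (36:ℝ)^(2*h) * C2 * ((2*(h:ℝ))^κ * 2^(hh κ)) * (6 * (h * 2^(κ+1)) * C3) * (C1 * (2*q)^h * (2*q)^(ε/3)) with hC4
  have hC40 : 0 ≤ C4 := by positivity
  set C5 : ℝ := (2*q)^k * q^3 with hC5
  have hC50 : 0 ≤ C5 := by positivity
  refine ⟨C4 + C5 + 1, by linarith, fun X hX => ?_⟩
  have hX' : (1:ℝ) ≤ X := by exact_mod_cast hX
  set N := Nat.log q (2*X) + 1 with hN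
  have hN1 : 2*X < q^N := Nat.lt_pow_succ_log_self hq2.one_lt _
  have hN2 : q^N ≤ 2*q*X := by
    rw [hN, pow_succ]
    have := Nat.pow_log_le_self q (x := 2*X) (by omega)
    nlinarith
  set M := k*N+3 with hM
  set H := h * (2*X)^(κ+1) with hH
  have hPe : q^M = (q^N)^k * q^3 := by rw [hM, pow_add, ← pow_mul, mul_comm k N]
  have hXk : (2*X)^k = (2*X)^(κ+1) * (2*X) := by rw [hk]; ring
  have hXp : 1 ≤ (2*X)^(κ+1) := Nat.one_le_iff_ne_zero.mpr (by positivity)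
  have hXX : X ≤ X^(κ+2) := Nat.le_self_pow (by omega) X
  have hPlow : (2*X)^k * q^3 ≤ q^M := by
    rw [hPe]; exact Nat.mul_le_mul_right _ (Nat.pow_le_pow_left hN1.le _)
  have h2Xk : 2^k * X^k = (2*X)^k := by rw [mul_pow]
  have h8 : 8 ≤ 2^k := by
    calc 8 = 2^3 := by norm_num
      _ ≤ 2^k := Nat.pow_le_pow_right (by norm_num) (by omega)
  have hq3 : 8 ≤ q^3 := by
    calc 8 ≤ q := by omega
      _ ≤ q^3 := Nat.le_self_pow (by norm_num) q
  have hbig : 8 * X^k ≤ q^M := by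
    calc 8 * X^k ≤ 2^k * X^k * 1 := by rw [mul_one]; gcongr
      _ ≤ (2*X)^k * q^3 := by rw [h2Xk]; gcongr; omega
      _ ≤ _ := hPlow
  have hXk1 : 1 ≤ X^k := Nat.one_le_iff_ne_zero.mpr (by positivity)
  have hHP : 2*H < q^M := by
    refine lt_of_lt_of_le ?_ hPlow
    rw [hXk, hH]
    have e1 : 2 * (h * (2*X)^(κ+1)) < 2 * (q^2 * (2*X)^(κ+1)) := by
      have := Nat.mul_lt_mul_of_pos_right hhq (show 0 < (2*X)^(κ+1) by omega)
      omega
    refine e1.trans_le ?_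
    have e2 : (2*X)^(κ+1) * (2*X) * q^3 = (2 * (q^2 * (2*X)^(κ+1))) * (X*q) := by ring
    rw [e2]
    exact Nat.le_mul_of_pos_right _ (Nat.mul_pos hX hq2.pos)
  have hmv := MVa (P := q^M) (κ := κ) (X := X) (h := h) (H := H) hκ hX (by rw [hk] at hbig; omega) (by omega) le_rfl hHP
  have hsx := sum_Xi (q := q) M κ h (2*X)
  rw [← hk] at hsx
  have hvm := hv N M (2*X) (by omega) hN1
  rw [← hsx] at hvm
  have hPpos : (0:ℝ) < ((q^M : ℕ):ℝ) := by exact_mod_cast (NeZero.pos (q^M))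
  have hPc : ((q^M : ℕ):ℝ) = (q:ℝ)^M := by push_cast; rfl
  have hNr : (q:ℝ)^N ≤ 2*q*X := by exact_mod_cast hN2
  set T := ∑ α : ZMod (q^M), ∑ γ : ZMod (q^M), Xi (q^M) κ h (2*X) γ α with hT
  have hTb : T ≤ (((q^M : ℕ):ℝ))^2 * (C1 * (2*q)^h * (2*q)^(ε/3)) * ((X:ℝ)^h * (X:ℝ)^(ε/3)) := by
    have e1 : ((q^M : ℕ):ℝ)^κ * T ≤ ((q^M : ℕ):ℝ)^κ * ((((q^M : ℕ):ℝ))^2 * (C1 * ((q:ℝ)^N)^h * (q:ℝ)^(ε/3*N))) := by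
      refine hvm.trans (le_of_eq ?_)
      rw [← hPc, hk]; ring
    refine (le_of_mul_le_mul_left e1 (by positivity)).trans ?_
    have e2 : (q:ℝ)^(ε/3*N) ≤ (2*q)^(ε/3) * (X:ℝ)^(ε/3) := by
      rw [mul_comm (ε/3), Real.rpow_mul (by linarith), Real.rpow_natCast, ← Real.mul_rpow (by positivity) (by positivity)]
      gcongr
    have e3 : ((q:ℝ)^N)^h ≤ (2*q)^h * (X:ℝ)^h := by rw [← mul_pow]; gcongr
    calc _ ≤ (((q^M : ℕ):ℝ))^2 * (C1 * ((2*q)^h * (X:ℝ)^h) * ((2*q)^(ε/3) * (X:ℝ)^(ε/3))) := by gcongr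
      _ = _ := by ring
  have hl1 := hlog1 X X hX' (by linarith) (by rw [pow_one]; linarith)
  have hHr : (H:ℝ) = (h * 2^(κ+1)) * (X:ℝ)^(κ+1) := by rw [hH]; push_cast; rw [mul_pow]; ring
  have hl2 := hlog2 X H hX' (by positivity) (by
    rw [hHr, add_mul, one_mul]
    have := one_le_pow₀ hX' (n := κ+1)
    linarith)
  rw [pow_one] at hl2
  have hlH : 0 ≤ Real.log ((H:ℝ)+1) := Real.log_nonneg (by linarith [(Nat.cast_nonneg H : (0:ℝ) ≤ H)])
  have hlX : 0 ≤ Real.log ((X:ℝ)+1) := Real.log_nonneg (by linarith)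
  have hT0 : 0 ≤ T := Finset.sum_nonneg fun _ _ => Finset.sum_nonneg fun _ _ => Xi_nonneg _ _
  refine ⟨q^M, H, inferInstance, ?_, ?_, ?_, ?_, ?_, ?_, ?_⟩
  · apply Nat.Coprime.pow_left
    exact (Nat.Prime.coprime_iff_not_dvd hq2).mpr (fun hdvd => by have := Nat.le_of_dvd (by omega) hdvd; omega)
  · omega
  · rw [hPe]; push_cast
    calc ((q:ℝ)^N)^k * q^3 ≤ (2*q*X)^k * q^3 := by gcongr
      _ = C5 * (X:ℝ)^k := by rw [hC5, mul_pow]; ring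
      _ ≤ _ := by gcongr; linarith
  · rw [hH]
    have : 2*X ≤ (2*X)^(κ+1) := Nat.le_self_pow (by omega) _
    nlinarith
  · rw [hH]
    calc X^(κ+1) ≤ (2*X)^(κ+1) := Nat.pow_le_pow_left (by omega) _
      _ ≤ _ := Nat.le_mul_of_pos_left _ (by omega)
  · refine le_trans ?_ hPlow
    rw [hXk, hH]
    calc X * (h * (2*X)^(κ+1)) = (2*X)^(κ+1) * X * h := by ring
      _ ≤ (2*X)^(κ+1) * (2*X) * q^3 := by
        gcongr
        · omega
        · calc h ≤ q^2 := hhq.le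
            _ ≤ q^3 := Nat.pow_le_pow_right hq2.pos (by norm_num)
  · set Sg := ∑ α : ZMod (q^M), ‖fX (q^M) (κ+2) X α‖^(2*h) / (1 + (rB (q^M) X H (α * (-((κ+2 : ℕ):ZMod (q^M)))) : ℝ)) with hSg
    have f1 : ((q^M : ℕ):ℝ) * X * Sg ≤ ((q^M : ℕ):ℝ) * X * (C4 * ((q^M : ℕ):ℝ) * ((X:ℝ)^((κ+2)^2-1) * (X:ℝ)^ε)) := by
      refine hmv.trans ?_
      calc _ ≤ ((36:ℝ)^(2*h) * (C2 * (X:ℝ)^(ε/3))) * ((2*(h:ℝ))^κ * (2^(hh κ) * (X:ℝ)^(hh κ))) *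
            (6 * ((h * 2^(κ+1)) * (X:ℝ)^(κ+1)) * (C3 * (X:ℝ)^(ε/3))) *
            ((((q^M : ℕ):ℝ))^2 * (C1 * (2*q)^h * (2*q)^(ε/3)) * ((X:ℝ)^h * (X:ℝ)^(ε/3))) := by
            rw [mul_pow 36, hHr]
            rw [hHr] at hl2 hlH
            have : ((2*X : ℕ):ℝ)^(hh κ) = 2^(hh κ) * (X:ℝ)^(hh κ) := by push_cast; rw [mul_pow]
            rw [this]
            exact gen4 (by positivity) (by positivity) (by positivity) (by positivity) (by positivity) hT0 hl1 hl2 hTb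
        _ = C4 * ((q^M : ℕ):ℝ)^2 * (((X:ℝ)^(hh κ) * (X:ℝ)^(κ+1) * (X:ℝ)^h) * ((X:ℝ)^(ε/3) * (X:ℝ)^(ε/3) * (X:ℝ)^(ε/3))) := by
            rw [hC4]; ring
        _ = C4 * ((q^M : ℕ):ℝ)^2 * ((X:ℝ)^((κ+2)^2) * (X:ℝ)^ε) := by
            congr 2
            · rw [← pow_add, ← pow_add]; congr 1
              have a1 := two_hh κ
              rw [hk] at h2h
              nlinarith
            · rw [← Real.rpow_add (by linarith), ← Real.rpow_add (by linarith)]; congr 1; ring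
        _ = _ := by
            have : (X:ℝ)^((κ+2)^2) = X * (X:ℝ)^((κ+2)^2-1) := by
              rw [← pow_succ']; congr 1
            rw [this]; ring
    refine (le_of_mul_le_mul_left f1 (by positivity)).trans ?_
    gcongr; linarith

lemma rB_struct {P X H : ℕ} [NeZero P] (hH : 2*X < H) (β : ZMod P) (hr : 1 ≤ rB P X H β) :
    ∃ g : ℕ, 1 ≤ g ∧ g * rB P X H β ≤ X ∧ za ((g:ZMod P) * β) * rB P X H β * H ≤ P := by
  set B := (Finset.Ico 1 X).filter (fun v : ℕ => za ((v:ZMod P) * β) * H ≤ P) with hB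
  have hP0 : 0 < P := NeZero.pos P
  set w : ℕ → ℤ := fun v => ((v:ZMod P) * β).valMinAbs with hw
  have hwc : ∀ v : ℕ, ((w v : ℤ) : ZMod P) = (v:ZMod P) * β := fun v => ZMod.coe_valMinAbs _
  have hBm : ∀ v ∈ B, 1 ≤ v ∧ v < X ∧ (w v).natAbs * H ≤ P := by
    intro v hv
    rw [hB, Finset.mem_filter, Finset.mem_Ico] at hv
    exact ⟨hv.1.1, hv.1.2, hv.2⟩
  have hrB : rB P X H β = B.card := rfl
  rw [hrB] at hr ⊢
  have hne : B.Nonempty := Finset.card_pos.mp hr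
  obtain ⟨v1, hv1, hmax⟩ := Finset.exists_max_image B id hne
  simp only [id] at hmax
  have hcol : ∀ v ∈ B, (v:ℤ) * w v1 = (v1:ℤ) * w v := by
    intro v hv
    obtain ⟨a1, a2, a3⟩ := hBm v hv
    obtain ⟨b1, b2, b3⟩ := hBm v1 hv1
    have hd : (P:ℤ) ∣ (v:ℤ) * w v1 - (v1:ℤ) * w v := by
      rw [← ZMod.intCast_zmod_eq_zero_iff_dvd]
      push_cast
      rw [hwc, hwc]; ring
    have hlt : ((v:ℤ) * w v1 - (v1:ℤ) * w v).natAbs < P := by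
      have c1 : ((v:ℤ) * w v1 - (v1:ℤ) * w v).natAbs ≤ v * (w v1).natAbs + v1 * (w v).natAbs := by
        refine (Int.natAbs_sub_le _ _).trans ?_
        rw [Int.natAbs_mul, Int.natAbs_mul, Int.natAbs_natCast, Int.natAbs_natCast]
      have c2 : (v * (w v1).natAbs + v1 * (w v).natAbs) * H < P * H := by
        calc _ = v * ((w v1).natAbs * H) + v1 * ((w v).natAbs * H) := by ring
          _ ≤ X * P + X * P := by gcongr
          _ = P * (2*X) := by ring
          _ < P * H := Nat.mul_lt_mul_of_pos_left hH hP0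
      exact lt_of_le_of_lt c1 (lt_of_mul_lt_mul_right c2 (Nat.zero_le _))
    have := Int.eq_zero_of_dvd_of_natAbs_lt_natAbs hd (by simpa using hlt)
    linarith
  obtain ⟨hv11, hv12, hv13⟩ := hBm v1 hv1
  let G : AddSubgroup ℤ :=
    { carrier := {n | ∃ s : ℤ, (s : ZMod P) = (n : ZMod P) * β ∧ n * w v1 = (v1:ℤ) * s}
      zero_mem' := ⟨0, by simp, by simp⟩
      add_mem' := by
        rintro a b ⟨s, h1, h2⟩ ⟨t, h3, h4⟩
        exact ⟨s + t, by push_cast; rw [h1, h3]; ring, by rw [add_mul, h2, h4]; ring⟩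
      neg_mem' := by
        rintro a ⟨s, h1, h2⟩
        exact ⟨-s, by push_cast; rw [h1]; ring, by rw [neg_mul, h2]; ring⟩ }
  obtain ⟨g0, hg0⟩ := Int.subgroup_cyclic G
  have hgG : g0 ∈ G := by rw [hg0]; exact AddSubgroup.mem_closure_singleton_self g0
  have hBG : ∀ v ∈ B, (v:ℤ) ∈ G := fun v hv => ⟨w v, by rw [hwc]; simp, hcol v hv⟩
  have hdiv : ∀ v ∈ B, ∃ j : ℤ, (v:ℤ) = j * g0 := by
    intro v hv
    have := hBG v hv
    rw [hg0, AddSubgroup.mem_closure_singleton] at this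
    obtain ⟨j, hj⟩ := this
    exact ⟨j, by rw [← hj]; simp⟩
  obtain ⟨s, hs1, hs2⟩ := hgG
  have hdiv' : ∀ v ∈ B, g0.natAbs ∣ v := by
    intro v hv
    obtain ⟨j, hj⟩ := hdiv v hv
    exact Int.natCast_dvd_natCast.mp (by rw [Int.natAbs_dvd]; exact ⟨j, by rw [hj]; ring⟩)
  have hgpos : 0 < g0.natAbs := Nat.pos_of_dvd_of_pos (hdiv' v1 hv1) (by omega)
  obtain ⟨J, hJ⟩ := hdiv' v1 hv1
  have hcard : B.card ≤ J := by
    calc B.card ≤ ((Finset.Icc 1 J).image (fun j => g0.natAbs * j)).card := by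
          apply Finset.card_le_card
          intro v hv
          obtain ⟨j, hj⟩ := hdiv' v hv
          have m1 := hmax v hv
          have m2 := (hBm v hv).1
          rw [Finset.mem_image]
          refine ⟨j, ?_, hj.symm⟩
          rw [Finset.mem_Icc]
          refine ⟨?_, ?_⟩
          · rcases Nat.eq_zero_or_pos j with h | h
            · rw [h] at hj; omega
            · exact h
          · rw [hj, hJ] at m1
            exact Nat.le_of_mul_le_mul_left m1 hgpos
      _ ≤ (Finset.Icc 1 J).card := Finset.card_image_le
      _ = J := by simp
  have hws : (w v1).natAbs = J * s.natAbs := by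
    have e : (g0 * w v1).natAbs = ((v1:ℤ) * s).natAbs := by rw [hs2]
    rw [Int.natAbs_mul, Int.natAbs_mul, Int.natAbs_natCast, hJ, mul_assoc, ← hJ] at e
    exact Nat.eq_of_mul_eq_mul_left hgpos e
  have hza : za ((g0.natAbs : ZMod P) * β) ≤ s.natAbs := by
    rcases Int.natAbs_eq g0 with h | h
    · refine za_le _ s ?_
      rw [hs1]; congr 1
      conv_lhs => rw [h]
      simp
    · have hc : (g0 : ZMod P) = -(g0.natAbs : ZMod P) := by
        conv_lhs => rw [h]
        rw [Int.cast_neg, Int.cast_natCast]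
      have := za_le ((g0.natAbs : ZMod P) * β) (-s) (by
        rw [Int.cast_neg, hs1, hc]; ring)
      simpa using this
  refine ⟨g0.natAbs, hgpos, ?_, ?_⟩
  · calc _ ≤ g0.natAbs * J := by gcongr
      _ ≤ X := by omega
  · calc _ ≤ s.natAbs * J * H := by gcongr
      _ = (w v1).natAbs * H := by rw [hws]; ring
      _ ≤ P := hv13

lemma rB_count {P X H : ℕ} [NeZero P] (hH : 2*X < H) (hXH : X * H ≤ P) (ρ : ℕ) (hρ : 1 ≤ ρ) :
    (Finset.univ.filter (fun β : ZMod P => ρ ≤ rB P X H β)).card * (H * ρ^2) ≤ 6 * X * P := by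
  have h1 : (Finset.univ.filter (fun β : ZMod P => ρ ≤ rB P X H β)).card ≤ (X/ρ) * (4 * (P/(ρ*H)) + 2 * (X/ρ)) := by
    have hsub : Finset.univ.filter (fun β : ZMod P => ρ ≤ rB P X H β) ⊆
        (Finset.Icc 1 (X/ρ)).biUnion (fun g => Finset.univ.filter (fun β : ZMod P => za ((g:ZMod P) * β) ≤ P/(ρ*H))) := by
      intro β hβ
      rw [Finset.mem_filter] at hβ
      obtain ⟨g, g1, g2, g3⟩ := rB_struct hH β (hρ.trans hβ.2)
      simp only [Finset.mem_biUnion, Finset.mem_filter, Finset.mem_univ, true_and, Finset.mem_Icc]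
      refine ⟨g, ⟨g1, (Nat.le_div_iff_mul_le hρ).mpr (le_trans (Nat.mul_le_mul_left _ hβ.2) g2)⟩, ?_⟩
      rw [Nat.le_div_iff_mul_le (Nat.mul_pos hρ (by omega))]
      refine le_trans ?_ g3
      rw [mul_assoc]
      gcongr; exact hβ.2
    refine (Finset.card_le_card hsub).trans (Finset.card_biUnion_le.trans ?_)
    calc _ ≤ ∑ g ∈ Finset.Icc 1 (X/ρ), (4 * (P/(ρ*H)) + 2 * (X/ρ)) := by
          refine Finset.sum_le_sum fun g hg => ?_
          rw [Finset.mem_Icc] at hg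
          exact (count_za g _ hg.1).trans (by omega)
      _ = _ := by simp
  calc _ ≤ (X/ρ) * (4 * (P/(ρ*H)) + 2 * (X/ρ)) * (H * ρ^2) := Nat.mul_le_mul_right _ h1
    _ = (ρ * (X/ρ)) * (4 * ((ρ*H) * (P/(ρ*H))) + 2 * ((ρ*(X/ρ)) * H)) := by ring
    _ ≤ X * (4 * P + 2 * (X * H)) := by
        gcongr <;> exact Nat.mul_div_le _ _
    _ ≤ X * (4 * P + 2 * P) := by gcongr
    _ = _ := by ring

lemma rB_le {P X H : ℕ} (β : ZMod P) : rB P X H β ≤ X := by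
  unfold rB
  refine (Finset.card_filter_le _ _).trans ?_
  simp

lemma rB_moment {P X H : ℕ} [NeZero P] (hH : 2*X < H) (hXH : X * H ≤ P) :
    (H:ℝ) * ∑ β : ZMod P, (rB P X H β : ℝ)^2 ≤ 12 * X * P * (1 + Real.log X) := by
  have h1 : ∀ r : ℕ, r^2 ≤ ∑ ρ ∈ Finset.Icc 1 r, 2 * ρ := by
    intro r
    induction r with
    | zero => simp
    | succ n ih => rw [Finset.sum_Icc_succ_top (by omega)]; nlinarith
  have h2 : ∑ β : ZMod P, (rB P X H β)^2 ≤ ∑ ρ ∈ Finset.Icc 1 X, 2 * ρ * (Finset.univ.filter (fun β : ZMod P => ρ ≤ rB P X H β)).card := by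
    calc _ ≤ ∑ β : ZMod P, ∑ ρ ∈ Finset.Icc 1 X, if ρ ≤ rB P X H β then 2 * ρ else 0 := by
          refine Finset.sum_le_sum fun β _ => (h1 _).trans ?_
          rw [← Finset.sum_filter]
          refine Finset.sum_le_sum_of_subset ?_
          intro ρ hρ
          rw [Finset.mem_Icc] at hρ
          rw [Finset.mem_filter, Finset.mem_Icc]
          exact ⟨⟨hρ.1, hρ.2.trans (rB_le β)⟩, hρ.2⟩
      _ = _ := by
          rw [Finset.sum_comm]
          refine Finset.sum_congr rfl fun ρ _ => ?_
          rw [← Finset.sum_filter, Finset.sum_const, smul_eq_mul, mul_comm]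
  have h2' : ∑ β : ZMod P, (rB P X H β : ℝ)^2 ≤ ∑ ρ ∈ Finset.Icc 1 X, 2 * (ρ:ℝ) * ((Finset.univ.filter (fun β : ZMod P => ρ ≤ rB P X H β)).card : ℝ) := by
    exact_mod_cast h2
  calc _ ≤ (H:ℝ) * ∑ ρ ∈ Finset.Icc 1 X, 2 * (ρ:ℝ) * ((Finset.univ.filter (fun β : ZMod P => ρ ≤ rB P X H β)).card : ℝ) := by gcongr
    _ ≤ ∑ ρ ∈ Finset.Icc 1 X, 12 * X * P * (ρ:ℝ)⁻¹ := by
        rw [Finset.mul_sum]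
        refine Finset.sum_le_sum fun ρ hρ => ?_
        rw [Finset.mem_Icc] at hρ
        have hρ0 : (0:ℝ) < ρ := by exact_mod_cast hρ.1
        have := rB_count hH hXH ρ hρ.1
        have h3 : ((Finset.univ.filter (fun β : ZMod P => ρ ≤ rB P X H β)).card : ℝ) * (H * (ρ:ℝ)^2) ≤ 6 * X * P := by exact_mod_cast this
        rw [← div_eq_mul_inv, le_div_iff₀ hρ0]
        nlinarith
    _ = 12 * X * P * (harmonic X : ℚ) := by
        rw [← Finset.mul_sum, harmonic_eq_sum_Icc]; push_cast; rfl
    _ ≤ _ := by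
        gcongr; exact harmonic_le_one_add_log X

lemma div_bound (ε : ℝ) (hε : 0 < ε) : ∃ C : ℝ, 1 ≤ C ∧ ∀ n : ℕ, 1 ≤ n → (n.divisors.card : ℝ) ≤ C * (n:ℝ)^ε := by
  set K : ℝ := 1 + 1 / (ε * Real.log 2) with hK
  have hl2 : 0 < Real.log 2 := Real.log_pos (by norm_num)
  have hK1 : 1 ≤ K := by have : 0 < 1 / (ε * Real.log 2) := by positivity
                         linarith
  set Q : ℕ := ⌈(2:ℝ)^(1/ε)⌉₊ with hQ
  refine ⟨K^Q, one_le_pow₀ hK1, fun n hn => ?_⟩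
  have hn0 : n ≠ 0 := by omega
  rw [Nat.card_divisors hn0]
  have hnp : (n:ℝ)^ε = ∏ p ∈ n.primeFactors, ((p:ℝ)^ε)^(n.factorization p) := by
    conv_lhs => rw [← Nat.prod_factorization_pow_eq_self hn0]
    rw [Finsupp.prod, Nat.support_factorization]
    push_cast
    rw [← Real.finset_prod_rpow _ _ (fun p _ => by positivity)]
    refine Finset.prod_congr rfl fun p _ => ?_
    rw [← Real.rpow_natCast, ← Real.rpow_mul (by positivity), mul_comm, Real.rpow_mul (by positivity), Real.rpow_natCast]
  rw [hnp]
  push_cast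
  have hterm : ∀ p ∈ n.primeFactors, ((n.factorization p : ℝ) + 1) ≤ (if p < Q then K else 1) * ((p:ℝ)^ε)^(n.factorization p) := by
    intro p hp
    have hp2 : (2:ℝ) ≤ p := by exact_mod_cast (Nat.prime_of_mem_primeFactors hp).two_le
    set a := n.factorization p
    split_ifs with h
    · have h1 : 1 + (a:ℝ) * (ε * Real.log 2) ≤ ((p:ℝ)^ε)^a := by
        calc _ ≤ Real.exp ((a:ℝ) * (ε * Real.log 2)) := by linarith [Real.add_one_le_exp ((a:ℝ) * (ε * Real.log 2))]
          _ = ((2:ℝ)^ε)^a := by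
            rw [Real.exp_nat_mul, Real.rpow_def_of_pos (by norm_num)]; congr 2; ring
          _ ≤ _ := by gcongr
      refine le_trans ?_ (mul_le_mul_of_nonneg_left h1 (by linarith))
      rw [hK]
      have : (1 + 1 / (ε * Real.log 2)) * (1 + (a:ℝ) * (ε * Real.log 2)) = 1 + a + 1 / (ε * Real.log 2) + a * (ε * Real.log 2) := by
        field_simp; ring
      rw [this]
      have e1 : 0 ≤ 1 / (ε * Real.log 2) := by positivity
      have e2 : 0 ≤ (a:ℝ) * (ε * Real.log 2) := by positivity
      linarith
    · rw [one_mul]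
      have h1 : (2:ℝ) ≤ (p:ℝ)^ε := by
        have : (2:ℝ)^(1/ε) ≤ p := (Nat.le_ceil _).trans (by exact_mod_cast not_lt.mp h)
        calc (2:ℝ) = ((2:ℝ)^(1/ε))^ε := by rw [← Real.rpow_mul (by norm_num), one_div, inv_mul_cancel₀ hε.ne', Real.rpow_one]
          _ ≤ _ := by gcongr
      calc (a:ℝ) + 1 ≤ (2:ℝ)^a := by
            have := Nat.lt_two_pow_self (n := a)
            exact_mod_cast this
        _ ≤ _ := by gcongr
  refine (Finset.prod_le_prod (fun p _ => by positivity) hterm).trans ?_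
  rw [Finset.prod_mul_distrib]
  refine mul_le_mul_of_nonneg_right ?_ (Finset.prod_nonneg fun p _ => by positivity)
  rw [← Finset.prod_filter, Finset.prod_const]
  refine pow_le_pow_right₀ hK1 ?_
  calc _ ≤ (Finset.range Q).card := Finset.card_le_card (fun p hp => Finset.mem_range.mpr (Finset.mem_filter.mp hp).2)
    _ = Q := Finset.card_range Q

lemma par_count {P : ℕ} [NeZero P] {ι : Type*} (s : Finset ι) (v : ι → ZMod P) :
    ∑ x : ZMod P, ‖∑ n ∈ s, ZMod.stdAddChar (x * v n)‖^2 = P * (((s ×ˢ s).filter (fun p => v p.1 = v p.2)).card : ℝ) := by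
  have := parseval' s (fun _ => 1) v
  simp only [one_mul] at this
  rw [this]; congr 1
  have e : ((s ×ˢ s).filter (fun p => v p.1 = v p.2)).card = ∑ t, ((s.filter (fun n => v n = t)).card)^2 := by
    rw [Finset.card_eq_sum_card_fiberwise (f := fun p => v p.1) (t := Finset.univ) (fun _ _ => Finset.mem_univ _)]
    refine Finset.sum_congr rfl fun t _ => ?_
    rw [sq, ← Finset.card_product]
    congr 1
    ext p
    simp only [Finset.mem_filter, Finset.mem_product]
    constructor
    · rintro ⟨⟨⟨h1, h2⟩, h3⟩, h4⟩; exact ⟨⟨h1, h4⟩, h2, by rw [← h3, h4]⟩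
    · rintro ⟨⟨h1, h4⟩, h2, h3⟩; exact ⟨⟨⟨h1, h2⟩, by rw [h3, h4]⟩, h4⟩
  rw [e]
  push_cast
  refine Finset.sum_congr rfl fun t _ => ?_
  simp

lemma par_mono {P : ℕ} [NeZero P] {ι : Type*} {s s' : Finset ι} (h : s ⊆ s') (v : ι → ZMod P) :
    ∑ x : ZMod P, ‖∑ n ∈ s, ZMod.stdAddChar (x * v n)‖^2 ≤ ∑ x : ZMod P, ‖∑ n ∈ s', ZMod.stdAddChar (x * v n)‖^2 := by
  rw [par_count, par_count]
  gcongr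

def fA (P k : ℕ) [NeZero P] (A : Finset ℕ) (α : ZMod P) : ℂ := ∑ n ∈ A, ZMod.stdAddChar (α * (n:ZMod P)^k)

lemma fA_pow {P k m : ℕ} [NeZero P] (A : Finset ℕ) (α : ZMod P) :
    fA P k A α ^ m = ∑ y ∈ Fintype.piFinset (fun _ : Fin m => A), ZMod.stdAddChar (α * ∑ i, (y i : ZMod P)^k) := by
  unfold fA
  rw [Finset.sum_pow']
  refine Finset.sum_congr rfl fun y _ => ?_
  rw [Finset.mul_sum, std_sum]

lemma fA_norm_le {P k : ℕ} [NeZero P] (A : Finset ℕ) (α : ZMod P) : ‖fA P k A α‖ ≤ A.card := by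
  unfold fA
  refine (norm_sum_le _ _).trans ?_
  simp [norm_std]

lemma fA_mono {P k : ℕ} [NeZero P] {A B : Finset ℕ} (h : A ⊆ B) (a b : ℕ) :
    ∑ α : ZMod P, ‖fA P k A α‖^(2*(a+b)) ≤ ∑ α : ZMod P, ‖fA P k A α‖^(2*a) * ‖fA P k B α‖^(2*b) := by
  have key : ∀ (D : Finset ℕ) (α : ZMod P), ‖fA P k A α‖^(2*a) * ‖fA P k D α‖^(2*b) =
      ‖∑ p ∈ (Fintype.piFinset (fun _ : Fin a => A)) ×ˢ (Fintype.piFinset (fun _ : Fin b => D)),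
        ZMod.stdAddChar (α * (∑ i, (p.1 i : ZMod P)^k + ∑ i, (p.2 i : ZMod P)^k))‖^2 := by
    intro D α
    rw [mul_comm 2 a, mul_comm 2 b, pow_mul, pow_mul, ← mul_pow, ← norm_pow, ← norm_pow, ← norm_mul, fA_pow, fA_pow,
      Finset.sum_mul_sum, ← Finset.sum_product']
    congr 2
    refine Finset.sum_congr rfl fun p _ => ?_
    rw [mul_add, AddChar.map_add_eq_mul]
  calc _ = ∑ α : ZMod P, ‖fA P k A α‖^(2*a) * ‖fA P k A α‖^(2*b) := by
        refine Finset.sum_congr rfl fun α _ => ?_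
        rw [← pow_add]; congr 1; ring
    _ ≤ _ := by
        simp_rw [key]
        apply par_mono (v := fun p : (Fin a → ℕ) × (Fin b → ℕ) => ∑ i, (p.1 i : ZMod P)^k + ∑ i, (p.2 i : ZMod P)^k)
        exact Finset.product_subset_product le_rfl (Fintype.piFinset_subset _ _ fun _ => h)

lemma pow_diff_lt (a b δ : ℕ) (hab : a < b) (hδ : 0 < δ) (n : ℕ) : 
    (a+δ)^(n+2) + b^(n+2) < (b+δ)^(n+2) + a^(n+2) := by
  have weak : ∀ n : ℕ, (a+δ)^(n+1) + b^(n+1) ≤ (b+δ)^(n+1) + a^(n+1) → (a+δ)^(n+2) + b^(n+2) < (b+δ)^(n+2) + a^(n+2) := by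
    intro n h
    have h1 : (a+δ)^(n+1) < (b+δ)^(n+1) := Nat.pow_lt_pow_left (by omega) (by omega)
    have h2 : a^(n+1) ≤ (a+δ)^(n+1) := Nat.pow_le_pow_left (by omega) _
    have e1 : (a+δ)^(n+2) = (a+δ)*(a+δ)^(n+1) := by ring
    have e2 : (b+δ)^(n+2) = (b+δ)*(b+δ)^(n+1) := by ring
    have e3 : a^(n+2) = a*a^(n+1) := by ring
    have e4 : b^(n+2) = b*b^(n+1) := by ring
    rw [e1, e2, e3, e4]
    generalize (a+δ)^(n+1) = A at *
    generalize (b+δ)^(n+1) = B at *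
    generalize a^(n+1) = A0 at *
    generalize b^(n+1) = B0 at *
    zify at *
    have h3 : (a:ℤ) * (A - A0) ≤ b * (B - B0) := by
      calc (a:ℤ) * (A - A0) ≤ b * (A - A0) := mul_le_mul_of_nonneg_right hab.le (by linarith)
        _ ≤ _ := mul_le_mul_of_nonneg_left (by linarith) (by positivity)
    have h4 : (δ:ℤ) * A < δ * B := by gcongr
    linarith
  induction n with
  | zero => exact weak 0 (by simp; omega)
  | succ n ih => exact weak (n+1) ih.le

lemma pair_count (k X n : ℕ) (hk : 2 ≤ k) (hn : 1 ≤ n) (A : Finset ℕ) :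
    ((A ×ˢ A).filter (fun p => p.1^k = p.2^k + n)).card ≤ n.divisors.card := by
  have hlt : ∀ x y : ℕ, x^k = y^k + n → y < x := by
    intro x y h
    by_contra hc
    have := Nat.pow_le_pow_left (not_lt.mp hc) k
    omega
  refine Finset.card_le_card_of_injOn (fun p => p.1 - p.2) ?_ ?_
  · rintro ⟨x, y⟩ hp
    have h := (Finset.mem_filter.mp (Finset.mem_coe.mp hp)).2
    simp only at h
    rw [Finset.mem_coe, Nat.mem_divisors]
    refine ⟨?_, by omega⟩
    have := Nat.sub_dvd_pow_sub_pow x y k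
    rwa [h, Nat.add_sub_cancel_left] at this
  · rintro ⟨x, y⟩ hp ⟨x', y'⟩ hp' he
    have h := (Finset.mem_filter.mp (Finset.mem_coe.mp hp)).2
    have h' := (Finset.mem_filter.mp (Finset.mem_coe.mp hp')).2
    simp only at h h' he
    have l1 := hlt _ _ h
    have l2 := hlt _ _ h'
    obtain ⟨δ, rfl⟩ := Nat.exists_eq_add_of_lt l1
    have hx' : x' = y' + (δ + 1) := by omega
    subst hx'
    obtain ⟨m, rfl⟩ := Nat.exists_eq_add_of_le hk
    rw [add_comm 2 m] at h h'
    rw [show y + δ + 1 = y + (δ+1) by ring] at h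
    have : y = y' := by
      rcases lt_trichotomy y y' with hc | hc | hc
      · have := pow_diff_lt y y' (δ+1) hc (by omega) m; omega
      · exact hc
      · have := pow_diff_lt y' y (δ+1) hc (by omega) m; omega
    subst this; rfl

lemma quad_count (k X D : ℕ) (hk : 2 ≤ k) (A : Finset ℕ) (hA : A ⊆ Finset.Icc 1 X)
    (hD : ∀ n, 1 ≤ n → n ≤ X^k → n.divisors.card ≤ D) :
    (((A ×ˢ A) ×ˢ (A ×ˢ A)).filter (fun p => p.1.1^k + p.1.2^k = p.2.1^k + p.2.2^k)).card ≤ A.card^2 * (D + 1) := by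
  have hX : ∀ a ∈ A, a^k ≤ X^k := fun a ha => Nat.pow_le_pow_left (Finset.mem_Icc.mp (hA ha)).2 k
  rw [Finset.card_eq_sum_card_fiberwise (f := fun p => (p.1.1, p.2.1)) (t := A ×ˢ A) (by
    intro p hp
    have := (Finset.mem_filter.mp (Finset.mem_coe.mp hp)).1
    simp only [Finset.mem_product] at this
    exact Finset.mem_coe.mpr (Finset.mem_product.mpr ⟨this.1.1, this.2.1⟩))]
  have inner : ∀ q ∈ A ×ˢ A, ((((A ×ˢ A) ×ˢ (A ×ˢ A)).filter (fun p => p.1.1^k + p.1.2^k = p.2.1^k + p.2.2^k)).filter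
      (fun p => (p.1.1, p.2.1) = q)).card ≤ if q.1 = q.2 then A.card else D := by
    rintro ⟨a, b⟩ hq
    rw [Finset.mem_product] at hq
    simp only at hq
    have ha := hX a hq.1
    have hb := hX b hq.2
    split_ifs with h
    · simp only at h
      subst h
      refine Finset.card_le_card_of_injOn (fun p => p.1.2) ?_ ?_
      · intro p hp
        simp only [Finset.coe_filter, Finset.mem_filter, Finset.mem_product, Set.mem_setOf_eq] at hp
        exact hp.1.1.1.2
      · rintro ⟨⟨p1, p2⟩, p3, p4⟩ hp ⟨⟨r1, r2⟩, r3, r4⟩ hr he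
        simp only [Finset.coe_filter, Finset.mem_filter, Finset.mem_product, Set.mem_setOf_eq, Prod.mk.injEq] at hp hr he
        obtain ⟨⟨_, e1⟩, rfl, rfl⟩ := hp
        obtain ⟨⟨_, e2⟩, rfl, rfl⟩ := hr
        subst he
        have i1 : p2 = p4 := Nat.pow_left_injective (n := k) (by omega) (by simp only; omega)
        have i2 : p2 = r4 := Nat.pow_left_injective (n := k) (by omega) (by simp only; omega)
        subst i1; subst i2; rfl
    · simp only at h
      rcases lt_or_gt_of_ne h with hc | hc
      · have hl : a^k < b^k := Nat.pow_lt_pow_left hc (by omega)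
        refine le_trans ?_ ((pair_count k X (b^k - a^k) hk (by omega) A).trans (hD _ (by omega) (by omega)))
        refine Finset.card_le_card_of_injOn (fun p => (p.1.2, p.2.2)) ?_ ?_
        · intro p hp
          simp only [Finset.coe_filter, Finset.mem_filter, Finset.mem_product, Set.mem_setOf_eq, Prod.mk.injEq] at hp ⊢
          obtain ⟨⟨hh, e1⟩, f1, f2⟩ := hp
          rw [f1, f2] at e1
          exact ⟨⟨hh.1.2, hh.2.2⟩, by omega⟩
        · rintro ⟨⟨p1, p2⟩, p3, p4⟩ hp ⟨⟨r1, r2⟩, r3, r4⟩ hr he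
          simp only [Finset.coe_filter, Finset.mem_filter, Finset.mem_product, Set.mem_setOf_eq, Prod.mk.injEq] at hp hr he ⊢
          omega
      · have hl : b^k < a^k := Nat.pow_lt_pow_left hc (by omega)
        refine le_trans ?_ ((pair_count k X (a^k - b^k) hk (by omega) A).trans (hD _ (by omega) (by omega)))
        refine Finset.card_le_card_of_injOn (fun p => (p.2.2, p.1.2)) ?_ ?_
        · intro p hp
          simp only [Finset.coe_filter, Finset.mem_filter, Finset.mem_product, Set.mem_setOf_eq, Prod.mk.injEq] at hp ⊢
          obtain ⟨⟨hh, e1⟩, f1, f2⟩ := hp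
          rw [f1, f2] at e1
          exact ⟨⟨hh.2.2, hh.1.2⟩, by omega⟩
        · rintro ⟨⟨p1, p2⟩, p3, p4⟩ hp ⟨⟨r1, r2⟩, r3, r4⟩ hr he
          simp only [Finset.coe_filter, Finset.mem_filter, Finset.mem_product, Set.mem_setOf_eq, Prod.mk.injEq] at hp hr he ⊢
          omega
  refine (Finset.sum_le_sum inner).trans ?_
  rw [Finset.sum_product]
  calc _ ≤ ∑ a ∈ A, (A.card + A.card * D) := by
        refine Finset.sum_le_sum fun a ha => ?_
        rw [← Finset.add_sum_erase A _ ha]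
        simp only [if_true]
        gcongr
        calc _ ≤ ∑ b ∈ A.erase a, D := by
              refine Finset.sum_le_sum fun b hb => ?_
              rw [if_neg (Finset.ne_of_mem_erase hb).symm]
          _ ≤ _ := by
              rw [Finset.sum_const, smul_eq_mul]
              exact Nat.mul_le_mul_right _ (Finset.card_erase_le)
    _ = _ := by rw [Finset.sum_const, smul_eq_mul]; ring

lemma L4 (k : ℕ) (hk : 2 ≤ k) (ε : ℝ) (hε : 0 < ε) : ∃ C : ℝ, 1 ≤ C ∧ ∀ (X P : ℕ) (_ : NeZero P), 1 ≤ X → 2 * X^k < P →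
    ∀ A ⊆ Finset.Icc 1 X, ∑ α : ZMod P, ‖fA P k A α‖^4 ≤ C * P * ((A.card:ℝ)^2 * (X:ℝ)^ε) := by
  obtain ⟨C, hC, hdiv⟩ := div_bound (ε/k) (by positivity)
  refine ⟨C + 1, by linarith, fun X P _ hX hP A hA => ?_⟩
  have hX' : (1:ℝ) ≤ X := by exact_mod_cast hX
  have hXe : (1:ℝ) ≤ (X:ℝ)^ε := Real.one_le_rpow hX' hε.le
  set D : ℕ := ⌊C * (X:ℝ)^ε⌋₊ with hDdef
  have hD : ∀ n, 1 ≤ n → n ≤ X^k → n.divisors.card ≤ D := by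
    intro n h1 h2
    apply Nat.le_floor
    refine (hdiv n h1).trans ?_
    have : (n:ℝ)^(ε/k) ≤ (X:ℝ)^ε := by
      calc (n:ℝ)^(ε/k) ≤ ((X:ℝ)^k)^(ε/k) := by
            gcongr; exact_mod_cast h2
        _ = _ := by
            rw [← Real.rpow_natCast, ← Real.rpow_mul (by linarith)]; congr 1; field_simp
    gcongr
  have hq := quad_count k X D hk A hA hD
  have e1 : ∀ α : ZMod P, ‖fA P k A α‖^4 = ‖∑ p ∈ A ×ˢ A, ZMod.stdAddChar (α * ((p.1:ZMod P)^k + (p.2:ZMod P)^k))‖^2 := by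
    intro α
    rw [show 4 = 2*2 by norm_num, pow_mul, ← norm_pow]
    congr 2
    unfold fA
    rw [sq, Finset.sum_mul_sum, ← Finset.sum_product']
    refine Finset.sum_congr rfl fun p _ => ?_
    rw [mul_add, AddChar.map_add_eq_mul]
  simp_rw [e1]
  rw [par_count]
  have e2 : (((A ×ˢ A) ×ˢ (A ×ˢ A)).filter (fun p => ((p.1.1:ZMod P)^k + (p.1.2:ZMod P)^k) = ((p.2.1:ZMod P)^k + (p.2.2:ZMod P)^k))).card ≤ A.card^2 * (D + 1) := by
    refine le_trans (Finset.card_le_card ?_) hq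
    intro p hp
    rw [Finset.mem_filter] at hp ⊢
    refine ⟨hp.1, ?_⟩
    have h := hp.2
    have hm := hp.1
    simp only [Finset.mem_product] at hm
    have hb : ∀ a ∈ A, a^k ≤ X^k := fun a ha => Nat.pow_le_pow_left (Finset.mem_Icc.mp (hA ha)).2 k
    have b1 := hb _ hm.1.1
    have b2 := hb _ hm.1.2
    have b3 := hb _ hm.2.1
    have b4 := hb _ hm.2.2
    have h' : ((p.1.1^k + p.1.2^k : ℕ) : ZMod P) = ((p.2.1^k + p.2.2^k : ℕ) : ZMod P) := by push_cast; exact h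
    rw [ZMod.natCast_eq_natCast_iff', Nat.mod_eq_of_lt (by omega), Nat.mod_eq_of_lt (by omega)] at h'
    exact h'
  have e3 : ((((A ×ˢ A) ×ˢ (A ×ˢ A)).filter (fun p => ((p.1.1:ZMod P)^k + (p.1.2:ZMod P)^k) = ((p.2.1:ZMod P)^k + (p.2.2:ZMod P)^k))).card : ℝ) ≤ (A.card:ℝ)^2 * (D + 1) := by
    exact_mod_cast e2
  have hDr : (D:ℝ) ≤ C * (X:ℝ)^ε := Nat.floor_le (by positivity)
  calc _ ≤ (P:ℝ) * ((A.card:ℝ)^2 * (D + 1)) := by gcongr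
    _ ≤ (P:ℝ) * ((A.card:ℝ)^2 * ((C+1) * (X:ℝ)^ε)) := by gcongr; linarith
    _ = _ := by ring

lemma maj_pt {u l : ℝ} {t n : ℕ} (h0 : 0 ≤ u) (h1 : u ≤ 1) (hl : 0 < l) (hn : n ≤ 3*t) : u^(2*t) ≤ u^n / l + l^2 := by
  rcases le_or_gt (u^t) l with h | h
  · have : u^(2*t) ≤ l^2 := by
      rw [mul_comm, pow_mul]; gcongr
    have h2 : 0 ≤ u^n / l := by positivity
    linarith
  · have : u^(2*t) ≤ u^n / l := by
      rw [le_div_iff₀ hl]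
      calc u^(2*t) * l ≤ u^(2*t) * u^t := by gcongr
        _ = u^(3*t) := by rw [← pow_add]; congr 1; ring
        _ ≤ u^n := pow_le_pow_of_le_one h0 h1 hn
    nlinarith

lemma min_pt {u w : ℝ} {S n : ℕ} (h0 : 0 ≤ u) (hw : 0 < w) (hS : 4 ≤ S) (hn : S ≤ n) : u^S ≤ w^(S-4) * u^4 + u^n / w^(n-S) := by
  rcases le_or_gt u w with h | h
  · have : u^S ≤ w^(S-4) * u^4 := by
      calc u^S = u^(S-4) * u^4 := by rw [← pow_add]; congr 1; omega
        _ ≤ _ := by gcongr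
    have h2 : 0 ≤ u^n / w^(n-S) := by positivity
    linarith
  · have : u^S ≤ u^n / w^(n-S) := by
      rw [le_div_iff₀ (by positivity)]
      calc u^S * w^(n-S) ≤ u^S * u^(n-S) := by gcongr
        _ = u^n := by rw [← pow_add]; congr 1; omega
    have h2 : 0 ≤ w^(S-4) * u^4 := by positivity
    linarith

lemma comb_pt {a b : ℝ} {s : ℕ} (ha : 0 ≤ a) (hb : 0 ≤ b) (hs : 2 ≤ s) : a^(2*1) * b^(2*(s-1)) ≤ a^(2*s) / 2 + 4 * b^(2*s) := by
  obtain ⟨m, rfl⟩ := Nat.exists_eq_add_of_le hs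
  rw [show 2 + m - 1 = m+1 by omega]
  rcases le_or_gt (2*b) a with h | h
  · have h1 : b^(2*(m+1)) ≤ a^(2*(m+1)) / 2 := by
      have h2 : (2*b)^(2*(m+1)) ≤ a^(2*(m+1)) := by gcongr
      rw [mul_pow] at h2
      have h3 : (2:ℝ) ≤ 2^(2*(m+1)) := by
        calc (2:ℝ) = 2^1 := by norm_num
          _ ≤ _ := pow_le_pow_right₀ (by norm_num) (by omega)
      have h4 : 0 ≤ b^(2*(m+1)) := by positivity
      nlinarith
    have h5 : 0 ≤ b^(2*(2+m)) := by positivity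
    have e : a^(2*(2+m)) = a^(2*1) * a^(2*(m+1)) := by rw [← pow_add]; congr 1; ring
    rw [e]
    have h6 : 0 ≤ a^(2*1) := by positivity
    nlinarith
  · have h1 : a^(2*1) ≤ (2*b)^(2*1) := by gcongr
    have e : b^(2*(2+m)) = b^(2*1) * b^(2*(m+1)) := by rw [← pow_add]; congr 1; ring
    have h4 : 0 ≤ b^(2*(m+1)) := by positivity
    have h5 : 0 ≤ a^(2*(2+m)) := by positivity
    rw [e]
    have := mul_le_mul_of_nonneg_right h1 h4
    rw [mul_pow, show (2:ℝ)^(2*1) = 4 by norm_num, mul_assoc (4:ℝ)] at this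
    generalize a ^ (2 * (2 + m)) = p at *
    generalize a ^ (2 * 1) * b ^ (2 * (m + 1)) = q at *
    generalize b ^ (2 * 1) * b ^ (2 * (m + 1)) = t at *
    linarith

lemma hT1_aux {a m M y z w K p q : ℝ} (ha : 0 ≤ a) (hm : 0 ≤ m) (hK : 0 ≤ K) (hp : 0 ≤ p) (hw : 0 < w)
    (hM : M ≤ K * p * y / w) (h2 : a * y ≤ 4 * z) (hq : q = z * m) :
    a * (m * M) ≤ 4 * K * p * (q / w) := by
  have e1 : a * (m * M) ≤ a * (m * (K * p * y / w)) := by gcongr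
  have e2 : a * (m * (K * p * y / w)) = (a * y) * (m * (K * p / w)) := by ring
  have e3 : (a * y) * (m * (K * p / w)) ≤ (4*z) * (m * (K * p / w)) := by gcongr
  rw [hq]
  calc _ ≤ _ := e1
    _ = _ := e2
    _ ≤ _ := e3
    _ = _ := by ring

def Good (k s : ℕ) (c : ℝ) : Prop := ∃ C : ℝ, 1 ≤ C ∧ ∀ X : ℕ, 1 ≤ X → ∀ A ⊆ Finset.Icc 1 X, (A.card:ℝ) ≤ 2 * (X:ℝ)^(1/c) →
    ∃ (P : ℕ) (_ : NeZero P), ∑ α : ZMod P, ‖fA P k A α‖^(2*s) ≤ C * P * ((X:ℝ)^(2*s) / (X:ℝ)^k)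

lemma exps (k s : ℕ) (hk : 4 ≤ k) (hs : s = k^2/2) : 2*hh k ≤ 3*(s-1) ∧ 4 ≤ 2*s ∧ 2*s ≤ 2*hh k ∧ 2*hh k - 2*s ≤ k+1 ∧
    (k-2:ℝ) + 1/(2*k+3) ≤ (2/(2*k+3)) * ((2*s-4 : ℕ):ℝ) := by
  have h1 := two_hh k
  have h2 : k^2 ≤ 2*s+1 := by omega
  have h3 : 2*s ≤ k^2 := by omega
  rw [h1]
  have h16 : 16 ≤ k^2 := by nlinarith
  have hk1 : k*(k+1) = k^2+k := by ring
  have hlow : k + 2 * s ≥ 2 * hh k - 1 := by omega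
  refine ⟨?_, by omega, by omega, by omega, ?_⟩
  · rcases Nat.lt_or_ge k 6 with h | h
    · have : k = 4 ∨ k = 5 := by omega
      rcases this with rfl | rfl <;> norm_num at hs <;> omega
    · have : 6*k ≤ k^2 := by nlinarith
      omega
  · have hc : ((2*s-4 : ℕ):ℝ) = 2*s-4 := by rw [Nat.cast_sub (by omega)]; push_cast; ring
    rw [hc, div_mul_eq_mul_div, ← sub_nonneg]
    have hk0 : (4:ℝ) ≤ k := by exact_mod_cast hk
    have key : (2*(k:ℝ)^2 - k - 5) ≤ 2*(2*s-4) := by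
      rcases Nat.lt_or_ge k 5 with h | h
      · have : k = 4 := by omega
        subst this; norm_num at hs; rw [hs]; norm_num
      · have e1 : (k:ℝ)^2 ≤ 2*s+1 := by exact_mod_cast h2
        have e2 : (5:ℝ) ≤ k := by exact_mod_cast h
        linarith
    have : 2*(2*(s:ℝ)-4)/(2*k+3) - ((k:ℝ)-2 + 1/(2*k+3)) = (2*(2*s-4) - (2*(k:ℝ)^2 - k - 5))/(2*k+3) := by
      field_simp; ring
    rw [this]
    apply div_nonneg <;> linarith

set_option maxHeartbeats 1000000 in
lemma W4 (κ s : ℕ) (hκ : 2 ≤ κ) (hs : s = (κ+2)^2/2) (c : ℝ) (hc : 1 < c) : Good (κ+2) s c := by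
  set k := κ+2 with hk
  obtain ⟨x1, x2, x3, x4, x5⟩ := exps k s (by omega) hs
  have hkr : ((k:ℕ):ℝ) = κ + 2 := by rw [hk]; push_cast; ring
  set h := hh k with hh_def
  have h2h : 2 * h = k * (k+1) := two_hh k
  set δ : ℝ := 2 - 2/c with hδ
  have hδ0 : 0 < δ := by
    have : 2/c < 2 := by rw [div_lt_iff₀ (by linarith)]; linarith
    linarith
  set e1 : ℝ := 1/(2*k+3) with he1
  have he10 : 0 < e1 := by positivity
  set w : ℝ := 2/(2*k+3) with hw
  have hw0 : 0 < w := by positivity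
  have hwe : w * (k+1) + e1 = 1 := by rw [hw, he1]; field_simp; ring
  obtain ⟨C1, hC1, hmv⟩ := MV κ (by omega) (min δ e1) (lt_min hδ0 he10)
  obtain ⟨C2, hC2, hl4⟩ := L4 k (by omega) e1 he10
  obtain ⟨C3, hC3, hlog⟩ := logb 1 1 δ 2 hδ0 (by norm_num)
  refine ⟨8*(C1+48*C3) + 8*(C1+C2), by linarith, fun X hX A hA hcard => ?_⟩
  obtain ⟨P, H, inst, hcop, hP2, hPC, hXH, hXk, hXHP, hmain⟩ := hmv X hX
  refine ⟨P, inst, ?_⟩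
  have hX' : (1:ℝ) ≤ X := by exact_mod_cast hX
  have hX0 : (0:ℝ) < X := by linarith
  have hP0 : (0:ℝ) < P := by exact_mod_cast NeZero.pos P
  rw [← hk, ← hh_def] at hmain
  set r : ZMod P → ℕ := fun α => rB P X H (α * (-((k : ℕ):ZMod P))) with hr
  set u : ZMod P → ℝ := fun α => ‖fA P k (Finset.Icc 1 X) α‖ / X with hu
  have hu0 : ∀ α, 0 ≤ u α := fun α => by positivity
  have hu1 : ∀ α, u α ≤ 1 := fun α => by
    rw [hu]; simp only
    rw [div_le_one hX0]
    have := fA_norm_le (P := P) (k := k) (Finset.Icc 1 X) α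
    simpa using this
  have hFu : ∀ α, ‖fA P k (Finset.Icc 1 X) α‖ = X * u α := fun α => by rw [hu]; field_simp
  have hXd : (X:ℝ)^(min δ e1) ≤ (X:ℝ)^δ := Real.rpow_le_rpow_of_exponent_le hX' (min_le_left _ _)
  have hXe : (X:ℝ)^(min δ e1) ≤ (X:ℝ)^e1 := Real.rpow_le_rpow_of_exponent_le hX' (min_le_right _ _)
  have m1 : ∑ α, u α^(2*h) / (1 + (r α : ℝ)) ≤ C1 * P * (X:ℝ)^(min δ e1) / (X:ℝ)^(k+1) := by
    have hf : ∀ α, fX P k X α = fA P k (Finset.Icc 1 X) α := fun α => rfl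
    simp_rw [hf, hFu, mul_pow, mul_div_assoc] at hmain
    rw [← Finset.mul_sum] at hmain
    have hXe2 : (X:ℝ)^(2*h) = (X:ℝ)^(k^2-1) * (X:ℝ)^(k+1) := by
      rw [← pow_add]; congr 1
      have : 1 ≤ k^2 := Nat.one_le_iff_ne_zero.mpr (by positivity)
      have hk1 : k*(k+1) = k^2+k := by ring
      omega
    rw [le_div_iff₀ (by positivity)]
    rw [hXe2] at hmain
    have hpp : (0:ℝ) < (X:ℝ)^(k^2-1) := by positivity
    refine le_of_mul_le_mul_left ?_ hpp
    calc _ = (X:ℝ)^(k^2-1) * (X:ℝ)^(k+1) * ∑ α, u α^(2*h) / (1 + (r α : ℝ)) := by ring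
      _ ≤ _ := hmain
      _ = _ := by ring
  have m2 : ∑ α, (r α : ℝ)^2 ≤ 12 * P * (C3 * (X:ℝ)^δ) * X^2 / (X:ℝ)^k := by
    have hb : ∑ α, (r α : ℝ)^2 = ∑ β : ZMod P, (rB P X H β : ℝ)^2 := by
      have : IsUnit (-((k : ℕ):ZMod P)) := by
        rw [IsUnit.neg_iff]; exact (ZMod.isUnit_iff_coprime k P).mpr hcop.symm
      obtain ⟨v, hv⟩ := this
      rw [hr, ← hv]
      exact Equiv.sum_comp (Units.mulRight v) (fun β => (rB P X H β : ℝ)^2)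
    rw [hb, le_div_iff₀ (by positivity)]
    have hm := rB_moment (P := P) hXH hXHP
    have hl := hlog X X hX' hX0.le (by rw [pow_one]; linarith)
    rw [pow_one] at hl
    have hl2 : 1 + Real.log X ≤ C3 * (X:ℝ)^δ := by
      refine le_trans ?_ hl
      have := Real.log_le_log hX0 (show (X:ℝ) ≤ X + 1 by linarith)
      linarith
    have hH' : (X:ℝ)^(κ+1) ≤ H := by exact_mod_cast hXk
    have hS0 : 0 ≤ ∑ β : ZMod P, (rB P X H β : ℝ)^2 := by positivity
    calc _ = X * ((X:ℝ)^(κ+1) * ∑ β : ZMod P, (rB P X H β : ℝ)^2) := by rw [hk]; ring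
      _ ≤ X * (H * ∑ β : ZMod P, (rB P X H β : ℝ)^2) := by gcongr
      _ ≤ X * (12 * X * P * (1 + Real.log X)) := by gcongr
      _ ≤ X * (12 * X * P * (C3 * (X:ℝ)^δ)) := by gcongr
      _ = _ := by ring
  set Mj := ∑ α ∈ Finset.univ.filter (fun α => 1 ≤ r α), u α^(2*(s-1)) with hMj
  set Mn := ∑ α ∈ Finset.univ.filter (fun α => ¬ 1 ≤ r α), u α^(2*s) with hMn
  have hMjb : Mj ≤ (C1 + 48*C3) * P * (X:ℝ)^δ / (X:ℝ)^k := by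
    calc Mj ≤ ∑ α ∈ Finset.univ.filter (fun α => 1 ≤ r α), (X * (u α^(2*h) / (1 + (r α : ℝ))) + 4/X^2 * (r α:ℝ)^2) := by
          refine Finset.sum_le_sum fun α hα => ?_
          have hα1 : (1:ℝ) ≤ r α := by exact_mod_cast (Finset.mem_filter.mp hα).2
          have := maj_pt (u := u α) (l := (1 + (r α:ℝ))/X) (t := s-1) (n := 2*h) (hu0 α) (hu1 α) (by positivity) x1
          refine this.trans ?_
          apply add_le_add
          · apply le_of_eq; field_simp
          · rw [div_pow, div_mul_eq_mul_div]
            gcongr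
            nlinarith
      _ ≤ ∑ α, (X * (u α^(2*h) / (1 + (r α : ℝ))) + 4/X^2 * (r α:ℝ)^2) :=
          Finset.sum_le_sum_of_subset_of_nonneg (Finset.filter_subset _ _) (fun α _ _ => by have := hu0 α; positivity)
      _ = X * ∑ α, (u α^(2*h) / (1 + (r α : ℝ))) + 4/X^2 * ∑ α, (r α:ℝ)^2 := by
          rw [Finset.sum_add_distrib, Finset.mul_sum, Finset.mul_sum]
      _ ≤ X * (C1 * P * (X:ℝ)^δ / (X:ℝ)^(k+1)) + 4/X^2 * (12 * P * (C3 * (X:ℝ)^δ) * X^2 / (X:ℝ)^k) := by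
          gcongr
          refine m1.trans ?_
          gcongr
      _ = _ := by
          rw [pow_succ]; field_simp; ring
  set ω : ℝ := (X:ℝ)^(-w) with hω
  have hω0 : 0 < ω := Real.rpow_pos_of_pos hX0 _
  have hl4' := hl4 X P inst hX hP2 (Finset.Icc 1 X) le_rfl
  have m3 : ∑ α, u α^4 ≤ C2 * P * (X:ℝ)^e1 / (X:ℝ)^2 := by
    simp_rw [hFu, mul_pow] at hl4'
    rw [← Finset.mul_sum] at hl4'
    rw [le_div_iff₀ (by positivity)]
    simp only [Nat.card_Icc, Nat.add_sub_cancel] at hl4'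
    refine le_of_mul_le_mul_left ?_ (show (0:ℝ) < (X:ℝ)^2 by positivity)
    calc _ = (X:ℝ)^4 * ∑ α, u α^4 := by ring
      _ ≤ _ := hl4'
      _ = _ := by ring
  have hω1 : ω^(2*s-4) * (X:ℝ)^e1 / (X:ℝ)^2 ≤ 1 / (X:ℝ)^k := by
    rw [div_le_div_iff₀ (by positivity) (by positivity), one_mul, hω, ← Real.rpow_natCast, ← Real.rpow_mul hX0.le,
      ← Real.rpow_add hX0, ← Real.rpow_natCast, ← Real.rpow_add hX0, ← Real.rpow_natCast]
    refine Real.rpow_le_rpow_of_exponent_le hX' ?_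
    push_cast
    linarith
  have hω2 : (X:ℝ)^e1 / (X:ℝ)^(k+1) / ω^(2*h-2*s) ≤ 1 / (X:ℝ)^k := by
    rw [div_div, div_le_div_iff₀ (by positivity) (by positivity), one_mul, hω, ← Real.rpow_natCast, ← Real.rpow_natCast, ← Real.rpow_natCast, ← Real.rpow_mul hX0.le,
      ← Real.rpow_add hX0, ← Real.rpow_add hX0]
    refine Real.rpow_le_rpow_of_exponent_le hX' ?_
    have : ((2*h-2*s : ℕ):ℝ) ≤ k+1 := by exact_mod_cast x4
    have := mul_le_mul_of_nonneg_left this hw0.le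
    push_cast
    linarith
  have hMnb : Mn ≤ (C1 + C2) * P / (X:ℝ)^k := by
    calc Mn ≤ ∑ α ∈ Finset.univ.filter (fun α => ¬ 1 ≤ r α), (ω^(2*s-4) * u α^4 + 1/ω^(2*h-2*s) * (u α^(2*h) / (1 + (r α : ℝ)))) := by
          refine Finset.sum_le_sum fun α hα => ?_
          have hα0 : r α = 0 := by
            have := (Finset.mem_filter.mp hα).2; omega
          rw [hα0]
          have := min_pt (u := u α) (w := ω) (S := 2*s) (n := 2*h) (hu0 α) hω0 x2 x3
          refine this.trans (le_of_eq ?_)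
          simp only [Nat.cast_zero, add_zero, div_one]; ring
      _ ≤ ∑ α, (ω^(2*s-4) * u α^4 + 1/ω^(2*h-2*s) * (u α^(2*h) / (1 + (r α : ℝ)))) :=
          Finset.sum_le_sum_of_subset_of_nonneg (Finset.filter_subset _ _) (fun α _ _ => by have := hu0 α; positivity)
      _ = ω^(2*s-4) * ∑ α, u α^4 + 1/ω^(2*h-2*s) * ∑ α, (u α^(2*h) / (1 + (r α : ℝ))) := by
          rw [Finset.sum_add_distrib, Finset.mul_sum, Finset.mul_sum]
      _ ≤ ω^(2*s-4) * (C2 * P * (X:ℝ)^e1 / (X:ℝ)^2) + 1/ω^(2*h-2*s) * (C1 * P * (X:ℝ)^e1 / (X:ℝ)^(k+1)) := by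
          gcongr
          refine m1.trans ?_
          gcongr
      _ = C2 * P * (ω^(2*s-4) * (X:ℝ)^e1 / (X:ℝ)^2) + C1 * P * ((X:ℝ)^e1 / (X:ℝ)^(k+1) / ω^(2*h-2*s)) := by
          field_simp
      _ ≤ C2 * P * (1 / (X:ℝ)^k) + C1 * P * (1 / (X:ℝ)^k) := by gcongr
      _ = _ := by ring
  set J := ∑ α : ZMod P, ‖fA P k A α‖^(2*s) with hJ
  have hs2 : 2 ≤ s := by omega
  have hJ1 : J ≤ ∑ α : ZMod P, ‖fA P k A α‖^(2*1) * ‖fA P k (Finset.Icc 1 X) α‖^(2*(s-1)) := by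
    have := fA_mono (P := P) (k := k) hA 1 (s-1)
    rwa [show 1 + (s-1) = s by omega] at this
  have hJ2 : J ≤ (A.card:ℝ)^2 * ((X:ℝ)^(2*(s-1)) * Mj) + (J/2 + 4 * ((X:ℝ)^(2*s) * Mn)) := by
    refine hJ1.trans ?_
    rw [← Finset.sum_filter_add_sum_filter_not Finset.univ (fun α => 1 ≤ r α)]
    apply add_le_add
    · rw [hMj, Finset.mul_sum, Finset.mul_sum]
      refine Finset.sum_le_sum fun α _ => ?_
      rw [hFu, mul_pow]
      have := fA_norm_le (P := P) (k := k) A α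
      have hu := hu0 α
      gcongr
    · rw [hMn, Finset.mul_sum, Finset.mul_sum]
      calc _ ≤ ∑ α ∈ Finset.univ.filter (fun α => ¬ 1 ≤ r α), (‖fA P k A α‖^(2*s)/2 + 4 * ((X:ℝ)^(2*s) * u α^(2*s))) := by
            refine Finset.sum_le_sum fun α _ => ?_
            refine (comb_pt (norm_nonneg _) (norm_nonneg _) hs2).trans (le_of_eq ?_)
            rw [hFu, mul_pow]
        _ ≤ _ := by
            rw [Finset.sum_add_distrib]
            refine add_le_add ?_ le_rfl
            rw [hJ, Finset.sum_div]
            exact Finset.sum_le_sum_of_subset_of_nonneg (Finset.filter_subset _ _) (fun α _ _ => by positivity)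
  have hA2 : (A.card:ℝ)^2 * (X:ℝ)^δ ≤ 4 * (X:ℝ)^2 := by
    have e : ((X:ℝ)^(1/c))^2 * (X:ℝ)^δ = (X:ℝ)^2 := by
      rw [← Real.rpow_natCast, ← Real.rpow_mul hX0.le, ← Real.rpow_add hX0, ← Real.rpow_natCast]
      congr 1; rw [hδ]; push_cast; ring
    calc _ ≤ (2 * (X:ℝ)^(1/c))^2 * (X:ℝ)^δ :=
          mul_le_mul_of_nonneg_right (pow_le_pow_left₀ (Nat.cast_nonneg _) hcard 2) (Real.rpow_nonneg hX0.le _)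
      _ = 4 * (((X:ℝ)^(1/c))^2 * (X:ℝ)^δ) := by ring
      _ = _ := by rw [e]
  have hT1 : (A.card:ℝ)^2 * ((X:ℝ)^(2*(s-1)) * Mj) ≤ 4 * (C1 + 48*C3) * P * ((X:ℝ)^(2*s) / (X:ℝ)^k) := by
    have e : (X:ℝ)^(2*s) = (X:ℝ)^2 * (X:ℝ)^(2*(s-1)) := by rw [← pow_add]; congr 1; omega
    exact hT1_aux (pow_nonneg (Nat.cast_nonneg _) _) (pow_nonneg hX0.le _) (by linarith) (Nat.cast_nonneg _) (pow_pos hX0 _) hMjb hA2 e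
  have hT2 : (X:ℝ)^(2*s) * Mn ≤ (C1 + C2) * P * ((X:ℝ)^(2*s) / (X:ℝ)^k) := by
    calc _ ≤ (X:ℝ)^(2*s) * ((C1 + C2) * P / (X:ℝ)^k) := by gcongr
      _ = _ := by ring
  have : (8*(C1+48*C3) + 8*(C1+C2)) * P * ((X:ℝ)^(2*s) / (X:ℝ)^k) = 2 * (4 * (C1 + 48*C3) * P * ((X:ℝ)^(2*s) / (X:ℝ)^k)) + 8 * ((C1 + C2) * P * ((X:ℝ)^(2*s) / (X:ℝ)^k)) := by ring
  rw [this]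
  linarith

lemma good2 (c : ℝ) (hc : 1 < c) : Good 2 2 c := by
  have hic : 1 / c < 1 := by rw [div_lt_one (by linarith)]; exact hc
  obtain ⟨C, hC, h⟩ := L4 2 le_rfl (2 - 2 * (1/c)) (by linarith)
  refine ⟨4 * C, by linarith, fun X hX A hA hcard => ⟨2 * X^2 + 1, ⟨by omega⟩, ?_⟩⟩
  have hX0 : (0:ℝ) < X := by exact_mod_cast hX
  have := h X (2 * X^2 + 1) ⟨by omega⟩ hX (by omega) A hA
  refine this.trans ?_
  have e : ((X:ℝ)^(1/c))^2 * (X:ℝ)^(2 - 2 * (1/c)) = (X:ℝ)^2 := by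
    rw [← Real.rpow_natCast, ← Real.rpow_mul hX0.le, ← Real.rpow_add hX0, ← Real.rpow_natCast]
    congr 1; push_cast; ring
  have e2 : (A.card:ℝ)^2 * (X:ℝ)^(2 - 2 * (1/c)) ≤ 4 * (X:ℝ)^2 := by
    calc _ ≤ (2 * (X:ℝ)^(1/c))^2 * (X:ℝ)^(2 - 2 * (1/c)) :=
          mul_le_mul_of_nonneg_right (pow_le_pow_left₀ (Nat.cast_nonneg _) hcard 2) (Real.rpow_nonneg hX0.le _)
      _ = 4 * (((X:ℝ)^(1/c))^2 * (X:ℝ)^(2 - 2 * (1/c))) := by ring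
      _ = _ := by rw [e]
  have e3 : (X:ℝ)^(2*2) / (X:ℝ)^2 = (X:ℝ)^2 := by field_simp
  rw [e3]
  calc _ ≤ C * ((2 * X^2 + 1 : ℕ):ℝ) * (4 * (X:ℝ)^2) := by gcongr
    _ = _ := by ring

def cubF (X : ℕ) (n : ℤ) : Finset ((ℕ × ℕ) × (ℕ × ℕ)) :=
  ((Finset.Icc 1 X ×ˢ Finset.Icc 1 X) ×ˢ (Finset.Icc 1 X ×ˢ Finset.Icc 1 X)).filter (fun z =>
    (z.1.1:ℤ) - z.1.2 = z.2.1 - z.2.2 ∧ (z.1.1:ℤ)^3 - (z.1.2:ℤ)^3 - ((z.2.1:ℤ)^3 - (z.2.2:ℤ)^3) = n)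

lemma cubF_id {a b a' b' n : ℤ} (h : a - b = a' - b') (h2 : a^3 - b^3 - (a'^3 - b'^3) = n) :
    3 * (a - b) * (b - b') * (a + b') = n := by
  have : a' = a - b + b' := by linarith
  rw [← h2, this]; ring

lemma cubF_zero (X : ℕ) : (cubF X 0).card ≤ 2 * X^2 := by
  have : cubF X 0 ⊆ (Finset.Icc 1 X ×ˢ Finset.Icc 1 X).image (fun p => ((p.1,p.1),(p.2,p.2))) ∪
      (Finset.Icc 1 X ×ˢ Finset.Icc 1 X).image (fun p => (p,p)) := by
    rintro ⟨⟨a,b⟩,⟨a',b'⟩⟩ hz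
    simp only [cubF, Finset.mem_filter, Finset.mem_product, Finset.mem_Icc] at hz
    obtain ⟨⟨⟨ha,hb⟩,⟨ha',hb'⟩⟩,h1,h2⟩ := hz
    have h3 := cubF_id h1 h2
    simp only [Finset.mem_union, Finset.mem_image, Finset.mem_product, Finset.mem_Icc, Prod.mk.injEq, Prod.exists]
    rcases mul_eq_zero.mp h3 with h4 | h4
    · rcases mul_eq_zero.mp h4 with h5 | h5
      · left; exact ⟨a, a', by omega, by omega⟩
      · right; exact ⟨a, b, by omega, by omega⟩
    · omega
  refine (Finset.card_le_card this).trans ((Finset.card_union_le _ _).trans ?_)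
  have h1 := Finset.card_image_le (s := (Finset.Icc 1 X ×ˢ Finset.Icc 1 X)) (f := fun p : ℕ × ℕ => ((p.1,p.1),(p.2,p.2)))
  have h2 := Finset.card_image_le (s := (Finset.Icc 1 X ×ˢ Finset.Icc 1 X)) (f := fun p : ℕ × ℕ => (p,p))
  rw [Finset.card_product, Nat.card_Icc] at h1 h2
  simp only [Nat.add_sub_cancel] at h1 h2
  have : X * X = X^2 := by ring
  omega

lemma cubF_ne (X D : ℕ) (n : ℤ) (hn : n ≠ 0) (hD : n.natAbs.divisors.card ≤ D) : (cubF X n).card ≤ 4 * D^2 := by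
  set Z : Finset ℤ := n.natAbs.divisors.image (fun m : ℕ => (m:ℤ)) ∪ n.natAbs.divisors.image (fun m : ℕ => -(m:ℤ)) with hZ
  have hZc : Z.card ≤ 2 * D := by
    refine (Finset.card_union_le _ _).trans ?_
    have h1 := Finset.card_image_le (s := n.natAbs.divisors) (f := fun m : ℕ => (m:ℤ))
    have h2 := Finset.card_image_le (s := n.natAbs.divisors) (f := fun m : ℕ => -(m:ℤ))
    omega
  have hZm : ∀ z : ℤ, z ∣ n → z ∈ Z := by
    intro z hz
    have h1 : z.natAbs ∈ n.natAbs.divisors := by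
      rw [Nat.mem_divisors]; exact ⟨Int.natAbs_dvd_natAbs.mpr hz, by simpa using hn⟩
    rw [hZ, Finset.mem_union, Finset.mem_image, Finset.mem_image]
    rcases Int.natAbs_eq z with h | h
    · left; exact ⟨_, h1, h.symm⟩
    · right; exact ⟨_, h1, h.symm⟩
  have : (cubF X n).card ≤ (Z ×ˢ Z).card := by
    apply Finset.card_le_card_of_injOn (fun z => ((z.1.1:ℤ) - z.1.2, (z.1.2:ℤ) - z.2.2))
    · rintro ⟨⟨a,b⟩,⟨a',b'⟩⟩ hz
      simp only [cubF, Finset.coe_filter, Set.mem_setOf_eq] at hz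
      have h3 := cubF_id hz.2.1 hz.2.2
      simp only [Finset.coe_product, Set.mem_prod, Finset.mem_coe]
      constructor
      · apply hZm; exact ⟨3 * ((b:ℤ) - b') * (a + b'), by rw [← h3]; ring⟩
      · apply hZm; exact ⟨3 * ((a:ℤ) - b) * (a + b'), by rw [← h3]; ring⟩
    · rintro ⟨⟨a,b⟩,⟨a',b'⟩⟩ hz ⟨⟨u,v⟩,⟨u',v'⟩⟩ hy he
      simp only [cubF, Finset.coe_filter, Set.mem_setOf_eq] at hz hy
      simp only [Prod.mk.injEq] at he
      have h3 := cubF_id hz.2.1 hz.2.2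
      have h4 := cubF_id hy.2.1 hy.2.2
      have hne : 3 * ((a:ℤ) - b) * (b - b') ≠ 0 := by
        intro h0; rw [h0] at h3; simp at h3; exact hn h3.symm
      rw [← he.1, ← he.2, ← h3] at h4
      have h5 := mul_left_cancel₀ hne h4
      have h6 := hz.2.1
      have h7 := hy.2.1
      simp only [Prod.mk.injEq]
      omega
  refine this.trans ?_
  rw [Finset.card_product]
  calc _ ≤ (2*D) * (2*D) := Nat.mul_le_mul hZc hZc
    _ = _ := by ring

def cubT (X : ℕ) (A : Finset ℕ) : Finset (((ℕ × ℕ) × (ℕ × ℕ)) × ((ℕ × ℕ) × (ℕ × ℕ))) :=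
  (((Finset.Icc 1 X ×ˢ Finset.Icc 1 X) ×ˢ (Finset.Icc 1 X ×ˢ Finset.Icc 1 X)) ×ˢ ((A ×ˢ A) ×ˢ (A ×ˢ A))).filter (fun z =>
    (z.1.1.1:ℤ) - z.1.1.2 = z.1.2.1 - z.1.2.2 ∧ (z.1.1.1:ℤ)^3 - (z.1.1.2:ℤ)^3 - ((z.1.2.1:ℤ)^3 - (z.1.2.2:ℤ)^3)
      = (z.2.2.1:ℤ)^3 + (z.2.2.2:ℤ)^3 - ((z.2.1.1:ℤ)^3 + (z.2.1.2:ℤ)^3))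

lemma cubT_card (X D : ℕ) (A : Finset ℕ) (hA : A ⊆ Finset.Icc 1 X)
    (hD : ∀ n, 1 ≤ n → n ≤ 2 * X^3 → n.divisors.card ≤ D) :
    (cubT X A).card ≤ A.card^2 * (D+1) * (2 * X^2) + A.card^4 * (4 * D^2) := by
  set B := (A ×ˢ A) ×ˢ (A ×ˢ A) with hB
  have hXA : ∀ a ∈ A, a^3 ≤ X^3 := fun a ha => Nat.pow_le_pow_left (Finset.mem_Icc.mp (hA ha)).2 3
  let n : (ℕ × ℕ) × (ℕ × ℕ) → ℤ := fun w => (w.2.1:ℤ)^3 + (w.2.2:ℤ)^3 - ((w.1.1:ℤ)^3 + (w.1.2:ℤ)^3)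
  rw [Finset.card_eq_sum_card_fiberwise (f := fun z => z.2) (t := B) (by
    intro z hz
    have := (Finset.mem_filter.mp (Finset.mem_coe.mp hz)).1
    exact (Finset.mem_product.mp this).2)]
  have hfib : ∀ w ∈ B, ((cubT X A).filter (fun z => z.2 = w)).card ≤ (cubF X (n w)).card := by
    intro w hw
    apply Finset.card_le_card_of_injOn (fun z => z.1)
    · rintro ⟨z, w'⟩ hz
      simp only [cubT, Finset.coe_filter, Set.mem_setOf_eq, Finset.mem_filter] at hz
      obtain ⟨⟨h1, h2⟩, h3⟩ := hz
      subst h3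
      simp only [cubF, Finset.coe_filter, Set.mem_setOf_eq]
      exact ⟨(Finset.mem_product.mp h1).1, h2⟩
    · rintro ⟨z, w'⟩ hz ⟨y, w''⟩ hy h
      have h1 := (Finset.mem_filter.mp (Finset.mem_coe.mp hz)).2
      have h2 := (Finset.mem_filter.mp (Finset.mem_coe.mp hy)).2
      simp only at h h1 h2
      rw [h, h1, h2]
  have hq := quad_count 3 X D (by norm_num) A hA (fun m h1 h2 => hD m h1 (by omega))
  refine (Finset.sum_le_sum hfib).trans ?_
  rw [← Finset.sum_filter_add_sum_filter_not B (fun w => w.1.1^3 + w.1.2^3 = w.2.1^3 + w.2.2^3)]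
  apply add_le_add
  · calc _ ≤ ∑ w ∈ B.filter (fun w => w.1.1^3 + w.1.2^3 = w.2.1^3 + w.2.2^3), 2 * X^2 := by
          refine Finset.sum_le_sum fun w hw => ?_
          have h := (Finset.mem_filter.mp hw).2
          have : n w = 0 := by
            have : ((w.1.1:ℤ)^3 + (w.1.2:ℤ)^3) = (w.2.1:ℤ)^3 + (w.2.2:ℤ)^3 := by exact_mod_cast h
            simp only [n]; linarith
          rw [this]; exact cubF_zero X
      _ ≤ _ := by
          rw [Finset.sum_const, smul_eq_mul]
          exact Nat.mul_le_mul_right _ hq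
  · calc _ ≤ ∑ w ∈ B.filter (fun w => ¬ w.1.1^3 + w.1.2^3 = w.2.1^3 + w.2.2^3), 4 * D^2 := by
          refine Finset.sum_le_sum fun w hw => ?_
          obtain ⟨hm, h⟩ := Finset.mem_filter.mp hw
          simp only [hB, Finset.mem_product] at hm
          have b1 := hXA _ hm.1.1
          have b2 := hXA _ hm.1.2
          have b3 := hXA _ hm.2.1
          have b4 := hXA _ hm.2.2
          have e : n w = ((w.2.1^3 + w.2.2^3 : ℕ):ℤ) - ((w.1.1^3 + w.1.2^3 : ℕ):ℤ) := by simp only [n]; push_cast; ring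
          have hn : n w ≠ 0 := by rw [e]; omega
          apply cubF_ne X D (n w) hn
          apply hD
          · have := Int.natAbs_pos.mpr hn; omega
          · rw [e]; omega
      _ ≤ _ := by
          rw [Finset.sum_const, smul_eq_mul]
          refine Nat.mul_le_mul_right _ ((Finset.card_filter_le _ _).trans (le_of_eq ?_))
          simp only [hB, Finset.card_product]; ring

lemma weyl3 {P X : ℕ} [NeZero P] (hX : 1 ≤ X) (α : ZMod P) :
    ‖fA P 3 (Finset.Icc 1 X) α‖^4 ≤ (2*X+1:ℝ) * ∑ h ∈ Finset.Icc (-(X:ℤ)) X,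
      ‖∑ p ∈ (Finset.Icc 1 X ×ˢ Finset.Icc 1 X).filter (fun p => (p.1:ℤ) - p.2 = h),
        ZMod.stdAddChar (α * ((p.1:ZMod P)^3 - (p.2:ZMod P)^3))‖^2 := by
  have e1 : ‖fA P 3 (Finset.Icc 1 X) α‖^2 = ‖∑ p ∈ Finset.Icc 1 X ×ˢ Finset.Icc 1 X,
      ZMod.stdAddChar (α * ((p.1:ZMod P)^3 - (p.2:ZMod P)^3))‖ := by
    rw [sq]
    nth_rw 2 [← RCLike.norm_conj]
    rw [← norm_mul]
    congr 1
    unfold fA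
    rw [map_sum, Finset.sum_mul_sum, ← Finset.sum_product']
    refine Finset.sum_congr rfl fun p _ => ?_
    rw [conj_std, ← AddChar.map_add_eq_mul]
    congr 1; ring
  have e2 : ‖fA P 3 (Finset.Icc 1 X) α‖^2 ≤ ∑ h ∈ Finset.Icc (-(X:ℤ)) X,
      ‖∑ p ∈ (Finset.Icc 1 X ×ˢ Finset.Icc 1 X).filter (fun p => (p.1:ℤ) - p.2 = h),
        ZMod.stdAddChar (α * ((p.1:ZMod P)^3 - (p.2:ZMod P)^3))‖ := by
    rw [e1, ← Finset.sum_fiberwise_of_maps_to (g := fun p : ℕ × ℕ => (p.1:ℤ) - p.2) (t := Finset.Icc (-(X:ℤ)) X)]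
    · exact norm_sum_le _ _
    · intro p hp
      simp only [Finset.mem_product, Finset.mem_Icc] at hp ⊢
      omega
  calc ‖fA P 3 (Finset.Icc 1 X) α‖^4 = (‖fA P 3 (Finset.Icc 1 X) α‖^2)^2 := by ring
    _ ≤ _ := pow_le_pow_left₀ (by positivity) e2 2
    _ ≤ _ := sq_sum_le_card_mul_sum_sq
    _ = _ := by
      congr 1
      rw [Int.card_Icc]
      have : ((X:ℤ) + 1 - -(X:ℤ)).toNat = 2*X+1 := by omega
      rw [this]; push_cast; ring

lemma cub_mv {P X : ℕ} [NeZero P] (hX : 1 ≤ X) (hP : 6 * X^3 < P) (A : Finset ℕ) (hA : A ⊆ Finset.Icc 1 X) :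
    ∑ α : ZMod P, ‖fA P 3 A α‖^8 ≤ (2*X+1:ℝ) * (P * ((cubT X A).card : ℝ)) := by
  have h0 := fA_mono (P := P) (k := 3) hA 2 2
  refine h0.trans ?_
  set I2 := Finset.Icc 1 X ×ˢ Finset.Icc 1 X with hI2
  let F : ℤ → Finset (ℕ × ℕ) := fun h => I2.filter (fun p => (p.1:ℤ) - p.2 = h)
  let v : (ℕ × ℕ) × (ℕ × ℕ) → ZMod P := fun z => ((z.1.1:ZMod P)^3 - (z.1.2:ZMod P)^3) + ((z.2.1:ZMod P)^3 + (z.2.2:ZMod P)^3)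
  have e1 : ∀ α : ZMod P, ‖fA P 3 A α‖^(2*2) * ‖fA P 3 (Finset.Icc 1 X) α‖^(2*2) ≤
      (2*X+1:ℝ) * ∑ h ∈ Finset.Icc (-(X:ℤ)) X, ‖∑ z ∈ F h ×ˢ (A ×ˢ A), ZMod.stdAddChar (α * v z)‖^2 := by
    intro α
    have hf : fA P 3 A α ^ 2 = ∑ p ∈ A ×ˢ A, ZMod.stdAddChar (α * ((p.1:ZMod P)^3 + (p.2:ZMod P)^3)) := by
      unfold fA
      rw [sq, Finset.sum_mul_sum, ← Finset.sum_product']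
      refine Finset.sum_congr rfl fun p _ => ?_
      rw [mul_add, AddChar.map_add_eq_mul]
    calc _ ≤ ‖fA P 3 A α‖^(2*2) * _ := mul_le_mul_of_nonneg_left (weyl3 hX α) (by positivity)
      _ = _ := by
        rw [mul_left_comm, Finset.mul_sum]
        congr 1
        refine Finset.sum_congr rfl fun h _ => ?_
        rw [pow_mul, ← mul_pow, ← norm_pow, ← norm_mul, hf, mul_comm, Finset.sum_mul_sum, ← Finset.sum_product']
        congr 2
        refine Finset.sum_congr rfl fun z _ => ?_
        simp only [v]
        rw [mul_add α (_ - _), AddChar.map_add_eq_mul]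
  refine (Finset.sum_le_sum fun α _ => e1 α).trans ?_
  rw [← Finset.mul_sum, Finset.sum_comm]
  refine mul_le_mul_of_nonneg_left ?_ (by positivity)
  have e2 : ∀ h ∈ Finset.Icc (-(X:ℤ)) X, ∑ α : ZMod P, ‖∑ z ∈ F h ×ˢ (A ×ˢ A), ZMod.stdAddChar (α * v z)‖^2 ≤
      P * (((cubT X A).filter (fun z => (z.1.1.1:ℤ) - z.1.1.2 = h)).card : ℝ) := by
    intro h _
    rw [par_count]
    refine mul_le_mul_of_nonneg_left ?_ (by positivity)
    rw [Nat.cast_le]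
    apply Finset.card_le_card_of_injOn (fun z => ((z.1.1, z.2.1), (z.1.2, z.2.2)))
    · rintro ⟨⟨⟨a,b⟩,⟨q,r⟩⟩,⟨⟨a',b'⟩,⟨q',r'⟩⟩⟩ hz
      simp only [Finset.coe_filter, Set.mem_setOf_eq, Finset.mem_product, F, hI2, Finset.mem_filter] at hz
      obtain ⟨⟨⟨⟨⟨ha,hb⟩,h1⟩,hq,hr⟩,⟨⟨ha',hb'⟩,h2⟩,hq',hr'⟩,he⟩ := hz
      simp only [Finset.coe_filter, Set.mem_setOf_eq, cubT, Finset.mem_filter, Finset.mem_product]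
      refine ⟨⟨⟨⟨⟨ha,hb⟩,ha',hb'⟩,⟨hq,hr⟩,hq',hr'⟩, by omega, ?_⟩, h1⟩
      have hc : ∀ a ∈ Finset.Icc 1 X, a^3 ≤ X^3 := fun a ha => Nat.pow_le_pow_left (Finset.mem_Icc.mp ha).2 3
      have b1 := hc _ ha
      have b2 := hc _ hb
      have b3 := hc _ ha'
      have b4 := hc _ hb'
      have b5 := hc _ (hA hq)
      have b6 := hc _ (hA hr)
      have b7 := hc _ (hA hq')
      have b8 := hc _ (hA hr')
      have hn : ((a^3 + b'^3 + q^3 + r^3 : ℕ) : ZMod P) = ((a'^3 + b^3 + q'^3 + r'^3 : ℕ) : ZMod P) := by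
        simp only [v] at he
        push_cast
        linear_combination he
      rw [ZMod.natCast_eq_natCast_iff', Nat.mod_eq_of_lt (by omega), Nat.mod_eq_of_lt (by omega)] at hn
      have hn' : (a:ℤ)^3 + (b':ℤ)^3 + (q:ℤ)^3 + (r:ℤ)^3 = (a':ℤ)^3 + (b:ℤ)^3 + (q':ℤ)^3 + (r':ℤ)^3 := by exact_mod_cast hn
      linarith
    · rintro ⟨⟨p,q⟩,⟨p',q'⟩⟩ _ ⟨⟨u,w⟩,⟨u',w'⟩⟩ _ he
      simp only [Prod.mk.injEq] at he ⊢
      tauto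
  refine (Finset.sum_le_sum e2).trans ?_
  rw [← Finset.mul_sum]
  refine mul_le_mul_of_nonneg_left ?_ (by positivity)
  rw [← Nat.cast_sum, Nat.cast_le]
  refine le_of_eq (Eq.symm ?_)
  apply Finset.card_eq_sum_card_fiberwise (s := cubT X A) (f := fun z => (z.1.1.1:ℤ) - z.1.1.2) (t := Finset.Icc (-(X:ℤ)) X)
  intro z hz
  have := (Finset.mem_filter.mp (Finset.mem_coe.mp hz)).1
  simp only [Finset.mem_product, Finset.mem_Icc] at this
  simp only [Finset.coe_Icc, Set.mem_Icc]
  omega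

lemma good3 (c : ℝ) (hc : 1 < c) : Good 3 4 c := by
  have hic : 1 / c < 1 := by rw [div_lt_one (by linarith)]; exact hc
  set ε := 1 - 1/c with hε
  have hε0 : 0 < ε := by rw [hε]; linarith
  have hε1 : ε < 1 := by
    have : 0 < 1/c := by positivity
    rw [hε]; linarith
  obtain ⟨C, hC, hdiv⟩ := div_bound (ε/3) (by positivity)
  refine ⟨1152 * C^2, by nlinarith, fun X hX A hA hcard => ⟨6 * X^3 + 1, ⟨by omega⟩, ?_⟩⟩
  have hX1 : (1:ℝ) ≤ X := by exact_mod_cast hX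
  have hX0 : (0:ℝ) < X := by linarith
  haveI : NeZero (6 * X^3 + 1) := ⟨by omega⟩
  have h1 := cub_mv (P := 6 * X^3 + 1) hX (by omega) A hA
  set P : ℕ := 6 * X^3 + 1
  have hXe : (1:ℝ) ≤ (X:ℝ)^ε := Real.one_le_rpow hX1 hε0.le
  set Y := (X:ℝ)^ε with hY
  set D : ℕ := ⌊2 * C * Y⌋₊ with hD
  have hDr : (D:ℝ) ≤ 2 * C * Y := Nat.floor_le (by positivity)
  have hDd : ∀ n, 1 ≤ n → n ≤ 2 * X^3 → n.divisors.card ≤ D := by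
    intro n h1 h2
    apply Nat.le_floor
    refine (hdiv n h1).trans ?_
    have : (n:ℝ)^(ε/3) ≤ 2 * Y := by
      calc (n:ℝ)^(ε/3) ≤ (2 * (X:ℝ)^3)^(ε/3) := by
            refine Real.rpow_le_rpow (by positivity) ?_ (by positivity)
            exact_mod_cast h2
        _ = 2^(ε/3) * Y := by
            rw [Real.mul_rpow (by norm_num) (by positivity), ← Real.rpow_natCast, ← Real.rpow_mul (by linarith)]
            congr 2; push_cast; field_simp
        _ ≤ 2^(1:ℝ) * Y := by
            refine mul_le_mul_of_nonneg_right (Real.rpow_le_rpow_of_exponent_le (by norm_num) (by linarith)) (by positivity)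
        _ = _ := by rw [Real.rpow_one]
    nlinarith
  have hT : ((cubT X A).card:ℝ) ≤ (A.card:ℝ)^2 * (D+1) * (2 * X^2) + (A.card:ℝ)^4 * (4 * D^2) := by
    exact_mod_cast cubT_card X D A hA hDd
  set a := (A.card:ℝ) with ha
  have ha0 : 0 ≤ a := Nat.cast_nonneg _
  have haY : a * Y ≤ 2 * X := by
    calc a * Y ≤ 2 * (X:ℝ)^(1/c) * Y := by gcongr
      _ = 2 * ((X:ℝ)^(1/c) * Y) := by ring
      _ = _ := by rw [hY, ← Real.rpow_add hX0, hε, show 1/c + (1 - 1/c) = 1 by ring, Real.rpow_one]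
  have haX : a ≤ 2 * X := by nlinarith
  have haD : a * (D+1) ≤ 8 * C * X := by
    have : (D:ℝ) + 1 ≤ 4 * C * Y := by nlinarith
    calc a * (D+1) ≤ a * (4 * C * Y) := by gcongr
      _ = 4 * C * (a * Y) := by ring
      _ ≤ 4 * C * (2 * X) := by gcongr
      _ = _ := by ring
  have hD0 : (0:ℝ) ≤ D := Nat.cast_nonneg _
  have haD2 : a * D ≤ 4 * C * X := by
    calc a * D ≤ a * (2 * C * Y) := by gcongr
      _ = 2 * C * (a * Y) := by ring
      _ ≤ 2 * C * (2 * X) := by gcongr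
      _ = _ := by ring
  have t1 : a^2 * (D+1) * (2 * X^2) ≤ 32 * C^2 * X^4 := by
    calc a^2 * (D+1) * (2 * X^2) = a * (a * (D+1)) * (2 * X^2) := by ring
      _ ≤ (2*X) * (8 * C * X) * (2 * X^2) := by gcongr
      _ = 32 * C * 1 * X^4 := by ring
      _ ≤ 32 * C * C * X^4 := by gcongr
      _ = _ := by ring
  have t2 : a^4 * (4 * D^2) ≤ 256 * C^2 * X^4 := by
    calc a^4 * (4 * D^2) = 4 * a^2 * (a*D)^2 := by ring
      _ ≤ 4 * (2*X)^2 * (4*C*X)^2 := by gcongr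
      _ = _ := by ring
  have e3 : (X:ℝ)^(2*4) / (X:ℝ)^3 = (X:ℝ)^5 := by field_simp
  rw [e3]
  have hp0 : (0:ℝ) ≤ P := Nat.cast_nonneg _
  calc _ ≤ _ := h1
    _ ≤ (3*X:ℝ) * (P * (288 * C^2 * X^4)) := by
      refine mul_le_mul (by linarith) (mul_le_mul_of_nonneg_left (by linarith) hp0) (by positivity) (by positivity)
    _ = 864 * (C^2 * P * X^5) := by ring
    _ ≤ 1152 * (C^2 * P * X^5) := by gcongr; norm_num
    _ = _ := by ring

lemma good_all (d : ℕ) (hd : 2 ≤ d) (c : ℝ) (hc : 1 < c) : Good d (d^2/2) c := by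
  rcases Nat.lt_or_ge d 4 with h | h
  · interval_cases d
    · exact good2 c hc
    · exact good3 c hc
  · obtain ⟨κ, rfl⟩ : ∃ κ, d = κ + 2 := ⟨d-2, by omega⟩
    exact W4 κ _ (by omega) rfl c hc

lemma eC_add (a b : ℝ) : eC (a + b) = eC a * eC b := by
  unfold eC; rw [← Complex.exp_add]; congr 1; push_cast; ring

lemma eC_sum {ι : Type*} (s : Finset ι) (f : ι → ℝ) : eC (∑ i ∈ s, f i) = ∏ i ∈ s, eC (f i) := by
  induction s using Finset.induction_on with
  | empty => simp [eC]
  | insert a s ha ih => rw [Finset.sum_insert ha, Finset.prod_insert ha, eC_add, ih]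

lemma eC_conj (a : ℝ) : (starRingEnd ℂ) (eC a) = eC (-a) := by
  unfold eC; rw [← Complex.exp_conj]; congr 1; simp [Complex.conj_ofNat]

lemma eC_cont (n : ℝ) : Continuous (fun θ : ℝ => eC (θ * n)) := by
  unfold eC; fun_prop

lemma eC_integral (n : ℤ) : ∫ θ in (0:ℝ)..1, eC (θ * n) = if n = 0 then 1 else 0 := by
  split_ifs with h
  · subst h; simp [eC]
  · have hne : (2 * Real.pi * Complex.I * n : ℂ) ≠ 0 := by
      have : (n:ℂ) ≠ 0 := by exact_mod_cast h
      have := Real.pi_ne_zero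
      simp [*]
    have e : ∀ θ : ℝ, eC (θ * n) = Complex.exp ((2 * Real.pi * Complex.I * n) * θ) := by
      intro θ; unfold eC; congr 1; push_cast; ring
    simp_rw [e]
    rw [integral_exp_mul_complex hne]
    have : Complex.exp ((2 * Real.pi * Complex.I * n) * ((1:ℝ):ℂ)) = 1 := by
      rw [Complex.exp_eq_one_iff]; exact ⟨n, by push_cast; ring⟩
    rw [this]; simp

lemma torus_bound {ι : Type*} (s : Finset ι) (a : ι → ℝ) (v : ι → ℤ) (M : ℝ) (hM : ∀ i ∈ s, |a i| ≤ M) :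
    ∫ θ in (0:ℝ)..1, ‖∑ i ∈ s, (a i : ℂ) * eC (θ * v i)‖^2 ≤
      M^2 * (((s ×ˢ s).filter (fun p => v p.1 = v p.2)).card : ℝ) := by
  have e1 : ∀ θ : ℝ, ((‖∑ i ∈ s, (a i : ℂ) * eC (θ * v i)‖^2 : ℝ) : ℂ) =
      ∑ p ∈ s ×ˢ s, ((a p.1 * a p.2 : ℝ) : ℂ) * eC (θ * ((v p.1 - v p.2 : ℤ):ℝ)) := by
    intro θ
    rw [Complex.ofReal_pow, ← Complex.mul_conj', map_sum, Finset.sum_mul_sum, ← Finset.sum_product']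
    refine Finset.sum_congr rfl fun p _ => ?_
    rw [map_mul, eC_conj, Complex.conj_ofReal]
    have : θ * ((v p.1 - v p.2 : ℤ):ℝ) = θ * v p.1 + -(θ * v p.2) := by push_cast; ring
    rw [this, eC_add]; push_cast; ring
  have e2 : ∫ θ in (0:ℝ)..1, ‖∑ i ∈ s, (a i : ℂ) * eC (θ * v i)‖^2 =
      ∑ p ∈ s ×ˢ s, if v p.1 = v p.2 then a p.1 * a p.2 else 0 := by
    have : ((∫ θ in (0:ℝ)..1, ‖∑ i ∈ s, (a i : ℂ) * eC (θ * v i)‖^2 : ℝ) : ℂ) =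
        ((∑ p ∈ s ×ˢ s, if v p.1 = v p.2 then a p.1 * a p.2 else 0 : ℝ) : ℂ) := by
      rw [← intervalIntegral.integral_ofReal]
      simp_rw [e1]
      rw [intervalIntegral.integral_finset_sum]
      · push_cast
        refine Finset.sum_congr rfl fun p _ => ?_
        rw [intervalIntegral.integral_const_mul]
        have := eC_integral (v p.1 - v p.2)
        push_cast at this ⊢
        rw [this]
        by_cases h : v p.1 = v p.2
        · simp [h]
        · have : ¬ (v p.1 - v p.2 = 0) := by omega
          simp [h, this]
      · intro p _
        exact ((continuous_const.mul (eC_cont _))).intervalIntegrable _ _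
    exact_mod_cast this
  rw [e2, ← Finset.sum_filter]
  calc _ ≤ ∑ p ∈ (s ×ˢ s).filter (fun p => v p.1 = v p.2), M^2 := by
        refine Finset.sum_le_sum fun p hp => ?_
        have hm := Finset.mem_product.mp (Finset.mem_filter.mp hp).1
        have h1 := hM _ hm.1
        have h2 := hM _ hm.2
        calc _ ≤ |a p.1 * a p.2| := le_abs_self _
          _ = |a p.1| * |a p.2| := abs_mul _ _
          _ ≤ M * M := mul_le_mul h1 h2 (abs_nonneg _) ((abs_nonneg _).trans h1)
          _ = _ := by ring
    _ = _ := by rw [Finset.sum_const, nsmul_eq_mul]; ring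

lemma FT_moment (d x s : ℕ) (c : ℝ) (b : ℕ) (τ : ℤ → ℝ) (hW : 0 < Wps d x) (A : Finset ℕ)
    (hA : ∀ m, m ∈ PS c → m ≤ x → m ∈ A) (hτ : tauSpec d x c b τ) (M : ℝ) (hM : ∀ n, |τ n| ≤ M)
    (P : ℕ) [NeZero P] :
    (P:ℝ) * (∫ θ in (0:ℝ)..1, ‖FT (fun n => (τ n : ℂ)) θ‖ ^ (2*s)) ≤ (M^s)^2 * ∑ α : ZMod P, ‖fA P d A α‖^(2*s) := by
  set W : ℤ := (Wps d x : ℤ) with hWd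
  have hW0 : W ≠ 0 := by rw [hWd]; exact_mod_cast hW.ne'
  set V : Finset ℤ := (A.image (fun m : ℕ => ((m:ℤ)^d + b) / W)).filter (fun n => ∃ m ∈ A, W * n - b = (m:ℤ)^d) with hV
  have hsup : Function.support τ ⊆ V := by
    intro n hn
    by_contra hc
    apply hn
    apply hτ.2
    rintro ⟨m, h1, h2, h3⟩
    apply hc
    have hm := hA m h1 h2
    rw [hV, Finset.mem_coe, Finset.mem_filter, Finset.mem_image]
    refine ⟨⟨m, hm, ?_⟩, m, hm, h3⟩
    rw [← h3, sub_add_cancel, Int.mul_ediv_cancel_left _ hW0]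
  have hFT : ∀ θ, FT (fun n => (τ n : ℂ)) θ = ∑ n ∈ V, (τ n : ℂ) * eC (θ * n) := by
    intro θ
    unfold FT
    apply finsum_eq_sum_of_support_subset
    intro n hn
    apply hsup
    intro h0
    apply hn
    simp [h0]
  have hr : ∀ n : ℤ, ∃ m : ℕ, n ∈ V → m ∈ A ∧ W * n - b = (m:ℤ)^d := by
    intro n
    by_cases hn : n ∈ V
    · obtain ⟨m, h1, h2⟩ := (Finset.mem_filter.mp hn).2
      exact ⟨m, fun _ => ⟨h1, h2⟩⟩
    · exact ⟨0, fun h => absurd h hn⟩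
  choose r hr using hr
  set Y := Fintype.piFinset (fun _ : Fin s => V) with hY
  set Z := Fintype.piFinset (fun _ : Fin s => A) with hZ
  have e1 : ∀ θ, ‖FT (fun n => (τ n : ℂ)) θ‖ ^ (2*s) =
      ‖∑ y ∈ Y, ((∏ i, τ (y i) : ℝ) : ℂ) * eC (θ * ((∑ i, y i : ℤ) : ℝ))‖^2 := by
    intro θ
    rw [mul_comm 2 s, pow_mul, ← norm_pow, hFT, Finset.sum_pow']
    congr 2
    refine Finset.sum_congr rfl fun y _ => ?_
    rw [Finset.prod_mul_distrib]
    push_cast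
    rw [Finset.mul_sum, eC_sum]
  simp_rw [e1]
  have hb := torus_bound Y (fun y => ∏ i, τ (y i)) (fun y => ∑ i, y i) (M^s) (by
    intro y _
    rw [Finset.abs_prod]
    calc _ ≤ ∏ i : Fin s, M := Finset.prod_le_prod (fun i _ => abs_nonneg _) (fun i _ => hM _)
      _ = _ := by simp)
  have e2 : ∑ α : ZMod P, ‖fA P d A α‖^(2*s) = P * (((Z ×ˢ Z).filter (fun p => (∑ i, (p.1 i : ZMod P)^d) = ∑ i, (p.2 i : ZMod P)^d)).card : ℝ) := by
    rw [← par_count Z (fun y => ∑ i, (y i : ZMod P)^d)]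
    refine Finset.sum_congr rfl fun α _ => ?_
    rw [mul_comm 2 s, pow_mul, ← norm_pow, fA_pow]
  rw [e2]
  have hcnt : ((Y ×ˢ Y).filter (fun p => ∑ i, p.1 i = ∑ i, p.2 i)).card ≤
      ((Z ×ˢ Z).filter (fun p => (∑ i, (p.1 i : ZMod P)^d) = ∑ i, (p.2 i : ZMod P)^d)).card := by
    apply Finset.card_le_card_of_injOn (fun p => (fun i => r (p.1 i), fun i => r (p.2 i)))
    · intro p hp
      obtain ⟨h1, h2⟩ := Finset.mem_filter.mp (Finset.mem_coe.mp hp)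
      obtain ⟨h3, h4⟩ := Finset.mem_product.mp h1
      rw [hY, Fintype.mem_piFinset] at h3 h4
      rw [Finset.mem_coe, Finset.mem_filter, Finset.mem_product, hZ, Fintype.mem_piFinset, Fintype.mem_piFinset]
      refine ⟨⟨fun i => (hr _ (h3 i)).1, fun i => (hr _ (h4 i)).1⟩, ?_⟩
      have key : ∀ y : Fin s → ℤ, (∀ i, y i ∈ V) → ∑ i, (r (y i) : ℤ)^d = W * ∑ i, y i - s * b := by
        intro y hy
        rw [Finset.sum_congr rfl (fun i _ => ((hr _ (hy i)).2).symm), Finset.sum_sub_distrib, ← Finset.mul_sum]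
        simp
      have := (key _ h3).trans ((congrArg (fun t => W * t - s * b) h2).trans (key _ h4).symm)
      have h5 := congrArg (fun t : ℤ => (t : ZMod P)) this
      push_cast at h5
      exact h5
    · intro p hp q hq he
      have hp1 := Finset.mem_product.mp (Finset.mem_filter.mp (Finset.mem_coe.mp hp)).1
      have hq1 := Finset.mem_product.mp (Finset.mem_filter.mp (Finset.mem_coe.mp hq)).1
      rw [hY, Fintype.mem_piFinset, Fintype.mem_piFinset] at hp1 hq1
      have inj : ∀ n ∈ V, ∀ n' ∈ V, r n = r n' → n = n' := by
        intro n hn n' hn' h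
        have h1 := (hr n hn).2
        have h2 := (hr n' hn').2
        rw [h, ← h2] at h1
        exact mul_left_cancel₀ hW0 (by linarith)
      simp only [Prod.mk.injEq] at he
      refine Prod.ext (funext fun i => ?_) (funext fun i => ?_)
      · exact inj _ (hp1.1 i) _ (hq1.1 i) (congrFun he.1 i)
      · exact inj _ (hp1.2 i) _ (hq1.2 i) (congrFun he.2 i)
  have hcnt' : (((Y ×ˢ Y).filter (fun p => ∑ i, p.1 i = ∑ i, p.2 i)).card : ℝ) ≤
      (((Z ×ˢ Z).filter (fun p => (∑ i, (p.1 i : ZMod P)^d) = ∑ i, (p.2 i : ZMod P)^d)).card : ℝ) := by exact_mod_cast hcnt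
  calc _ ≤ (P:ℝ) * ((M^s)^2 * _) := mul_le_mul_of_nonneg_left (hb.trans (mul_le_mul_of_nonneg_left hcnt' (by positivity))) (Nat.cast_nonneg _)
    _ = _ := by ring

lemma PS_card (c : ℝ) (hc : 1 < c) (X : ℕ) (hX : 1 ≤ X) :
    (((Finset.Icc 1 X).filter (fun m => m ∈ PS c)).card : ℝ) ≤ 2 * (X:ℝ)^(1/c) := by
  have hX1 : (1:ℝ) ≤ X := by exact_mod_cast hX
  have hc0 : 0 < c := by linarith
  have hr : ∀ m : ℕ, ∃ n : ℕ, m ∈ PS c → 0 < n ∧ m = ⌊(n : ℝ) ^ c⌋₊ := by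
    intro m
    by_cases h : m ∈ PS c
    · obtain ⟨n, hn⟩ := h; exact ⟨n, fun _ => hn⟩
    · exact ⟨0, fun h' => absurd h' h⟩
  choose r hr using hr
  have h1 : ((Finset.Icc 1 X).filter (fun m => m ∈ PS c)).card ≤ (Finset.Icc 1 ⌊2 * (X:ℝ)^(1/c)⌋₊).card := by
    apply Finset.card_le_card_of_injOn r
    · intro m hm
      obtain ⟨h1, h2⟩ := Finset.mem_filter.mp (Finset.mem_coe.mp hm)
      obtain ⟨h3, h4⟩ := hr m h2
      rw [Finset.mem_coe, Finset.mem_Icc]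
      refine ⟨h3, Nat.le_floor ?_⟩
      have h5 : (r m : ℝ)^c ≤ 2 * X := by
        have := Nat.lt_floor_add_one ((r m : ℝ)^c)
        rw [← h4] at this
        have h6 : (m:ℝ) ≤ X := by exact_mod_cast (Finset.mem_Icc.mp h1).2
        linarith
      calc (r m : ℝ) = ((r m : ℝ)^c)^(1/c) := by
            rw [← Real.rpow_mul (Nat.cast_nonneg _), mul_one_div_cancel hc0.ne', Real.rpow_one]
        _ ≤ (2 * X)^(1/c) := Real.rpow_le_rpow (by positivity) h5 (by positivity)
        _ = 2^(1/c) * (X:ℝ)^(1/c) := Real.mul_rpow (by norm_num) (by positivity)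
        _ ≤ 2^(1:ℝ) * (X:ℝ)^(1/c) := by
            refine mul_le_mul_of_nonneg_right (Real.rpow_le_rpow_of_exponent_le (by norm_num) ?_) (by positivity)
            rw [div_le_one hc0]; exact hc.le
        _ = _ := by rw [Real.rpow_one]
    · intro m hm m' hm' h
      have h1 := (hr m (Finset.mem_filter.mp (Finset.mem_coe.mp hm)).2).2
      have h2 := (hr m' (Finset.mem_filter.mp (Finset.mem_coe.mp hm')).2).2
      rw [h1, h2, h]
  rw [Nat.card_Icc, Nat.add_sub_cancel] at h1
  calc _ ≤ ((⌊2 * (X:ℝ)^(1/c)⌋₊ : ℕ) : ℝ) := by exact_mod_cast h1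
    _ ≤ _ := Nat.floor_le (by positivity)

lemma PS_pos (c : ℝ) (hc : 1 < c) (m : ℕ) (hm : m ∈ PS c) : 1 ≤ m := by
  obtain ⟨n, hn, rfl⟩ := hm
  apply Nat.le_floor
  rw [Nat.cast_one]
  exact Real.one_le_rpow (by exact_mod_cast hn) (by linarith)

lemma Wps_pos (d x : ℕ) (hd : 2 ≤ d) : 0 < Wps d x := by
  unfold Wps
  have : 0 < ∏ p ∈ Finset.filter Nat.Prime (Finset.Iic ⌊wps x⌋₊), p :=
    Finset.prod_pos fun p hp => (Finset.mem_filter.mp hp).2.pos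
  positivity

lemma tau_le (d x : ℕ) (hd : 2 ≤ d) (c : ℝ) (hc : 1 < c) (b : ℕ) (τ : ℤ → ℝ) (hτ : tauSpec d x c b τ) (n : ℤ) :
    |τ n| ≤ c * (x:ℝ)^((d:ℝ) - 1/c) := by
  have hc0 : 0 < c := by linarith
  by_cases h : ∃ m : ℕ, m ∈ PS c ∧ m ≤ x ∧ (Wps d x : ℤ) * n - (b : ℤ) = (m : ℤ) ^ d
  · obtain ⟨m, h1, h2, h3⟩ := h
    rw [hτ.1 n m h1 h2 h3]
    have hs : c / (sigmaPS d (Wps d x) b : ℝ) ≤ c := by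
      rcases Nat.eq_zero_or_pos (sigmaPS d (Wps d x) b) with h | h
      · rw [h]; simp; linarith
      · apply div_le_self hc0.le; exact_mod_cast h
    rw [abs_of_nonneg (by positivity)]
    have hic : 1 / c < 1 := by rw [div_lt_one (by linarith)]; exact hc
    have hd' : (2:ℝ) ≤ d := by exact_mod_cast hd
    have : (m:ℝ)^((d:ℝ) - 1/c) ≤ (x:ℝ)^((d:ℝ) - 1/c) :=
      Real.rpow_le_rpow (by positivity) (by exact_mod_cast h2) (by linarith)
    gcongr
  · rw [hτ.2 n h, abs_zero]; positivity

lemma first_bound (d : ℕ) (hd : 2 ≤ d) (c : ℝ) (hc : 1 < c) :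
    ∃ C : ℝ, 1 ≤ C ∧ ∀ x : ℕ, 3 ≤ x → ∀ b : ℕ, ∀ τ : ℤ → ℝ, tauSpec d x c b τ →
          (∫ θ in (0:ℝ)..1, ‖FT (fun n => (τ n : ℂ)) θ‖ ^ (Sd d)) ≤
              C * (x : ℝ) ^ (((d : ℝ) - 1 / c) * (Sd d : ℝ) + (Sd d : ℝ) - (d : ℝ)) := by
  obtain ⟨C, hC, h⟩ := good_all d hd c hc
  set s := d^2/2 with hs
  have hS : Sd d = 2 * s := rfl
  have hc2 : 1 ≤ c^(2*s) := one_le_pow₀ hc.le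
  refine ⟨c^(2*s) * C, by nlinarith, fun x hx b τ hτ => ?_⟩
  have hx0 : (0:ℝ) < x := by exact_mod_cast (by omega : 0 < x)
  obtain ⟨P, hP, hg⟩ := h x (by omega) ((Finset.Icc 1 x).filter (fun m => m ∈ PS c)) (Finset.filter_subset _ _)
    (PS_card c hc x (by omega))
  have hm := FT_moment d x s c b τ (Wps_pos d x hd) ((Finset.Icc 1 x).filter (fun m => m ∈ PS c))
    (fun m h1 h2 => Finset.mem_filter.mpr ⟨Finset.mem_Icc.mpr ⟨PS_pos c hc m h1, h2⟩, h1⟩) hτ _ (tau_le d x hd c hc b τ hτ) P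
  rw [hS]
  set I := ∫ θ in (0:ℝ)..1, ‖FT (fun n => (τ n : ℂ)) θ‖ ^ (2*s)
  have hP0 : (0:ℝ) < P := by exact_mod_cast Nat.pos_of_ne_zero hP.out
  have h2 : (P:ℝ) * I ≤ P * (((c * (x:ℝ)^((d:ℝ) - 1/c))^s)^2 * (C * ((x:ℝ)^(2*s) / (x:ℝ)^d))) := by
    calc _ ≤ _ := hm
      _ ≤ _ := mul_le_mul_of_nonneg_left hg (by positivity)
      _ = _ := by ring
  refine (le_of_mul_le_mul_left h2 hP0).trans (le_of_eq ?_)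
  have e1 : (x : ℝ) ^ (((d : ℝ) - 1 / c) * ((2*s : ℕ) : ℝ) + ((2*s : ℕ) : ℝ) - (d : ℝ)) =
      ((x:ℝ)^((d:ℝ) - 1/c))^(2*s) * (x:ℝ)^(2*s) / (x:ℝ)^d := by
    rw [Real.rpow_sub hx0, Real.rpow_add hx0, Real.rpow_mul hx0.le, Real.rpow_natCast, Real.rpow_natCast, Real.rpow_natCast]
  rw [e1, ← pow_mul, mul_comm s 2, mul_pow]
  ring

lemma c2_le (d : ℕ) (hd : 2 ≤ d) : c2ps d ≤ 1/2 := by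
  unfold c2ps
  have gen : ∀ t S : ℝ, 0 < t → t ≤ 1 → 4 ≤ S → 2 * t / (4 * S + 1 - t) ≤ 1/2 := by
    intro t S h0 h1 h4
    rw [div_le_div_iff₀ (by linarith) (by norm_num)]; linarith
  have hS : (4:ℝ) ≤ (Sd d : ℝ) := by
    have : 4 ≤ Sd d := by
      unfold Sd
      have : 2^2 ≤ d^2 := Nat.pow_le_pow_left hd 2
      omega
    exact_mod_cast this
  have hd' : (2:ℝ) ≤ d := by exact_mod_cast hd
  split_ifs
  · norm_num
  · norm_num
  · have h1 : (2:ℝ) ≤ (d : ℝ) * ((d : ℝ) + 1) ^ 2 - 1 := by nlinarith [mul_nonneg (by linarith : (0:ℝ) ≤ d - 2) (by linarith : (0:ℝ) ≤ d), sq_nonneg ((d:ℝ)+1)]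
    apply gen _ _ _ _ hS
    · unfold hD; apply div_pos <;> linarith
    · unfold hD; rw [div_le_one] <;> linarith
  · have h1 : (2:ℝ) ≤ 27 * (d : ℝ)^2 - 14 := by nlinarith
    apply gen _ _ _ _ hS
    · unfold kD; apply div_pos <;> linarith
    · unfold kD; rw [div_le_one] <;> linarith
  · have h1 : (2:ℝ) ≤ 27 * (d : ℝ)^2 - 5 := by nlinarith
    apply gen _ _ _ _ hS
    · unfold lD; apply div_pos <;> linarith
    · unfold lD; rw [div_le_one] <;> linarith

lemma Wps_le (d x : ℕ) (hx : 1 ≤ Real.log x) : (Wps d x : ℝ) ≤ 4 * (d:ℝ)^3 * (Real.log x)^(Real.log 2) := by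
  have hw : 0 ≤ wps x := by unfold wps; have := Real.log_nonneg hx; positivity
  have h1 : (∏ p ∈ Finset.filter Nat.Prime (Finset.Iic ⌊wps x⌋₊), p) ≤ 4 ^ ⌊wps x⌋₊ := by
    have := primorial_le_four_pow ⌊wps x⌋₊
    unfold primorial at this
    convert this using 3
    ext; simp [Nat.lt_succ_iff]
  have h2 : ((∏ p ∈ Finset.filter Nat.Prime (Finset.Iic ⌊wps x⌋₊), p : ℕ) : ℝ) ≤ (Real.log x)^(Real.log 2) := by
    calc _ ≤ ((4 ^ ⌊wps x⌋₊ : ℕ) : ℝ) := by exact_mod_cast h1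
      _ = (4:ℝ)^((⌊wps x⌋₊ : ℕ):ℝ) := by rw [Real.rpow_natCast]; push_cast; rfl
      _ ≤ (4:ℝ)^(wps x) := Real.rpow_le_rpow_of_exponent_le (by norm_num) (Nat.floor_le hw)
      _ = _ := by
        rw [Real.rpow_def_of_pos (by norm_num), Real.rpow_def_of_pos (by linarith)]
        congr 1
        have : Real.log 4 = 2 * Real.log 2 := by
          rw [show (4:ℝ) = 2^2 by norm_num, Real.log_pow]; push_cast; ring
        rw [this]; unfold wps; ring
  unfold Wps
  push_cast at h2 ⊢
  gcongr

lemma second_bound (d : ℕ) (hd : 2 ≤ d) (c : ℝ) (hc : 1 < c) (hc2 : c < 1 + c2ps d) :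
    ∃ C : ℝ, 1 ≤ C ∧ ∀ x : ℕ, 3 ≤ x →
            (x : ℝ) ^ (((d : ℝ) - 1 / c) * (Sd d : ℝ) + (Sd d : ℝ) - (d : ℝ)) *
                Real.log x ≤
              C * (Nps d x : ℝ) ^ ((Sd d : ℝ) * (1 + (1 - 1 / c) / (d : ℝ)) - 1) *
                (Real.log x) ^ (Sd d) := by
  have hS4 : 4 ≤ Sd d := by
    unfold Sd
    have : 2^2 ≤ d^2 := Nat.pow_le_pow_left hd 2
    omega
  have hS : (4:ℝ) ≤ (Sd d : ℝ) := by exact_mod_cast hS4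
  have hd' : (2:ℝ) ≤ d := by exact_mod_cast hd
  have hc0 : 0 < c := by linarith
  set E := (Sd d : ℝ) * (1 + (1 - 1 / c) / (d : ℝ)) - 1 with hE
  have hcc := c2_le d hd
  have hic : 1 / c < 1 := by rw [div_lt_one (by linarith)]; exact hc
  have hic2 : 1/3 ≤ 1/c := by
    apply one_div_le_one_div_of_le hc0; linarith
  have hic3 : 1 - 1/c ≤ 1/2 := by
    have : 1 - 1/c ≤ c - 1 := by
      rw [sub_le_iff_le_add]
      have : 2 ≤ c + 1/c := by
        have h : c + 1/c - 2 = (c-1)^2/c := by field_simp; ring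
        have : 0 ≤ (c-1)^2/c := by positivity
        linarith
      linarith
    linarith
  set q := (1 - 1 / c) / (d : ℝ) with hq
  have hq0 : 0 ≤ q := by rw [hq]; apply div_nonneg <;> linarith
  have hq1 : q ≤ 1/4 := by rw [hq, div_le_iff₀ (by linarith)]; linarith
  have hE0 : 0 ≤ E := by rw [hE]; nlinarith
  have hEl : Real.log 2 * E ≤ (Sd d : ℝ) - 1 := by
    have h1 := Real.log_two_lt_d9
    have h2 : Real.log 2 * E ≤ 0.7 * E := mul_le_mul_of_nonneg_right (by linarith) hE0
    have h3 : E ≤ (Sd d : ℝ) * (1 + 1/4) - 1 := by rw [hE]; nlinarith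
    linarith
  refine ⟨(4 * (d:ℝ)^3)^E, ?_, fun x hx => ?_⟩
  · apply Real.one_le_rpow _ hE0
    have : (1:ℝ) ≤ (d:ℝ)^3 := one_le_pow₀ (by linarith)
    linarith
  have hx0 : (0:ℝ) < x := by exact_mod_cast (by omega : 0 < x)
  have hL : 1 ≤ Real.log x := by
    rw [Real.le_log_iff_exp_le hx0]
    have h1 := Real.exp_one_lt_d9
    have : (3:ℝ) ≤ x := by exact_mod_cast hx
    linarith
  have hW0 : (0:ℝ) < Wps d x := by exact_mod_cast Wps_pos d x hd
  have hN : (x:ℝ)^d ≤ (Wps d x : ℝ) * Nps d x := by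
    have : (x:ℝ)^d / (Wps d x : ℝ) ≤ Nps d x := by
      unfold Nps; push_cast; exact (Nat.lt_floor_add_one _).le
    rw [div_le_iff₀ hW0] at this; linarith
  have hWl := Wps_le d x hL
  set L := Real.log x with hLdef
  have hL0 : 0 < L := by linarith
  have e1 : (x : ℝ) ^ (((d : ℝ) - 1 / c) * (Sd d : ℝ) + (Sd d : ℝ) - (d : ℝ)) = ((x:ℝ)^d)^E := by
    rw [← Real.rpow_natCast, ← Real.rpow_mul hx0.le]
    congr 1
    rw [hE, hq]; field_simp; ring
  rw [e1]
  have e2 : ((x:ℝ)^d)^E ≤ (4 * (d:ℝ)^3)^E * (Nps d x : ℝ)^E * L^(Real.log 2 * E) := by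
    calc ((x:ℝ)^d)^E ≤ ((4 * (d:ℝ)^3 * L^(Real.log 2)) * Nps d x)^E := by
          refine Real.rpow_le_rpow (by positivity) (hN.trans ?_) hE0
          exact mul_le_mul_of_nonneg_right hWl (Nat.cast_nonneg _)
      _ = _ := by
          rw [Real.mul_rpow (by positivity) (by positivity), Real.mul_rpow (by positivity) (by positivity), ← Real.rpow_mul hL0.le]
          ring
  have e3 : L^(Real.log 2 * E) * L ≤ L^(Sd d) := by
    calc L^(Real.log 2 * E) * L ≤ L^((Sd d : ℝ) - 1) * L :=
          mul_le_mul_of_nonneg_right (Real.rpow_le_rpow_of_exponent_le hL hEl) hL0.le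
      _ = L^((Sd d : ℝ) - 1) * L^(1:ℝ) := by rw [Real.rpow_one]
      _ = _ := by rw [← Real.rpow_add hL0, sub_add_cancel, Real.rpow_natCast]
  calc ((x:ℝ)^d)^E * L ≤ ((4 * (d:ℝ)^3)^E * (Nps d x : ℝ)^E * L^(Real.log 2 * E)) * L :=
        mul_le_mul_of_nonneg_right e2 hL0.le
    _ = (4 * (d:ℝ)^3)^E * (Nps d x : ℝ)^E * (L^(Real.log 2 * E) * L) := by ring
    _ ≤ _ := mul_le_mul_of_nonneg_left e3 (by positivity)

/-- the mean value bound
`∫₀¹ |τ̂(θ)|^{S(d)} dθ ≪ x^{(d−1/c)S(d)+S(d)−d} L ≪ N^{S(d)(1+(1−1/c)/d)−1} L^{S(d)}`. -/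
theorem stmt15 (d : ℕ) (hd : 2 ≤ d) (c : ℝ) (hc1 : 1 < c) (hc2 : c < 1 + c2ps d) :
    ∃ C : ℝ, 0 < C ∧ ∃ x₀ : ℕ, ∀ x : ℕ, x₀ ≤ x →
      ∀ b : ℕ, bSpec d x b →
        ∀ τ : ℤ → ℝ, tauSpec d x c b τ →
          (∫ θ in (0:ℝ)..1, ‖FT (fun n => (τ n : ℂ)) θ‖ ^ (Sd d)) ≤
              C * (x : ℝ) ^ (((d : ℝ) - 1 / c) * (Sd d : ℝ) + (Sd d : ℝ) - (d : ℝ)) *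
                Real.log x ∧
            (x : ℝ) ^ (((d : ℝ) - 1 / c) * (Sd d : ℝ) + (Sd d : ℝ) - (d : ℝ)) *
                Real.log x ≤
              C * (Nps d x : ℝ) ^ ((Sd d : ℝ) * (1 + (1 - 1 / c) / (d : ℝ)) - 1) *
                (Real.log x) ^ (Sd d) := by
  obtain ⟨C1, hC1, h1⟩ := first_bound d hd c hc1
  obtain ⟨C2, hC2, h2⟩ := second_bound d hd c hc1 hc2
  refine ⟨C1 + C2, by linarith, 3, fun x hx b _ τ hτ => ?_⟩
  have hx0 : (0:ℝ) < x := by exact_mod_cast (by omega : 0 < x)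
  have hL : 1 ≤ Real.log x := by
    rw [Real.le_log_iff_exp_le hx0]
    have h1 := Real.exp_one_lt_d9
    have : (3:ℝ) ≤ x := by exact_mod_cast hx
    linarith
  constructor
  · refine (h1 x hx b τ hτ).trans ?_
    calc _ ≤ (C1 + C2) * (x : ℝ) ^ (((d : ℝ) - 1 / c) * (Sd d : ℝ) + (Sd d : ℝ) - (d : ℝ)) * 1 := by
          rw [mul_one]
          exact mul_le_mul_of_nonneg_right (by linarith) (by positivity)
      _ ≤ _ := mul_le_mul_of_nonneg_left hL (by positivity)
  · refine (h2 x hx).trans ?_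
    refine mul_le_mul_of_nonneg_right (mul_le_mul_of_nonneg_right (by linarith) (by positivity)) (by positivity)
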